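/- For every ε > 0 there exist constants c > 0 and C > 0 such that for all sufficiently large x, |Σ_{p ≤ x} {x/p} − li_f(x)| ≤ C · x · e^{-c(log x)^{3/5-ε}}, where the sum is over primes p ≤ x. -/

import Mathlib

open Filter Real MeasureTheory
open scoped Classical

/-- `lif x = ∫₂^x {x/t}/log t dt`. -/
noncomputable def lif (x : ℝ) : ℝ := ∫ t in (2:ℝ)..x, Int.fract (x / t) / Real.log t

namespace VK
open Metric
open Finset (sum_congr card_product mem_filter mem_product coe_filter card_le_card mem_image_of_mem sum_comm mul_sum sum_le_sum mem_image sum_product sum_filter sum_const single_le_sum mem_univ sum_insert prod_univ_sum univ card_univ range card_range card_le_mul_card_image_of_maps_to mem_range prod_const card_le_card_of_injOn sum_nonneg mem_Icc Ico sum_Ico_consecutive mem_Ico sum_sub_distrib sum_range_succ mem_Ioc)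
open Fintype (card piFinset card_fin piFinset_subset card_piFinset mem_piFinset sum_sum_type)
open Complex (ofReal_sum I norm_real norm_cpow_eq_rpow_re_of_pos neg_re ofReal_natCast norm_natCast_cpow_of_pos cpow_neg continuous_re ofReal_mul add_re abs_re_le_norm ofReal_re hasSum_re ofReal_cpow ext mem_reProdIm re)
open ArithmeticFunction (moebius vonMangoldt vonMangoldt_nonneg)
open Chebyshev (psi theta)
open intervalIntegral (integral_of_le)

noncomputable def En {Ω G : Type*} (U : Finset Ω) (h : Ω → G) : ℕ :=
  ((U ×ˢ U).filter (fun z => h z.1 = h z.2)).card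

lemma En_eq_sum {Ω G : Type*} (U : Finset Ω) (h : Ω → G) (L : Finset G) (hL : ∀ ω ∈ U, h ω ∈ L) :
    En U h = ∑ l ∈ L, ((U.filter (fun ω => h ω = l)).card) ^ 2 := by
  unfold En
  rw [Finset.card_eq_sum_card_fiberwise (f := fun z => h z.1) (t := L)]
  · refine sum_congr rfl fun l _ => ?_
    rw [sq, ← card_product]
    congr 1
    ext ⟨a, b⟩
    simp only [mem_filter, mem_product]
    constructor
    · rintro ⟨⟨⟨h1, h2⟩, h3⟩, h4⟩
      exact ⟨⟨h1, h4⟩, h2, by rw [← h3, h4]⟩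
    · rintro ⟨⟨h1, h2⟩, h3, h4⟩
      exact ⟨⟨⟨h1, h3⟩, by rw [h2, h4]⟩, h2⟩
  · intro z hz
    simp only [coe_filter, mem_product, Set.mem_ofPred_eq] at hz
    exact hL _ hz.1.1

lemma En_cover {Ω G I : Type*} (U : Finset Ω) (h : Ω → G) (T : Finset I) (V : I → Finset Ω)
    (hc : ∀ ω ∈ U, ∃ i ∈ T, ω ∈ V i) : En U h ≤ T.card * ∑ i ∈ T, En (V i) h := by
  set L : Finset G := (U ∪ T.biUnion V).image h with hLdef
  have h1 : ∀ ω ∈ U, h ω ∈ L := fun ω hω =>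
    mem_image_of_mem _ (Finset.mem_union_left _ hω)
  have h2 : ∀ i ∈ T, ∀ ω ∈ V i, h ω ∈ L := fun i hi ω hω =>
    mem_image_of_mem _ (Finset.mem_union_right _ (Finset.mem_biUnion.2 ⟨i, hi, hω⟩))
  rw [En_eq_sum U h L h1, sum_congr rfl (fun i hi => En_eq_sum (V i) h L (h2 i hi)),
    sum_comm, mul_sum]
  refine sum_le_sum fun l _ => ?_
  refine le_trans (Nat.pow_le_pow_left (m := ∑ i ∈ T, ((V i).filter (fun ω => h ω = l)).card) ?_ 2)
    (sq_sum_le_card_mul_sum_sq)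
  refine le_trans (card_le_card (t := T.biUnion fun i => (V i).filter (fun ω => h ω = l)) ?_)
    Finset.card_biUnion_le
  intro ω hω
  simp only [mem_filter, Finset.mem_biUnion] at hω ⊢
  obtain ⟨i, hi, hi2⟩ := hc ω hω.1
  exact ⟨i, hi, hi2, hω.2⟩

lemma En_shift {Ω G : Type*} [AddCommGroup G] (U : Finset Ω) (h : Ω → G) (d : G) :
    ((U ×ˢ U).filter (fun z => h z.1 = h z.2 + d)).card ≤ En U h := by
  set L : Finset G := (U.image h) ∪ (U.image (fun ω => h ω + d)) ∪ (U.image (fun ω => h ω - d))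
  set r : G → ℕ := fun l => (U.filter (fun ω => h ω = l)).card with hr
  have hL1 : ∀ ω ∈ U, h ω ∈ L := fun ω hω => by
    simp only [L, Finset.mem_union, mem_image]; exact Or.inl (Or.inl ⟨ω, hω, rfl⟩)
  have hL2 : ∀ ω ∈ U, h ω - d ∈ L := fun ω hω => by
    simp only [L, Finset.mem_union, mem_image]; exact Or.inr ⟨ω, hω, rfl⟩
  have e1 : ((U ×ˢ U).filter (fun z => h z.1 = h z.2 + d)).card = ∑ l ∈ L, r (l + d) * r l := by
    rw [Finset.card_eq_sum_card_fiberwise (f := fun z => h z.2) (t := L)]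
    · refine sum_congr rfl fun l _ => ?_
      rw [hr, ← card_product]
      congr 1
      ext ⟨a, b⟩
      simp only [mem_filter, mem_product]
      constructor
      · rintro ⟨⟨⟨h1, h2⟩, h3⟩, h4⟩
        exact ⟨⟨h1, by rw [h3, h4]⟩, h2, h4⟩
      · rintro ⟨⟨h1, h2⟩, h3, h4⟩
        exact ⟨⟨⟨h1, h3⟩, by rw [h2, h4]⟩, h4⟩
    · intro z hz
      simp only [coe_filter, mem_product, Set.mem_ofPred_eq] at hz
      exact hL1 _ hz.1.2
  have e2 : En U h = ∑ l ∈ L, r l ^ 2 := En_eq_sum U h L hL1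
  have e3 : ∑ l ∈ L, r (l + d) ^ 2 = En U h := by
    have : ∑ l ∈ L, r (l + d) ^ 2 = ∑ l ∈ L.image (fun l => l + d), r l ^ 2 := by
      rw [Finset.sum_image]; intro a _ b _ hab; exact add_right_cancel hab
    rw [this, En_eq_sum U h (L.image (fun l => l + d))]
    intro ω hω
    exact mem_image.2 ⟨h ω - d, hL2 ω hω, by simp⟩
  have e4 : ∀ l ∈ L, 2 * (r (l + d) * r l) ≤ r (l + d) ^ 2 + r l ^ 2 := fun l _ => by
    zify; nlinarith [sq_nonneg ((r (l + d) : ℤ) - r l)]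
  have := sum_le_sum e4
  rw [Finset.sum_add_distrib, e3, ← e2, ← mul_sum, ← e1] at this
  omega

lemma En_fourier {Ω G : Type*} [AddCommGroup G] [Fintype G] (U : Finset Ω) (h : Ω → G) :
    ∑ ψ : AddChar G ℂ, ‖∑ ω ∈ U, ψ (h ω)‖ ^ 2 = (card G : ℝ) * En U h := by
  have key : ∀ ψ : AddChar G ℂ, ((‖∑ ω ∈ U, ψ (h ω)‖ ^ 2 : ℝ) : ℂ)
      = ∑ z ∈ U ×ˢ U, ψ (h z.1 - h z.2) := by
    intro ψ
    push_cast
    rw [← Complex.mul_conj', map_sum, Finset.sum_mul_sum, sum_product]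
    refine sum_congr rfl fun a _ => sum_congr rfl fun b _ => ?_
    rw [AddChar.map_sub_eq_div, div_eq_mul_inv, ← AddChar.map_neg_eq_inv, AddChar.map_neg_eq_conj]
  have : ((∑ ψ : AddChar G ℂ, ‖∑ ω ∈ U, ψ (h ω)‖ ^ 2 : ℝ) : ℂ) =
      ((card G : ℝ) * En U h : ℝ) := by
    rw [ofReal_sum, sum_congr rfl (fun ψ _ => key ψ), sum_comm]
    simp_rw [AddChar.sum_apply_eq_ite, sub_eq_zero]
    rw [← sum_filter, sum_const]
    unfold En
    simp [mul_comm]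
  exact_mod_cast this

lemma En_zmod {Ω : Type*} {k : ℕ} (U : Finset Ω) (h : Ω → Fin k → ℤ) (M : ℕ)
    (hM : ∀ ω ∈ U, ∀ j, 2 * |h ω j| < M) :
    En U h = En U (fun ω j => ((h ω j : ℤ) : ZMod M)) := by
  unfold En
  congr 1
  ext z
  simp only [mem_filter]
  refine and_congr_right fun hz => ?_
  rw [mem_product] at hz
  constructor
  · intro e; simp [e]
  · intro e
    funext j
    have e1 := congrFun e j
    simp only [ZMod.intCast_eq_intCast_iff_dvd_sub] at e1
    have h1 := hM _ hz.1 j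
    have h2 := hM _ hz.2 j
    have := Int.eq_zero_of_abs_lt_dvd e1 (by
      have := abs_sub (h z.2 j) (h z.1 j)
      omega)
    omega

lemma exists_M {Ω : Type*} {k : ℕ} (U : Finset Ω) (h : Ω → Fin k → ℤ) :
    ∃ M : ℕ, 0 < M ∧ ∀ ω ∈ U, ∀ j, 2 * |h ω j| < M := by
  refine ⟨2 * (∑ ω ∈ U, ∑ j, (h ω j).natAbs) + 1, by omega, fun ω hω j => ?_⟩
  have h1 : (h ω j).natAbs ≤ ∑ j, (h ω j).natAbs :=
    single_le_sum (f := fun j => (h ω j).natAbs) (fun _ _ => Nat.zero_le _) (mem_univ j)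
  have h2 : ∑ j, (h ω j).natAbs ≤ ∑ ω ∈ U, ∑ j, (h ω j).natAbs :=
    single_le_sum (f := fun ω => ∑ j, (h ω j).natAbs) (fun _ _ => Nat.zero_le _) hω
  rw [Int.abs_eq_natAbs]
  omega

lemma char_sum {ι G : Type*} [AddCommGroup G] (ψ : AddChar G ℂ) (s : Finset ι) (g : ι → G) :
    ψ (∑ i ∈ s, g i) = ∏ i ∈ s, ψ (g i) := by
  induction s using Finset.induction_on with
  | empty => simp
  | insert a s ha ih => rw [sum_insert ha, Finset.prod_insert ha, AddChar.map_add_eq_mul, ih]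

lemma En_holder_aux {α Ω ι G : Type*} [Fintype ι] [DecidableEq ι] [AddCommGroup G] [Fintype G] (V : Finset Ω) (f : Ω → G)
    (A : Finset α) (v : α → G) {p : ℕ} (hp : 0 < p) (c : α → Fin p) (hm : 1 ≤ card ι) :
    En (V ×ˢ piFinset fun _ : ι => A) (fun z => f z.1 + ∑ i, v (z.2 i)) ≤
      p ^ (2 * card ι - 1) * ∑ a : Fin p,
        En (V ×ˢ piFinset fun _ : ι => A.filter (fun y => c y = a))
          (fun z => f z.1 + ∑ i, v (z.2 i)) := by
  have hfac : ∀ (ψ : AddChar G ℂ) (B : Finset α),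
      ‖∑ ω ∈ V ×ˢ piFinset fun _ : ι => B, ψ (f ω.1 + ∑ i, v (ω.2 i))‖ ^ 2 =
      ‖∑ x ∈ V, ψ (f x)‖ ^ 2 * ‖∑ y ∈ B, ψ (v y)‖ ^ (2 * card ι) := by
    intro ψ B
    rw [sum_product]
    simp_rw [AddChar.map_add_eq_mul, char_sum, ← mul_sum]
    rw [← Finset.sum_mul, ← prod_univ_sum (fun _ : ι => B) (fun _ y => ψ (v y))]
    simp [mul_pow, norm_mul, ← pow_mul, mul_comm]
  have hG : (0:ℝ) < card G := by exact_mod_cast Fintype.card_pos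
  have main : (card G : ℝ) * En (V ×ˢ piFinset fun _ : ι => A) (fun z => f z.1 + ∑ i, v (z.2 i)) ≤
      (card G : ℝ) * ((p:ℝ) ^ (2 * card ι - 1) * ∑ a : Fin p,
        (En (V ×ˢ piFinset fun _ : ι => A.filter (fun y => c y = a))
          (fun z => f z.1 + ∑ i, v (z.2 i)) : ℝ)) := by
    rw [← En_fourier, mul_left_comm, mul_sum]
    simp_rw [← En_fourier]
    rw [sum_comm, mul_sum]
    refine sum_le_sum fun ψ _ => ?_
    simp_rw [hfac]
    rw [← mul_sum, mul_left_comm]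
    refine mul_le_mul_of_nonneg_left ?_ (by positivity)
    have e1 : ∑ y ∈ A, ψ (v y) = ∑ a : Fin p, ∑ y ∈ A.filter (fun y => c y = a), ψ (v y) :=
      (Finset.sum_fiberwise A c _).symm
    rw [e1]
    have e3 := pow_sum_div_card_le_sum_pow (s := (univ : Finset (Fin p)))
      (f := fun a => ‖∑ y ∈ A.filter (fun y => c y = a), ψ (v y)‖) (fun _ _ => norm_nonneg _)
      (2 * card ι - 1)
    rw [show 2 * card ι - 1 + 1 = 2 * card ι by omega, card_univ,
      card_fin, div_le_iff₀ (by positivity)] at e3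
    calc _ ≤ (∑ a : Fin p, ‖∑ y ∈ A.filter (fun y => c y = a), ψ (v y)‖) ^ (2 * card ι) := by
          gcongr; exact norm_sum_le _ _
      _ ≤ _ := by rw [mul_comm ((p:ℝ) ^ _)]; exact e3
  have := le_of_mul_le_mul_left main hG
  exact_mod_cast this

lemma En_holder {α Ω ι : Type*} [Fintype ι] [DecidableEq ι] {k : ℕ} (V : Finset Ω) (f : Ω → Fin k → ℤ)
    (A : Finset α) (v : α → Fin k → ℤ) {p : ℕ} (hp : 0 < p) (c : α → Fin p) (hm : 1 ≤ card ι) :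
    En (V ×ˢ piFinset fun _ : ι => A) (fun z => f z.1 + ∑ i, v (z.2 i)) ≤
      p ^ (2 * card ι - 1) * ∑ a : Fin p,
        En (V ×ˢ piFinset fun _ : ι => A.filter (fun y => c y = a))
          (fun z => f z.1 + ∑ i, v (z.2 i)) := by
  obtain ⟨M, hM0, hM⟩ := exists_M (V ×ˢ piFinset fun _ : ι => A) (fun z => f z.1 + ∑ i, v (z.2 i))
  have : NeZero M := ⟨hM0.ne'⟩
  have hsub : ∀ a, (V ×ˢ piFinset fun _ : ι => A.filter (fun y => c y = a)) ⊆
      (V ×ˢ piFinset fun _ : ι => A) := fun a =>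
    Finset.product_subset_product (Finset.Subset.refl _) (piFinset_subset _ _ fun _ => Finset.filter_subset _ _)
  have key := En_holder_aux (ι := ι) V (fun x j => ((f x j : ℤ) : ZMod M)) A (fun y j => ((v y j : ℤ) : ZMod M)) hp c hm
  have conv : ∀ U ⊆ (V ×ˢ piFinset fun _ : ι => A),
      En U (fun z => f z.1 + ∑ i, v (z.2 i)) = En U (fun z => (fun j => ((f z.1 j : ℤ) : ZMod M)) +
        ∑ i, (fun j => ((v (z.2 i) j : ℤ) : ZMod M))) := by
    intro U hU
    rw [En_zmod U _ M (fun ω hω => hM ω (hU hω))]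
    congr 1
    funext z j
    simp [Finset.sum_apply]
  rw [conv _ (Finset.Subset.refl _), sum_congr rfl fun a _ => conv _ (hsub a)]
  exact key

lemma En_mix_aux {α ι G : Type*} [Fintype ι] [DecidableEq ι] [Nonempty ι] [AddCommGroup G] [Fintype G]
    (A : ι → Finset α) (v : α → G) :
    En (piFinset A) (fun z => ∑ i, v (z i)) ≤
      ∑ i, En (piFinset fun _ : ι => A i) (fun z => ∑ i, v (z i)) := by
  have hfac : ∀ (ψ : AddChar G ℂ) (B : ι → Finset α),
      ‖∑ ω ∈ piFinset B, ψ (∑ i, v (ω i))‖ ^ 2 =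
      ∏ i, ‖∑ y ∈ B i, ψ (v y)‖ ^ 2 := by
    intro ψ B
    simp_rw [char_sum]
    rw [← prod_univ_sum B (fun _ y => ψ (v y)), norm_prod, Finset.prod_pow]
  have hG : (0:ℝ) < card G := by exact_mod_cast Fintype.card_pos
  have main : (card G : ℝ) * En (piFinset A) (fun z => ∑ i, v (z i)) ≤
      (card G : ℝ) * ∑ i, (En (piFinset fun _ : ι => A i) (fun z => ∑ i, v (z i)) : ℝ) := by
    rw [← En_fourier, mul_sum]
    simp_rw [← En_fourier]
    rw [sum_comm]
    refine sum_le_sum fun ψ _ => ?_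
    simp_rw [hfac]
    obtain ⟨i0, hi0⟩ := Finite.exists_max (fun i => ‖∑ y ∈ A i, ψ (v y)‖ ^ 2)
    refine le_trans (Finset.prod_le_prod (fun i _ => by positivity) (fun i _ => hi0 i)) ?_
    exact single_le_sum (f := fun i => ∏ _j : ι, ‖∑ y ∈ A i, ψ (v y)‖ ^ 2)
      (fun i _ => Finset.prod_nonneg fun _ _ => by positivity) (mem_univ i0)
  have := le_of_mul_le_mul_left main hG
  exact_mod_cast this

lemma En_mix {α ι : Type*} [Fintype ι] [DecidableEq ι] [Nonempty ι] {k : ℕ}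
    (A : ι → Finset α) (v : α → Fin k → ℤ) :
    En (piFinset A) (fun z => ∑ i, v (z i)) ≤
      ∑ i, En (piFinset fun _ : ι => A i) (fun z => ∑ i, v (z i)) := by
  obtain ⟨M, hM0, hM⟩ := exists_M (piFinset fun _ : ι => (univ : Finset ι).biUnion A)
    (fun z => ∑ i, v (z i))
  have : NeZero M := ⟨hM0.ne'⟩
  have key := En_mix_aux A (fun y j => ((v y j : ℤ) : ZMod M))
  have conv : ∀ U ⊆ (piFinset fun _ : ι => (univ : Finset ι).biUnion A),
      En U (fun z => ∑ i, v (z i)) = En U (fun z => 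
        ∑ i, (fun j => ((v (z i) j : ℤ) : ZMod M))) := by
    intro U hU
    rw [En_zmod U _ M (fun ω hω => hM ω (hU hω))]
    congr 1
    funext z j
    simp [Finset.sum_apply]
  have hs : ∀ i, A i ⊆ (univ : Finset ι).biUnion A := fun i =>
    Finset.subset_biUnion_of_mem _ (mem_univ i)
  rw [conv _ (piFinset_subset _ _ hs),
    sum_congr rfl fun a _ => conv _ (piFinset_subset _ _ fun _ => hs a)]
  exact key


lemma newton_prod {R : Type*} [CommRing R] (k : ℕ) (hu : ∀ n, 1 ≤ n → n ≤ k → IsUnit (n : R))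
    (x y : Fin k → R) (h : ∀ j, 1 ≤ j → j ≤ k → ∑ i, x i ^ j = ∑ i, y i ^ j) (t : R) :
    ∏ i, (t - x i) = ∏ i, (t - y i) := by
  have e : ∀ n, n ≤ k → MvPolynomial.aeval x (MvPolynomial.esymm (Fin k) R n)
      = MvPolynomial.aeval y (MvPolynomial.esymm (Fin k) R n) := by
    intro n
    induction n using Nat.strong_induction_on with
    | _ n ih =>
    intro hn
    rcases Nat.eq_zero_or_pos n with rfl | hn0
    · simp
    have hx := congrArg (MvPolynomial.aeval x) (MvPolynomial.mul_esymm_eq_sum (Fin k) R n)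
    have hy := congrArg (MvPolynomial.aeval y) (MvPolynomial.mul_esymm_eq_sum (Fin k) R n)
    simp only [map_mul, map_natCast, map_sum, map_pow, map_neg, map_one] at hx hy
    apply (hu n hn0 hn).mul_left_cancel
    rw [hx, hy]
    congr 1
    refine sum_congr rfl fun a ha => ?_
    rw [mem_filter] at ha
    have ha1 := Finset.HasAntidiagonal.mem_antidiagonal.1 ha.1
    rw [ih a.1 ha.2 (by omega)]
    congr 1
    simp only [MvPolynomial.psum, map_sum, map_pow, MvPolynomial.aeval_X]
    exact h _ (by omega) (by omega)
  have g : ∀ z : Fin k → R, ∏ i, (t - z i) = ∑ j ∈ range (k + 1),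
      (-1) ^ j * (MvPolynomial.aeval z (MvPolynomial.esymm (Fin k) R j) * t ^ (k - j)) := by
    intro z
    have := congrArg (Polynomial.eval t) (Multiset.prod_X_sub_X_eq_sum_esymm (univ.val.map z))
    simp only [Multiset.map_map, Multiset.card_map, Finset.card_val, card_univ,
      card_fin, Polynomial.eval_finsetSum, Polynomial.eval_mul, Polynomial.eval_pow,
      Polynomial.eval_neg, Polynomial.eval_one, Polynomial.eval_C, Polynomial.eval_X] at this
    simp_rw [MvPolynomial.aeval_esymm_eq_multiset_esymm]
    rw [← this]
    change _ = Polynomial.eval t (∏ i, (Polynomial.X - Polynomial.C (z i)))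
    simp [Polynomial.eval_prod]
  rw [g, g]
  refine sum_congr rfl fun j hj => ?_
  rw [e j (by simpa [Nat.lt_succ_iff] using hj)]

lemma linnik_fiber {p k P : ℕ} (hp : p.Prime) (hkp : k < p) (hk : 1 ≤ k) (hP : P ≤ p ^ k) (a : ℤ)
    (x y : Fin k → ℕ) (hx : ∀ i, x i < P) (hy : ∀ i, y i < P)
    (hinj : Function.Injective fun i => (x i : ZMod p))
    (h : ∀ j : Fin k, ∑ i, ((x i : ℤ) - a) ^ (j.1 + 1) ≡ ∑ i, ((y i : ℤ) - a) ^ (j.1 + 1) [ZMOD (p ^ k : ℕ)])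
    (j : Fin k) : ∃ i, y j = x i := by
  have hu : ∀ n, 1 ≤ n → n ≤ k → IsUnit ((n : ℕ) : ZMod (p ^ k)) := by
    intro n h1 h2
    rw [ZMod.isUnit_iff_coprime]
    exact Nat.Coprime.pow_right _ (Nat.coprime_of_lt_prime (by omega) (by omega) hp).symm
  have key := newton_prod k hu (fun i => (((x i : ℤ) - a : ℤ) : ZMod (p ^ k)))
    (fun i => (((y i : ℤ) - a : ℤ) : ZMod (p ^ k))) (by
      intro j h1 h2
      have := h ⟨j - 1, by omega⟩
      rw [← ZMod.intCast_eq_intCast_iff] at this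
      simp only [show j - 1 + 1 = j by omega] at this
      push_cast at this ⊢
      exact this) (((y j : ℤ) - a : ℤ) : ZMod (p ^ k))
  rw [Finset.prod_eq_zero (i := j) (mem_univ j) (sub_self _) (f := fun i => (((y j : ℤ) - a : ℤ) : ZMod (p ^ k)) - (((y i : ℤ) - a : ℤ) : ZMod (p ^ k)))] at key
  have key2 : ((p ^ k : ℕ) : ℤ) ∣ ∏ i, ((y j : ℤ) - x i) := by
    rw [← ZMod.intCast_zmod_eq_zero_iff_dvd, ← key]
    push_cast
    refine Finset.prod_congr rfl fun i _ => by ring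
  have hpi : Prime (p : ℤ) := Nat.prime_iff_prime_int.mp hp
  have h0 : (p : ℤ) ∣ ∏ i, ((y j : ℤ) - x i) := by
    refine dvd_trans ?_ key2
    push_cast
    exact dvd_pow_self _ (by omega)
  obtain ⟨i, -, hi⟩ := (hpi.dvd_finsetProd_iff _).1 h0
  refine ⟨i, ?_⟩
  rw [← Finset.mul_prod_erase _ _ (mem_univ i)] at key2
  have hcop : IsCoprime ((p ^ k : ℕ) : ℤ) (∏ l ∈ univ.erase i, ((y j : ℤ) - x l)) := by
    push_cast
    refine IsCoprime.pow_left (IsCoprime.prod_right fun l hl => ?_)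
    refine (Prime.coprime_iff_not_dvd hpi).2 fun hd => ?_
    have := dvd_sub hi hd
    have h2 : (x l : ZMod p) = x i := by
      have : ((p : ℕ) : ℤ) ∣ (x l : ℤ) - x i := by convert! this using 1; ring
      have := (ZMod.intCast_eq_intCast_iff_dvd_sub (x i : ℤ) (x l : ℤ) p).2 this
      push_cast at this
      exact this.symm
    exact (Finset.mem_erase.1 hl).1 (hinj h2)
  have hd := hcop.dvd_of_dvd_mul_right key2
  have := Int.eq_zero_of_abs_lt_dvd hd (by
    have h1 : ((x i : ℕ) : ℤ) < ((p ^ k : ℕ) : ℤ) := by exact_mod_cast lt_of_lt_of_le (hx i) hP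
    have h2 : ((y j : ℕ) : ℤ) < ((p ^ k : ℕ) : ℤ) := by exact_mod_cast lt_of_lt_of_le (hy j) hP
    rw [abs_lt]; constructor <;> omega)
  omega

lemma linnik_count {p k P : ℕ} (hp : p.Prime) (hkp : k < p) (hk : 1 ≤ k) (hP : P ≤ p ^ k) (a : ℤ)
    (lam : Fin k → ℤ) :
    ((piFinset fun _ : Fin k => range P).filter (fun x : Fin k → ℕ =>
      (Function.Injective fun i => (x i : ZMod p)) ∧
      ∀ j : Fin k, ∑ i, ((x i : ℤ) - a) ^ (j.1 + 1) ≡ lam j [ZMOD (p ^ (j.1 + 1) : ℕ)])).card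
    ≤ k ^ k * p ^ (k * (k - 1) / 2) := by
  have hp0 : 0 < p := hp.pos
  set c : (Fin k → ℕ) → Fin k → ℕ := fun x j =>
    ((∑ i, ((x i : ℤ) - a) ^ (j.1 + 1)) % ((p ^ k : ℕ) : ℤ)).toNat / p ^ (j.1 + 1) with hc
  set t := piFinset fun j : Fin k => range (p ^ (k - 1 - j.1)) with ht
  have hppos : (0 : ℤ) < ((p ^ k : ℕ) : ℤ) := by positivity
  have htc : t.card = p ^ (k * (k - 1) / 2) := by
    rw [ht, card_piFinset]
    simp only [card_range]
    rw [Fin.prod_univ_eq_prod_range (fun j => p ^ (k - 1 - j)) k, Finset.prod_range_reflect (fun j => p ^ j) k,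
      Finset.prod_pow_eq_pow_sum, Finset.sum_range_id]
  rw [← htc]
  refine card_le_mul_card_image_of_maps_to (f := c) ?_ _ ?_
  · intro x _
    rw [ht, mem_piFinset]
    intro j
    rw [mem_range, hc]
    refine Nat.div_lt_of_lt_mul ?_
    rw [← pow_add, show j.1 + 1 + (k - 1 - j.1) = k by omega]
    have h1 := Int.emod_lt_of_pos (∑ i, ((x i : ℤ) - a) ^ (j.1 + 1)) hppos
    have h2 := Int.emod_nonneg (∑ i, ((x i : ℤ) - a) ^ (j.1 + 1)) hppos.ne'
    omega
  · intro w _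
    rcases Finset.eq_empty_or_nonempty ((((piFinset fun _ : Fin k => range P).filter (fun x : Fin k → ℕ =>
      (Function.Injective fun i => (x i : ZMod p)) ∧
      ∀ j : Fin k, ∑ i, ((x i : ℤ) - a) ^ (j.1 + 1) ≡ lam j [ZMOD (p ^ (j.1 + 1) : ℕ)]))).filter (fun x => c x = w)) with h0 | ⟨x, hx⟩
    · rw [h0]; simp
    · simp only [mem_filter, mem_piFinset, mem_range] at hx
      refine le_trans (card_le_card (t := piFinset fun _ : Fin k => univ.image x) ?_) ?_
      · intro y hy
        simp only [mem_filter, mem_piFinset, mem_range] at hy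
        rw [mem_piFinset]
        intro j
        obtain ⟨i, hi⟩ := linnik_fiber hp hkp hk hP a x y hx.1.1 hy.1.1 hx.1.2.1 (by
          intro j
          have e1 : c x j = c y j := by rw [hx.2, hy.2]
          have e2 := (hx.1.2.2 j).trans (hy.1.2.2 j).symm
          have hd : ((p ^ (j.1 + 1) : ℕ) : ℤ) ∣ ((p ^ k : ℕ) : ℤ) := by
            exact_mod_cast pow_dvd_pow p (by omega : j.1 + 1 ≤ k)
          simp only [hc] at e1
          generalize ∑ i, ((x i : ℤ) - a) ^ (j.1 + 1) = X at e1 e2 ⊢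
          generalize ∑ i, ((y i : ℤ) - a) ^ (j.1 + 1) = Y at e1 e2 ⊢
          have hX := Int.emod_nonneg X hppos.ne'
          have hY := Int.emod_nonneg Y hppos.ne'
          have e3 : X % ((p ^ k : ℕ) : ℤ) ≡ Y % ((p ^ k : ℕ) : ℤ) [ZMOD (p ^ (j.1 + 1) : ℕ)] := by
            have a1 := (Int.mod_modEq X ((p ^ k : ℕ) : ℤ)).of_dvd hd
            have a2 := (Int.mod_modEq Y ((p ^ k : ℕ) : ℤ)).of_dvd hd
            exact a1.trans (e2.trans a2.symm)
          unfold Int.ModEq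
          lift X % ((p ^ k : ℕ) : ℤ) to ℕ using hX with X' hX'
          lift Y % ((p ^ k : ℕ) : ℤ) to ℕ using hY with Y' hY'
          rw [Int.natCast_modEq_iff] at e3
          simp only [Int.toNat_natCast] at e1
          rw [← Nat.div_add_mod X' (p ^ (j.1 + 1)), ← Nat.div_add_mod Y' (p ^ (j.1 + 1)), e1, e3]) j
        exact mem_image.2 ⟨i, mem_univ _, hi.symm⟩
      · rw [card_piFinset]
        simp only [prod_const, card_univ, card_fin]
        refine Nat.pow_le_pow_left (le_trans Finset.card_image_le (by simp)) _


lemma En_le_of_inj {Ω Ω' G G' : Type*} {U : Finset Ω} {U' : Finset Ω'} (h : Ω → G) (h' : Ω' → G')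
    (f : Ω → Ω') (hf : ∀ ω ∈ U, f ω ∈ U') (hi : ∀ a ∈ U, ∀ b ∈ U, f a = f b → a = b)
    (hh : ∀ a ∈ U, ∀ b ∈ U, h a = h b → h' (f a) = h' (f b)) : En U h ≤ En U' h' := by
  unfold En
  refine card_le_card_of_injOn (fun z => (f z.1, f z.2)) ?_ ?_
  · intro z hz
    simp only [coe_filter, mem_product, Set.mem_ofPred_eq] at hz ⊢
    exact ⟨⟨hf _ hz.1.1, hf _ hz.1.2⟩, hh _ hz.1.1 _ hz.1.2 hz.2⟩
  · intro z hz w hw e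
    simp only [coe_filter, mem_product, Set.mem_ofPred_eq, Prod.mk.injEq] at hz hw e
    exact Prod.ext (hi _ hz.1.1 _ hw.1.1 e.1) (hi _ hz.1.2 _ hw.1.2 e.2)

def pv (k : ℕ) (y : ℤ) : Fin k → ℤ := fun j => y ^ (j.1 + 1)

noncomputable def Jv (ι : Type) [Fintype ι] [DecidableEq ι] (k P : ℕ) : ℕ :=
  En (piFinset fun _ : ι => range P) (fun z => ∑ i, pv k (z i : ℤ))

lemma pv_poly {ι : Type*} [Fintype ι] {k : ℕ} (x y : ι → ℤ)
    (h : ∑ i, pv k (x i) = ∑ i, pv k (y i)) (q : Polynomial ℤ) (hq : q.natDegree ≤ k) :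
    ∑ i, q.eval (x i) = ∑ i, q.eval (y i) := by
  simp_rw [Polynomial.eval_eq_sum_range' (Nat.lt_succ_of_le hq)]
  rw [sum_comm, sum_comm (s := univ)]
  refine sum_congr rfl fun n hn => ?_
  simp_rw [← mul_sum]
  congr 1
  rcases n with _ | n
  · simp
  · have := congrFun h ⟨n, by simpa using hn⟩
    simpa [Finset.sum_apply, pv] using this

lemma pv_shift {ι : Type*} [Fintype ι] {k : ℕ} (x y : ι → ℤ)
    (h : ∑ i, pv k (x i) = ∑ i, pv k (y i)) (a : ℤ) (j : Fin k) :
    ∑ i, (x i - a) ^ (j.1 + 1) = ∑ i, (y i - a) ^ (j.1 + 1) := by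
  have := pv_poly x y h ((Polynomial.X - Polynomial.C a) ^ (j.1 + 1)) (by
    refine le_trans Polynomial.natDegree_pow_le ?_
    rw [Polynomial.natDegree_X_sub_C]; omega)
  simpa using this

def cls (p : ℕ) (hp : 0 < p) (y : ℕ) : Fin p := ⟨y % p, Nat.mod_lt _ hp⟩

lemma cls_eq {p : ℕ} (hp : 0 < p) {y : ℕ} {a : Fin p} (h : cls p hp y = a) :
    (y : ℤ) = a.1 + p * ((y / p : ℕ) : ℤ) := by
  have : y % p = a.1 := by rw [← h]; rfl
  rw [← this]
  exact_mod_cast (Nat.mod_add_div y p).symm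

lemma class_energy {ι : Type} [Fintype ι] [DecidableEq ι] {k p P P' : ℕ} (hp : 0 < p) (hP : P ≤ p * P') (a : Fin p) :
    En (piFinset fun _ : ι => (range P).filter (fun y => cls p hp y = a))
      (fun z => ∑ i, pv k (z i : ℤ)) ≤ Jv ι k P' := by
  unfold Jv
  refine En_le_of_inj _ _ (fun x i => x i / p) ?_ ?_ ?_
  · intro x hx
    simp only [mem_piFinset, mem_filter, mem_range] at hx ⊢
    exact fun i => Nat.div_lt_of_lt_mul (lt_of_lt_of_le (hx i).1 hP)
  · intro x hx y hy e
    simp only [mem_piFinset, mem_filter, mem_range] at hx hy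
    funext i
    have e1 := cls_eq hp (hx i).2
    have e2 := cls_eq hp (hy i).2
    rw [congrFun e i, ← e2] at e1
    exact_mod_cast e1
  · intro x hx y hy e
    simp only [mem_piFinset, mem_filter, mem_range] at hx hy
    funext j
    have := pv_shift _ _ e a.1 j
    have e1 : ∀ i, ((x i : ℤ) - a.1) = p * ((x i / p : ℕ) : ℤ) := fun i => by
      have := cls_eq hp (hx i).2; linarith
    have e2 : ∀ i, ((y i : ℤ) - a.1) = p * ((y i / p : ℕ) : ℤ) := fun i => by
      have := cls_eq hp (hy i).2; linarith
    simp_rw [e1, e2, mul_pow, ← mul_sum] at this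
    have := mul_left_cancel₀ (pow_ne_zero _ (by exact_mod_cast hp.ne')) this
    simpa [Finset.sum_apply, pv] using this

noncomputable def U1 (k p P : ℕ) : Finset (Fin k → ℕ) :=
  (piFinset fun _ : Fin k => range P).filter
    (fun x => Function.Injective fun i => (x i : ZMod p))

lemma good_class {k m p P P' : ℕ} (hp : p.Prime) (hkp : k < p) (hk : 1 ≤ k) (hPk : P ≤ p ^ k)
    (hP : P ≤ p * P') (a : Fin p) :
    En (U1 k p P ×ˢ piFinset fun _ : Fin m => (range P).filter (fun y => cls p hp.pos y = a))
      (fun z => (∑ i, pv k (z.1 i : ℤ)) + ∑ i, pv k (z.2 i : ℤ))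
      ≤ Jv (Fin m) k P' * (P ^ k * (k ^ k * p ^ (k * (k - 1) / 2))) := by
  set B := piFinset fun _ : Fin m => (range P).filter (fun y => cls p hp.pos y = a) with hB
  set T := (U1 k p P ×ˢ U1 k p P).filter (fun z : (Fin k → ℕ) × (Fin k → ℕ) => ∀ j : Fin k,
    ∑ i, ((z.1 i : ℤ) - a.1) ^ (j.1 + 1) ≡ ∑ i, ((z.2 i : ℤ) - a.1) ^ (j.1 + 1) [ZMOD (p ^ (j.1 + 1) : ℕ)]) with hT
  have hTc : T.card ≤ P ^ k * (k ^ k * p ^ (k * (k - 1) / 2)) := by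
    have h1 : ((piFinset fun _ : Fin k => range P)).card = P ^ k := by simp
    rw [mul_comm, ← h1]
    refine card_le_mul_card_image_of_maps_to (f := fun z => z.2) ?_ _ ?_
    · intro z hz
      simp only [hT, U1, mem_filter, mem_product] at hz
      exact hz.1.2.1
    · intro y _
      refine le_trans ?_ (linnik_count hp hkp hk hPk a.1 (fun j => ∑ i, ((y i : ℤ) - a.1) ^ (j.1 + 1)))
      refine card_le_card_of_injOn (fun z => z.1) ?_ ?_
      · intro z hz
        simp only [hT, U1, coe_filter, mem_filter, mem_product, Set.mem_ofPred_eq] at hz ⊢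
        obtain ⟨⟨⟨⟨h1, h2⟩, h3⟩, h4⟩, rfl⟩ := hz
        exact ⟨h1, h2, h4⟩
      · intro z hz w hw e
        simp only [coe_filter, Set.mem_ofPred_eq] at hz hw
        exact Prod.ext e (hz.2.trans hw.2.symm)
  refine le_trans ?_ (Nat.mul_le_mul_left _ hTc)
  unfold En
  refine card_le_mul_card_image_of_maps_to (f := fun z => (z.1.1, z.2.1)) ?_ _ ?_
  · intro z hz
    obtain ⟨⟨x, u⟩, ⟨y, w⟩⟩ := z
    simp only [mem_filter, mem_product] at hz
    obtain ⟨⟨⟨hx, hu⟩, ⟨hy, hw⟩⟩, e⟩ := hz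
    simp only [hT, mem_filter, mem_product]
    refine ⟨⟨hx, hy⟩, fun j => ?_⟩
    simp only [hB, mem_piFinset, mem_filter, mem_range] at hu hw
    have := pv_shift (k := k) (ι := Fin k ⊕ Fin m) (Sum.elim (fun i => (x i : ℤ)) (fun i => (u i : ℤ)))
      (Sum.elim (fun i => (y i : ℤ)) (fun i => (w i : ℤ))) (by
        simpa [sum_sum_type] using e) a.1 j
    simp only [sum_sum_type, Sum.elim_inl, Sum.elim_inr] at this
    have e1 : ∀ i, ((u i : ℤ) - a.1) = p * ((u i / p : ℕ) : ℤ) := fun i => by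
      have := cls_eq hp.pos (hu i).2; linarith
    have e2 : ∀ i, ((w i : ℤ) - a.1) = p * ((w i / p : ℕ) : ℤ) := fun i => by
      have := cls_eq hp.pos (hw i).2; linarith
    simp_rw [e1, e2, mul_pow, ← mul_sum] at this
    rw [Int.modEq_iff_dvd]
    push_cast
    refine ⟨∑ i, ((u i / p : ℕ) : ℤ) ^ (j.1 + 1) - ∑ i, ((w i / p : ℕ) : ℤ) ^ (j.1 + 1), ?_⟩
    rw [mul_sub]; push_cast at this ⊢; linarith
  · intro b _
    obtain ⟨x, y⟩ := b
    refine le_trans ?_ (class_energy (ι := Fin m) (k := k) hp.pos hP a)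
    refine le_trans ?_ (En_shift B (fun z => ∑ i, pv k (z i : ℤ)) ((∑ i, pv k (y i : ℤ)) - ∑ i, pv k (x i : ℤ)))
    refine card_le_card_of_injOn (fun z => (z.1.2, z.2.2)) ?_ ?_
    · rintro ⟨⟨x', u⟩, ⟨y', w⟩⟩ hz
      simp only [coe_filter, mem_filter, mem_product, Set.mem_ofPred_eq, Prod.mk.injEq] at hz ⊢
      obtain ⟨⟨⟨⟨hx, hu⟩, ⟨hy, hw⟩⟩, e⟩, rfl, rfl⟩ := hz
      refine ⟨⟨hu, hw⟩, ?_⟩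
      rw [← add_sub_assoc, eq_sub_iff_add_eq, add_comm, e, add_comm]
    · rintro ⟨⟨x', u⟩, ⟨y', w⟩⟩ hz ⟨⟨x'', u'⟩, ⟨y'', w'⟩⟩ hw e
      simp only [coe_filter, Set.mem_ofPred_eq, Prod.mk.injEq] at hz hw e ⊢
      obtain ⟨-, rfl, rfl⟩ := hz
      obtain ⟨-, rfl, rfl⟩ := hw
      exact ⟨⟨rfl, e.1⟩, rfl, e.2⟩

lemma good_energy {k m p P P' : ℕ} (hp : p.Prime) (hkp : k < p) (hk : 1 ≤ k) (hm : 1 ≤ m) (hPk : P ≤ p ^ k)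
    (hP : P ≤ p * P') :
    En (U1 k p P ×ˢ piFinset fun _ : Fin m => range P)
      (fun z => (∑ i, pv k (z.1 i : ℤ)) + ∑ i, pv k (z.2 i : ℤ))
      ≤ p ^ (2 * m) * (Jv (Fin m) k P' * (P ^ k * (k ^ k * p ^ (k * (k - 1) / 2)))) := by
  refine le_trans (En_holder (ι := Fin m) (U1 k p P) (fun x => ∑ i, pv k (x i : ℤ)) (range P)
    (fun y => pv k (y : ℤ)) hp.pos (cls p hp.pos) (by simpa using hm)) ?_
  refine le_trans (Nat.mul_le_mul_left _ (sum_le_sum fun a _ => good_class hp hkp hk hPk hP a)) ?_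
  simp only [sum_const, card_univ, card_fin, smul_eq_mul]
  rw [← mul_assoc, ← pow_succ, show 2 * m - 1 + 1 = 2 * m by omega]

lemma bad_energy {ι : Type} [Fintype ι] [DecidableEq ι] [Nonempty ι] {k p P P' : ℕ} (hp : 0 < p) (hk : 1 ≤ k)
    (hP : P ≤ p * P') :
    En ((piFinset fun _ : ι => range P).filter
      (fun x => (univ.image fun i => cls p hp (x i)).card < k)) (fun z => ∑ i, pv k (z i : ℤ))
      ≤ (p ^ k * k ^ card ι) ^ 2 * (card ι * Jv ι k P') := by
  refine le_trans (En_cover _ _ (univ : Finset ((Fin k → Fin p) × (ι → Fin k)))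
    (fun gt => piFinset fun i : ι => (range P).filter (fun y => cls p hp y = gt.1 (gt.2 i))) ?_) ?_
  · intro x hx
    simp only [mem_filter, mem_piFinset] at hx
    set C := univ.image fun i => cls p hp (x i) with hC
    have : ∃ g : Fin k → Fin p, ∀ c ∈ C, ∃ l, g l = c := by
      have e := C.equivFin
      refine ⟨fun l => if h : l.1 < C.card then (e.symm ⟨l.1, h⟩).1 else ⟨0, hp⟩, fun c hc => ?_⟩
      refine ⟨⟨(e ⟨c, hc⟩).1, lt_trans (e ⟨c, hc⟩).2 hx.2⟩, ?_⟩
      simp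
    obtain ⟨g, hg⟩ := this
    have hkne : Nonempty (Fin k) := ⟨⟨0, hk⟩⟩
    choose! l hl using hg
    refine ⟨(g, fun i => l (cls p hp (x i))), mem_univ _, ?_⟩
    simp only [mem_piFinset, mem_filter]
    exact fun i => ⟨hx.1 i, (hl _ (mem_image_of_mem _ (mem_univ i))).symm⟩
  · have h1 : ∀ gt : (Fin k → Fin p) × (ι → Fin k), En (piFinset fun i : ι =>
        (range P).filter (fun y => cls p hp y = gt.1 (gt.2 i))) (fun z => ∑ i, pv k (z i : ℤ))
        ≤ card ι * Jv ι k P' := by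
      intro gt
      refine le_trans (En_mix (fun i : ι => (range P).filter (fun y => cls p hp y = gt.1 (gt.2 i))) (fun y : ℕ => pv k (y : ℤ))) ?_
      refine le_trans (sum_le_sum fun i _ => class_energy (ι := ι) (k := k) hp hP (gt.1 (gt.2 i))) ?_
      simp
    refine le_trans (Nat.mul_le_mul_left _ (sum_le_sum fun gt _ => h1 gt)) ?_
    simp only [sum_const, card_univ, Fintype.card_prod, Fintype.card_fun, card_fin, smul_eq_mul]
    rw [← mul_assoc, ← sq]

lemma J_rec {k m p P P' : ℕ} (hp : p.Prime) (hkp : k < p) (hk : 1 ≤ k) (hm : 1 ≤ m) (hPk : P ≤ p ^ k)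
    (hP : P ≤ p * P') :
    Jv (Fin k ⊕ Fin m) k P ≤ 2 * ((k + m).factorial ^ 2 *
        (p ^ (2 * m) * (Jv (Fin m) k P' * (P ^ k * (k ^ k * p ^ (k * (k - 1) / 2)))))
      + (p ^ k * k ^ (k + m)) ^ 2 * ((k + m) * Jv (Fin k ⊕ Fin m) k P')) := by
  set h : (Fin k ⊕ Fin m → ℕ) → Fin k → ℤ := fun z => ∑ i, pv k (z i : ℤ) with hh
  set A := (piFinset fun _ : Fin k ⊕ Fin m => range P) with hA
  set bad := A.filter (fun x => (univ.image fun i => cls p hp.pos (x i)).card < k) with hbad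
  set good := A.filter (fun x => ¬ (univ.image fun i => cls p hp.pos (x i)).card < k) with hgood
  have hcov := En_cover A h (univ : Finset Bool) (fun b => if b then good else bad) (by
    intro x hx
    by_cases hb : (univ.image fun i => cls p hp.pos (x i)).card < k
    · exact ⟨false, mem_univ _, by simp [hbad, hx, hb]⟩
    · refine ⟨true, mem_univ _, by simpa [hgood, hx] using hb⟩)
  have hne : Nonempty (Fin k ⊕ Fin m) := ⟨Sum.inl ⟨0, hk⟩⟩
  have hb := bad_energy (ι := Fin k ⊕ Fin m) (k := k) hp.pos hk hP
  simp only [Fintype.card_sum, card_fin] at hb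
  have hg : En good h ≤ (k + m).factorial ^ 2 *
        (p ^ (2 * m) * (Jv (Fin m) k P' * (P ^ k * (k ^ k * p ^ (k * (k - 1) / 2))))) := by
    refine le_trans (En_cover good h (univ : Finset (Equiv.Perm (Fin k ⊕ Fin m)))
      (fun σ => A.filter (fun x => Function.Injective fun i : Fin k => ((x (σ (Sum.inl i)) : ℕ) : ZMod p))) ?_) ?_
    · intro x hx
      simp only [hgood, mem_filter, not_lt] at hx
      obtain ⟨D, hD, hDc⟩ := Finset.exists_subset_card_eq hx.2
      have e : Fin k ≃ D := (finCongr hDc.symm).trans D.equivFin.symm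
      have hex : ∀ i : Fin k, ∃ l, cls p hp.pos (x l) = (e i).1 := fun i => by
        have := hD (e i).2
        simpa using this
      choose l hl using hex
      have hli : Function.Injective (fun i => cls p hp.pos (x (l i))) := by
        intro i j hij
        simp only [hl] at hij
        exact e.injective (Subtype.ext hij)
      have hl2 : Function.Injective l := fun i j hij => hli (by simp [hij])
      obtain ⟨σ, hσ⟩ := Equiv.Perm.exists_extending_pair (Sum.inl : Fin k → Fin k ⊕ Fin m) l Sum.inl_injective hl2
      refine ⟨σ, mem_univ _, ?_⟩
      rw [mem_filter]
      refine ⟨hx.1, fun i j hij => hli ?_⟩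
      have hs : ∀ i, σ (Sum.inl i) = l i := fun i => by
        have := hσ; first | exact congrFun this i | exact this i
      simp only [hs] at hij
      rw [ZMod.natCast_eq_natCast_iff'] at hij
      exact Fin.ext hij
    · have h1 : ∀ σ : Equiv.Perm (Fin k ⊕ Fin m), En (A.filter (fun x => Function.Injective fun i : Fin k =>
          ((x (σ (Sum.inl i)) : ℕ) : ZMod p))) h ≤ p ^ (2 * m) * (Jv (Fin m) k P' * (P ^ k * (k ^ k * p ^ (k * (k - 1) / 2)))) := by
        intro σ
        refine le_trans ?_ (good_energy hp hkp hk hm hPk hP)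
        refine En_le_of_inj _ _ (fun x => (fun i => x (σ (Sum.inl i)), fun i => x (σ (Sum.inr i)))) ?_ ?_ ?_
        · intro x hx
          simp only [hA, U1, mem_filter, mem_piFinset, mem_product] at hx ⊢
          exact ⟨⟨fun i => hx.1 _, hx.2⟩, fun i => hx.1 _⟩
        · intro x _ y _ e
          simp only [Prod.mk.injEq] at e
          funext i
          obtain ⟨i', rfl⟩ := σ.surjective i
          rcases i' with i' | i'
          · exact congrFun e.1 i'
          · exact congrFun e.2 i'
        · intro x _ y _ e
          have g : ∀ x : Fin k ⊕ Fin m → ℕ, (∑ i, pv k (x (σ (Sum.inl i)) : ℤ)) + ∑ i, pv k (x (σ (Sum.inr i)) : ℤ) = h x := by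
            intro x
            rw [hh]
            simp only
            rw [← Equiv.sum_comp σ, sum_sum_type]
          simp only [g, e]
      refine le_trans (Nat.mul_le_mul_left _ (sum_le_sum fun σ _ => h1 σ)) ?_
      simp only [sum_const, card_univ, Fintype.card_perm, Fintype.card_sum, card_fin, smul_eq_mul]
      rw [← mul_assoc, ← sq]
  refine le_trans hcov ?_
  simp only [card_univ, Fintype.card_bool, Fintype.univ_bool, Finset.mem_singleton, Bool.true_eq_false, not_false_eq_true, sum_insert, Finset.sum_singleton, if_true]
  refine Nat.mul_le_mul_left _ (Nat.add_le_add hg ?_)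
  simp only [Bool.false_eq_true, if_false]
  exact hb


lemma Jv_congr {ι ι' : Type} [Fintype ι] [DecidableEq ι] [Fintype ι'] [DecidableEq ι'] (e : ι ≃ ι') (k P : ℕ) :
    Jv ι k P ≤ Jv ι' k P := by
  unfold Jv
  refine En_le_of_inj _ _ (fun x i => x (e.symm i)) ?_ ?_ ?_
  · intro x hx
    simp only [mem_piFinset] at hx ⊢
    exact fun i => hx _
  · intro x _ y _ h
    funext i
    simpa using congrFun h (e i)
  · intro x _ y _ h
    have g : ∀ x : ι → ℕ, ∑ i, pv k (x (e.symm i) : ℤ) = ∑ i, pv k (x i : ℤ) := fun x =>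
      Equiv.sum_comp e.symm (fun i => pv k (x i : ℤ))
    simp only [g, h]

lemma En_triv {Ω G : Type*} (U : Finset Ω) (h : Ω → G) : En U h ≤ U.card ^ 2 := by
  unfold En
  refine le_trans (Finset.card_filter_le _ _) ?_
  rw [card_product, sq]

lemma Jv_triv (ι : Type) [Fintype ι] [DecidableEq ι] (k P : ℕ) : Jv ι k P ≤ P ^ (2 * card ι) := by
  unfold Jv
  refine le_trans (En_triv _ _) ?_
  simp [← pow_mul, mul_comm]

lemma Jv_add (k m P : ℕ) : Jv (Fin k ⊕ Fin m) k P ≤ P ^ (2 * k) * Jv (Fin m) k P := by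
  have h := En_cover (piFinset fun _ : Fin k ⊕ Fin m => range P) (fun z => ∑ i, pv k (z i : ℤ))
    (piFinset fun _ : Fin k => range P)
    (fun g => (piFinset fun _ : Fin k ⊕ Fin m => range P).filter (fun x => (fun i => x (Sum.inl i)) = g))
    (by
      intro x hx
      refine ⟨fun i => x (Sum.inl i), ?_, ?_⟩
      · simp only [mem_piFinset] at hx ⊢
        exact fun i => hx _
      · simp only [mem_filter]
        exact ⟨hx, trivial⟩)
  unfold Jv
  refine le_trans h ?_
  have h1 : ∀ g ∈ (piFinset fun _ : Fin k => range P), En ((piFinset fun _ : Fin k ⊕ Fin m => range P).filter (fun x => (fun i => x (Sum.inl i)) = g)) (fun z => ∑ i, pv k (z i : ℤ)) ≤ En (piFinset fun _ : Fin m => range P) (fun z => ∑ i, pv k (z i : ℤ)) := by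
    intro g _
    refine En_le_of_inj _ _ (fun x i => x (Sum.inr i)) ?_ ?_ ?_
    · intro x hx
      simp only [mem_piFinset, mem_filter] at hx ⊢
      exact fun i => hx.1 _
    · intro x hx y hy e
      simp only [mem_filter] at hx hy
      funext i
      rcases i with i | i
      · exact congrFun (hx.2.trans hy.2.symm) i
      · exact congrFun e i
    · intro x hx y hy e
      simp only [mem_filter] at hx hy
      simp only [sum_sum_type] at e
      have e1 : ∀ i, x (Sum.inl i) = y (Sum.inl i) := congrFun (hx.2.trans hy.2.symm)
      simp only [e1] at e
      exact add_left_cancel e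
  refine le_trans (Nat.mul_le_mul_left _ (sum_le_sum h1)) ?_
  simp only [sum_const, card_piFinset, card_range, prod_const, card_univ, card_fin, smul_eq_mul]
  rw [← mul_assoc, ← pow_add, two_mul]

lemma D_bound {k m S : ℕ} (hk : 2 ≤ k) (hm : k ^ 2 ≤ m) (hS : k + m ≤ S) :
    2 * ((k + m).factorial ^ 2 * (4 ^ (2 * m) * 2 ^ (2 * m) * (k ^ k * 4 ^ (k * (k - 1) / 2)))
      + (4 ^ k * k ^ (k + m)) ^ 2 * ((k + m) * (2 ^ (2 * k) * 2 ^ (2 * m)))) ≤ (8 * S) ^ (3 * S) := by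
  have hk2 : k ^ 2 ≤ S := by omega
  have hkS : k ≤ S := by omega
  have hS1 : 1 ≤ S := by omega
  have h1 : (k + m).factorial ≤ S ^ S := (Nat.factorial_le hS).trans (Nat.factorial_le_pow S)
  have h2 : k ^ k ≤ S ^ S := (Nat.pow_le_pow_left hkS _).trans (Nat.pow_le_pow_right hS1 hkS)
  have h3 : (4:ℕ) ^ (k * (k - 1) / 2) ≤ 2 ^ S := by
    rw [show (4:ℕ) = 2 ^ 2 by norm_num, ← pow_mul]
    refine Nat.pow_le_pow_right (by norm_num) ?_
    have : k * (k - 1) ≤ k ^ 2 := by rw [sq]; exact Nat.mul_le_mul_left _ (by omega)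
    omega
  have h4 : (4:ℕ) ^ (2 * m) * 2 ^ (2 * m) ≤ 64 ^ S := by
    rw [← mul_pow, pow_mul]
    exact Nat.pow_le_pow_right (by norm_num) (by omega)
  have h5 : (4 ^ k * k ^ (k + m)) ^ 2 ≤ 16 ^ S * S ^ S := by
    rw [mul_pow, ← pow_mul, ← pow_mul, mul_comm k 2, mul_comm (k + m) 2, pow_mul, pow_mul]
    refine Nat.mul_le_mul (Nat.pow_le_pow_right (by norm_num) hkS) ?_
    exact (Nat.pow_le_pow_left hk2 _).trans (Nat.pow_le_pow_right hS1 hS)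
  have h6 : (k + m) * (2 ^ (2 * k) * 2 ^ (2 * m)) ≤ 2 ^ S * 4 ^ S := by
    refine Nat.mul_le_mul (hS.trans Nat.lt_two_pow_self.le) ?_
    rw [← pow_add, ← mul_add, pow_mul]
    exact Nat.pow_le_pow_right (by norm_num) hS
  have h7 : (k + m).factorial ^ 2 * (4 ^ (2 * m) * 2 ^ (2 * m) * (k ^ k * 4 ^ (k * (k - 1) / 2))) ≤
      128 ^ S * (S ^ S) ^ 3 := by
    calc _ ≤ (S ^ S) ^ 2 * (64 ^ S * (S ^ S * 2 ^ S)) := by gcongr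
      _ = (64 * 2) ^ S * (S ^ S) ^ 3 := by rw [mul_pow]; ring
      _ = _ := by norm_num
  have h8 : (4 ^ k * k ^ (k + m)) ^ 2 * ((k + m) * (2 ^ (2 * k) * 2 ^ (2 * m))) ≤ 128 ^ S * (S ^ S) ^ 3 := by
    calc _ ≤ (16 ^ S * S ^ S) * (2 ^ S * 4 ^ S) := Nat.mul_le_mul h5 h6
      _ = (16 * 2 * 4) ^ S * (S ^ S) ^ 1 := by rw [mul_pow, mul_pow]; ring
      _ ≤ 128 ^ S * (S ^ S) ^ 3 := by
        norm_num
        exact Nat.le_self_pow (by norm_num) _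
  have h9 : 4 ≤ 4 ^ S := Nat.le_self_pow (by omega) _
  calc _ ≤ 2 * (128 ^ S * (S ^ S) ^ 3 + 128 ^ S * (S ^ S) ^ 3) := by gcongr
    _ = 4 * (128 ^ S * (S ^ S) ^ 3) := by ring
    _ ≤ 4 ^ S * (128 ^ S * (S ^ S) ^ 3) := Nat.mul_le_mul_right _ h9
    _ = (4 * 128) ^ S * (S ^ S) ^ 3 := by rw [mul_pow]; ring
    _ = _ := by
      rw [mul_pow 8, pow_mul 8, ← pow_mul, mul_comm S 3]; norm_num

set_option maxHeartbeats 1000000 in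
lemma J_step {k m S : ℕ} (hk : 2 ≤ k) (hm : k ^ 2 ≤ m) (hS : k + m ≤ S) {C δ : ℝ}
    (hC : (k : ℝ) ^ (k ^ 3) ≤ C) (hδ : 0 ≤ δ) (hδK : δ ≤ k * (k + 1) / 2)
    (IH : ∀ P : ℕ, 1 ≤ P → (Jv (Fin m) k P : ℝ) ≤ C * (P : ℝ) ^ (2 * (m : ℝ) - k * (k + 1) / 2 + δ))
    (P : ℕ) (hP : 1 ≤ P) :
    (Jv (Fin (k + m)) k P : ℝ) ≤ (8 * S : ℝ) ^ (3 * S) * C *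
      (P : ℝ) ^ (2 * ((k + m : ℕ) : ℝ) - k * (k + 1) / 2 + (1 - 1 / k) * δ) := by
  have hk1 : (2:ℝ) ≤ k := by exact_mod_cast hk
  have hk0 : (0:ℝ) < k := by linarith
  have hP1 : (1:ℝ) ≤ P := by exact_mod_cast hP
  have hP0 : (0:ℝ) < P := by linarith
  have hmR : (k:ℝ) ^ 2 ≤ m := by exact_mod_cast hm
  have hSR : (k + m : ℝ) ≤ S := by exact_mod_cast hS
  have hkk1 : (1:ℝ) ≤ (k:ℝ) ^ (k ^ 3) := one_le_pow₀ (by linarith)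
  have hC1 : 1 ≤ C := hkk1.trans hC
  have hD1 : (1:ℝ) ≤ (8 * S : ℝ) ^ (3 * S) := one_le_pow₀ (by nlinarith)
  have hfac : 0 ≤ 1 - 1 / (k:ℝ) := by
    have : 1 / (k:ℝ) ≤ 1 := by rw [div_le_one hk0]; linarith
    linarith
  rcases lt_or_ge P (k ^ k) with hsmall | hbig
  · -- trivial range
    have h1 : (Jv (Fin (k + m)) k P : ℝ) ≤ (P : ℝ) ^ (2 * ((k + m : ℕ) : ℝ)) := by
      have := Jv_triv (Fin (k + m)) k P
      rw [card_fin] at this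
      have h2 : (Jv (Fin (k + m)) k P : ℝ) ≤ (P : ℝ) ^ (2 * (k + m)) := by exact_mod_cast this
      rw [← rpow_natCast] at h2
      push_cast at h2 ⊢
      exact h2
    have h2 : (P : ℝ) ^ (k * (k + 1) / 2 - (1 - 1 / k) * δ : ℝ) ≤ (k:ℝ) ^ (k ^ 3) := by
      have hPk : (P:ℝ) ≤ (k:ℝ) ^ k := by exact_mod_cast hsmall.le
      calc (P : ℝ) ^ (k * (k + 1) / 2 - (1 - 1 / k) * δ : ℝ) ≤ (P : ℝ) ^ ((k ^ 2 : ℕ) : ℝ) := by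
            refine rpow_le_rpow_of_exponent_le hP1 ?_
            push_cast
            nlinarith [mul_nonneg hfac hδ]
        _ = (P : ℝ) ^ (k ^ 2) := rpow_natCast _ _
        _ ≤ ((k:ℝ) ^ k) ^ (k ^ 2) := pow_le_pow_left₀ hP0.le hPk _
        _ = (k:ℝ) ^ (k ^ 3) := by rw [← pow_mul]; congr 1; ring
    calc (Jv (Fin (k + m)) k P : ℝ) ≤ (P : ℝ) ^ (2 * ((k + m : ℕ) : ℝ)) := h1
      _ = (P : ℝ) ^ (k * (k + 1) / 2 - (1 - 1 / k) * δ : ℝ) * (P : ℝ) ^ (2 * ((k + m : ℕ) : ℝ) - k * (k + 1) / 2 + (1 - 1 / k) * δ) := by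
          rw [← rpow_add hP0]; congr 1; ring
      _ ≤ _ := by
          gcongr
          calc _ ≤ (k:ℝ) ^ (k ^ 3) := h2
            _ ≤ C := hC
            _ ≤ _ := le_mul_of_one_le_left (by linarith) hD1
  · set Q : ℝ := (P : ℝ) ^ (1 / (k:ℝ)) with hQ
    have hQ0 : 0 < Q := rpow_pos_of_pos hP0 _
    have hQk : Q ^ k = P := by
      rw [hQ, ← rpow_natCast, ← rpow_mul hP0.le, one_div_mul_cancel hk0.ne', rpow_one]
    have hkQ : (k:ℝ) ≤ Q := by
      refine le_of_pow_le_pow_left₀ (n := k) (by omega) hQ0.le ?_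
      rw [hQk]; exact_mod_cast hbig
    have hQ1 : 1 ≤ Q := by linarith
    obtain ⟨p, hp, hp1, hp2⟩ := Nat.exists_prime_lt_and_le_two_mul ⌈Q⌉₊ (by
      rw [Nat.ne_zero_iff_zero_lt, Nat.ceil_pos]; exact hQ0)
    have hQp : Q ≤ p := (Nat.le_ceil Q).trans (by exact_mod_cast hp1.le)
    have hp4 : (p:ℝ) ≤ 4 * Q := by
      have : (p:ℝ) ≤ 2 * (⌈Q⌉₊ : ℝ) := by exact_mod_cast hp2
      have := Nat.ceil_lt_add_one hQ0.le
      linarith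
    have hkp : k < p := lt_of_le_of_lt (by
      have : (k:ℝ) ≤ (⌈Q⌉₊ : ℝ) := hkQ.trans (Nat.le_ceil Q)
      exact_mod_cast this) hp1
    have hPpk : P ≤ p ^ k := by
      have : (P:ℝ) ≤ (p:ℝ) ^ k := by rw [← hQk]; exact pow_le_pow_left₀ hQ0.le hQp _
      exact_mod_cast this
    have hp0 : (0:ℝ) < p := by linarith
    set P' : ℕ := P / p + 1 with hP'
    have hPP : P ≤ p * P' := (Nat.lt_mul_div_succ P hp.pos).le
    have hP'1 : 1 ≤ P' := Nat.le_add_left _ _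
    have hP'2 : (P':ℝ) ≤ 2 * Q ^ (k - 1) := by
      rw [hP']; push_cast
      have h1 : ((P / p : ℕ) : ℝ) ≤ (P:ℝ) / p := Nat.cast_div_le
      have h2 : (P:ℝ) / p ≤ Q ^ (k - 1) := by
        rw [div_le_iff₀ hp0, ← hQk]
        calc Q ^ k = Q ^ (k - 1) * Q := by rw [← pow_succ]; congr 1; omega
          _ ≤ _ := by gcongr
      have h3 : 1 ≤ Q ^ (k - 1) := one_le_pow₀ hQ1
      linarith
    set e : ℝ := 2 * (m:ℝ) - k * (k + 1) / 2 + δ with he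
    have he0 : 0 ≤ e := by rw [he]; nlinarith only [hmR, hk1, hδ]
    have hrec := J_rec hp hkp (by omega : 1 ≤ k) (by nlinarith only [hm, hk] : 1 ≤ m) hPpk hPP
    have hcg := Jv_congr (finSumFinEquiv (m := k) (n := m)).symm k P
    have hadd := Jv_add k m P'
    have hJm := IH P' hP'1
    set q1 : ℝ := Q ^ ((k - 1) * e : ℝ) with hq1
    have hq10 : 0 < q1 := rpow_pos_of_pos hQ0 _
    have hJm' : (Jv (Fin m) k P' : ℝ) ≤ C * (2 ^ (2 * m) * q1) := by
      refine hJm.trans ?_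
      have h1 : (P':ℝ) ^ e ≤ (2 * Q ^ (k - 1)) ^ e := rpow_le_rpow (by positivity) hP'2 he0
      have h2 : (2 * Q ^ (k - 1)) ^ e = 2 ^ e * q1 := by
        rw [mul_rpow (by norm_num) (by positivity), ← rpow_natCast, ← rpow_mul hQ0.le, hq1]
        push_cast [Nat.cast_sub (by omega : 1 ≤ k)]; rfl
      have h3 : (2:ℝ) ^ e ≤ 2 ^ (2 * m) := by
        rw [← rpow_natCast]
        refine rpow_le_rpow_of_exponent_le (by norm_num) ?_
        rw [he]; push_cast; linarith
      rw [h2] at h1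
      have h4 : (2:ℝ) ^ e * q1 ≤ 2 ^ (2 * m) * q1 := by gcongr
      exact mul_le_mul_of_nonneg_left (h1.trans h4) (by linarith)
    set N : ℕ := k * (k - 1) / 2 with hN
    have hNR : (N:ℝ) = k * (k - 1) / 2 := by
      have : 2 * N = k * (k - 1) := by
        rw [hN]; exact Nat.mul_div_cancel' (Nat.even_mul_pred_self k).two_dvd
      have : (2:ℝ) * N = k * ((k - 1 : ℕ) : ℝ) := by exact_mod_cast this
      rw [Nat.cast_sub (by omega)] at this; push_cast at this; linarith
    set X : ℝ := (P : ℝ) ^ (2 * ((k + m : ℕ) : ℝ) - k * (k + 1) / 2 + (1 - 1 / k) * δ) with hX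
    have hXQ : X = Q ^ (k * (2 * ((k + m : ℕ) : ℝ) - k * (k + 1) / 2) + (k - 1) * δ : ℝ) := by
      rw [hX, ← hQk, ← rpow_natCast, ← rpow_mul hQ0.le]
      congr 1; field_simp
    have hE1 : Q ^ (2 * m) * (q1 * ((Q ^ k) ^ k * Q ^ N)) = X := by
      rw [hXQ, hq1, ← pow_mul, ← rpow_natCast, ← rpow_natCast, ← rpow_natCast, ← rpow_add hQ0,
        ← rpow_add hQ0, ← rpow_add hQ0]
      congr 1
      push_cast; rw [hNR, he]; ring
    have hE2 : (Q ^ k) ^ 2 * ((Q ^ (k - 1)) ^ (2 * k) * q1) ≤ X := by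
      rw [hXQ, hq1, ← pow_mul, ← pow_mul, ← rpow_natCast, ← rpow_natCast, ← rpow_add hQ0,
        ← rpow_add hQ0]
      refine rpow_le_rpow_of_exponent_le hQ1 ?_
      push_cast [Nat.cast_sub (by omega : 1 ≤ k)]
      rw [he]
      have hh : (k * (k + 1) / 2 : ℝ) ≤ 2 * m := by nlinarith only [hmR, hk1]
      linarith only [hh]
    have hX0 : 0 < X := rpow_pos_of_pos hP0 _
    have hT1 : ((k + m).factorial : ℝ) ^ 2 *
        ((p:ℝ) ^ (2 * m) * (Jv (Fin m) k P' * ((P:ℝ) ^ k * ((k:ℝ) ^ k * (p:ℝ) ^ N))))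
        ≤ ((k + m).factorial : ℝ) ^ 2 * (4 ^ (2 * m) * 2 ^ (2 * m) * ((k:ℝ) ^ k * 4 ^ N)) * (C * X) := by
      calc _ ≤ ((k + m).factorial : ℝ) ^ 2 *
          ((4 * Q) ^ (2 * m) * ((C * (2 ^ (2 * m) * q1)) * ((Q ^ k) ^ k * ((k:ℝ) ^ k * (4 * Q) ^ N)))) := by
            rw [← hQk]; gcongr
        _ = _ := by rw [← hE1, mul_pow, mul_pow]; ring
    have hT2 : ((p:ℝ) ^ k * (k:ℝ) ^ (k + m)) ^ 2 * ((k + m) * Jv (Fin k ⊕ Fin m) k P')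
        ≤ (4 ^ k * (k:ℝ) ^ (k + m)) ^ 2 * ((k + m) * (2 ^ (2 * k) * 2 ^ (2 * m))) * (C * X) := by
      have haddR : (Jv (Fin k ⊕ Fin m) k P' : ℝ) ≤ (P':ℝ) ^ (2 * k) * Jv (Fin m) k P' := by exact_mod_cast hadd
      calc _ ≤ ((4 * Q) ^ k * (k:ℝ) ^ (k + m)) ^ 2 * ((k + m) * ((2 * Q ^ (k - 1)) ^ (2 * k) * (C * (2 ^ (2 * m) * q1)))) := by
            gcongr
            refine haddR.trans ?_
            gcongr
        _ = (4 ^ k * (k:ℝ) ^ (k + m)) ^ 2 * ((k + m) * (2 ^ (2 * k) * 2 ^ (2 * m))) * (C * ((Q ^ k) ^ 2 * ((Q ^ (k - 1)) ^ (2 * k) * q1))) := by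
            rw [mul_pow 4 Q, mul_pow 2 (Q ^ (k - 1))]; ring
        _ ≤ _ := by gcongr
    have hDb : (2 * (((k + m).factorial : ℝ) ^ 2 * (4 ^ (2 * m) * 2 ^ (2 * m) * ((k:ℝ) ^ k * 4 ^ N))
      + (4 ^ k * (k:ℝ) ^ (k + m)) ^ 2 * ((k + m) * (2 ^ (2 * k) * 2 ^ (2 * m))))) ≤ (8 * S : ℝ) ^ (3 * S) := by
      exact_mod_cast D_bound hk hm hS
    have hrecR : (Jv (Fin (k + m)) k P : ℝ) ≤ 2 * (((k + m).factorial : ℝ) ^ 2 *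
        ((p:ℝ) ^ (2 * m) * (Jv (Fin m) k P' * ((P:ℝ) ^ k * ((k:ℝ) ^ k * (p:ℝ) ^ N)))) +
        ((p:ℝ) ^ k * (k:ℝ) ^ (k + m)) ^ 2 * ((k + m) * Jv (Fin k ⊕ Fin m) k P')) := by
      exact_mod_cast hcg.trans hrec
    calc _ ≤ _ := hrecR
      _ ≤ 2 * (((k + m).factorial : ℝ) ^ 2 * (4 ^ (2 * m) * 2 ^ (2 * m) * ((k:ℝ) ^ k * 4 ^ N)) * (C * X)
        + (4 ^ k * (k:ℝ) ^ (k + m)) ^ 2 * ((k + m) * (2 ^ (2 * k) * 2 ^ (2 * m))) * (C * X)) := by linarith only [hT1, hT2]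
      _ = (2 * (((k + m).factorial : ℝ) ^ 2 * (4 ^ (2 * m) * 2 ^ (2 * m) * ((k:ℝ) ^ k * 4 ^ N))
      + (4 ^ k * (k:ℝ) ^ (k + m)) ^ 2 * ((k + m) * (2 ^ (2 * k) * 2 ^ (2 * m))))) * (C * X) := by ring
      _ ≤ (8 * S : ℝ) ^ (3 * S) * (C * X) := by gcongr
      _ = _ := by ring

lemma J_iter {k S : ℕ} (hk : 2 ≤ k) (r : ℕ) (hS : k ^ 2 + r * k ≤ S) (P : ℕ) (hP : 1 ≤ P) :
    (Jv (Fin (k ^ 2 + r * k)) k P : ℝ) ≤ ((8 * S : ℝ) ^ (3 * S)) ^ r * (k : ℝ) ^ (k ^ 3) *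
      (P : ℝ) ^ (2 * ((k ^ 2 + r * k : ℕ) : ℝ) - k * (k + 1) / 2 + (1 - 1 / k) ^ r * (k * (k + 1) / 2)) := by
  have hk1 : (2:ℝ) ≤ k := by exact_mod_cast hk
  have hfac : 0 ≤ 1 - 1 / (k:ℝ) := by
    have : 1 / (k:ℝ) ≤ 1 := by rw [div_le_one (by linarith)]; linarith
    linarith
  have hfac1 : 1 - 1 / (k:ℝ) ≤ 1 := by
    have : 0 < 1 / (k:ℝ) := by positivity
    linarith
  have hkk1 : (1:ℝ) ≤ (k:ℝ) ^ (k ^ 3) := one_le_pow₀ (by linarith)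
  have hS1 : (1:ℝ) ≤ S := by
    have : 1 ≤ S := by nlinarith
    exact_mod_cast this
  have hD1 : (1:ℝ) ≤ (8 * S : ℝ) ^ (3 * S) := one_le_pow₀ (by linarith)
  induction r generalizing P with
  | zero =>
    have := Jv_triv (Fin (k ^ 2 + 0 * k)) k P
    rw [card_fin] at this
    have h2 : (Jv (Fin (k ^ 2 + 0 * k)) k P : ℝ) ≤ (P : ℝ) ^ (2 * (k ^ 2 + 0 * k)) := by exact_mod_cast this
    rw [← rpow_natCast] at h2
    rw [pow_zero, pow_zero, one_mul, one_mul, sub_add_cancel]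
    refine h2.trans ?_
    push_cast
    exact le_mul_of_one_le_left (by positivity) hkk1
  | succ r ih =>
    have hS' : k ^ 2 + r * k ≤ S := by nlinarith
    have := J_step (m := k ^ 2 + r * k) (S := S) (C := ((8 * S : ℝ) ^ (3 * S)) ^ r * (k : ℝ) ^ (k ^ 3))
      (δ := (1 - 1 / k) ^ r * (k * (k + 1) / 2)) hk (by omega) (by linarith) ?_ ?_ ?_ (ih hS') P hP
    · rw [show k ^ 2 + (r + 1) * k = k + (k ^ 2 + r * k) by ring]
      refine this.trans (le_of_eq ?_)
      rw [pow_succ, pow_succ]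
      congr 1
      · ring
      · congr 1; ring
    · exact le_mul_of_one_le_left (by positivity) (one_le_pow₀ hD1)
    · positivity
    · have : (1 - 1 / (k:ℝ)) ^ r ≤ 1 := pow_le_one₀ hfac hfac1
      exact mul_le_of_le_one_left (by positivity) this

lemma J_main {k : ℕ} (hk : 2 ≤ k) (P : ℕ) (hP : 1 ≤ P) :
    (Jv (Fin (9 * k ^ 2)) k P : ℝ) ≤ ((72 * k ^ 2 : ℝ) ^ (27 * k ^ 2)) ^ (8 * k) * (k : ℝ) ^ (k ^ 3) *
      (P : ℝ) ^ (18 * (k : ℝ) ^ 2 - k * (k + 1) / 2 + k * (k + 1) / 5000) := by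
  have hk1 : (2:ℝ) ≤ k := by exact_mod_cast hk
  have hP1 : (1:ℝ) ≤ P := by exact_mod_cast hP
  have h := J_iter hk (8 * k) (S := 9 * k ^ 2) (by nlinarith) P hP
  have e1 : k ^ 2 + 8 * k * k = 9 * k ^ 2 := by ring
  rw [e1] at h
  refine h.trans ?_
  have e2 : (8 * ((9 * k ^ 2 : ℕ) : ℝ)) = 72 * k ^ 2 := by push_cast; ring
  rw [e2, show 3 * (9 * k ^ 2) = 27 * k ^ 2 by ring]
  refine mul_le_mul_of_nonneg_left (rpow_le_rpow_of_exponent_le hP1 ?_) (by positivity)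
  have h1 : (1 - 1 / (k:ℝ)) ^ (8 * k) ≤ 1 / 2500 := by
    have h2 : 1 - 1 / (k:ℝ) ≤ Real.exp (-(1 / k)) := by
      have := add_one_le_exp (-(1 / (k:ℝ))); linarith
    have h3 : 0 ≤ 1 - 1 / (k:ℝ) := by
      have : 1 / (k:ℝ) ≤ 1 := by rw [div_le_one (by linarith)]; linarith
      linarith
    calc _ ≤ (Real.exp (-(1 / (k:ℝ)))) ^ (8 * k) := pow_le_pow_left₀ h3 h2 _
      _ = Real.exp (-8) := by
        rw [← exp_nat_mul]; congr 1; push_cast; field_simp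
      _ ≤ _ := by
        rw [exp_neg, one_div]
        refine inv_anti₀ (by norm_num) ?_
        have := exp_one_gt_d9
        calc (2500:ℝ) ≤ 2.7 ^ 8 := by norm_num
          _ ≤ (Real.exp 1) ^ 8 := pow_le_pow_left₀ (by norm_num) (by linarith) _
          _ = _ := by rw [← exp_nat_mul]; norm_num
  have h4 : (1 - 1 / (k:ℝ)) ^ (8 * k) * (k * (k + 1) / 2) ≤ 1 / 2500 * (k * (k + 1) / 2) := by gcongr
  push_cast
  nlinarith


noncomputable def ee (θ : ℝ) : ℂ := Complex.exp ((2 * π * θ : ℝ) * I)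

lemma ee_add (a b : ℝ) : ee (a + b) = ee a * ee b := by
  unfold ee; rw [← Complex.exp_add]; congr 1; push_cast; ring

lemma ee_zero : ee 0 = 1 := by simp [ee]

lemma norm_ee (a : ℝ) : ‖ee a‖ = 1 := Complex.norm_exp_ofReal_mul_I _

lemma ee_neg (a : ℝ) : ee (-a) = (starRingEnd ℂ) (ee a) := by
  unfold ee; rw [← Complex.exp_conj, map_mul, Complex.conj_ofReal, Complex.conj_I]; congr 1; push_cast; ring

lemma ee_sum {ι : Type*} (s : Finset ι) (g : ι → ℝ) : ee (∑ i ∈ s, g i) = ∏ i ∈ s, ee (g i) := by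
  induction s using Finset.induction_on with
  | empty => simp [ee_zero]
  | insert a s ha ih => rw [sum_insert ha, Finset.prod_insert ha, ee_add, ih]

lemma diff_sum {Ω G : Type*} [AddCommGroup G] (U : Finset Ω) (h : Ω → G) (L : Finset G)
    (hL : ∀ a ∈ U, ∀ b ∈ U, h a - h b ∈ L) (φ : G → ℝ) (hφ : ∀ g, 0 ≤ φ g) :
    ∑ z ∈ U ×ˢ U, φ (h z.1 - h z.2) ≤ En U h * ∑ l ∈ L, φ l := by
  have hm : ∀ z ∈ U ×ˢ U, h z.1 - h z.2 ∈ L := fun z hz => by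
    rw [mem_product] at hz; exact hL _ hz.1 _ hz.2
  rw [← Finset.sum_fiberwise_of_maps_to hm, mul_sum]
  refine sum_le_sum fun l _ => ?_
  have : ∑ z ∈ (U ×ˢ U).filter (fun z => h z.1 - h z.2 = l), φ (h z.1 - h z.2) =
      (((U ×ˢ U).filter (fun z => h z.1 - h z.2 = l)).card : ℝ) * φ l := by
    rw [← nsmul_eq_mul, ← sum_const]
    refine sum_congr rfl fun z hz => ?_
    rw [(mem_filter.1 hz).2]
  rw [this]
  refine mul_le_mul_of_nonneg_right ?_ (hφ l)
  have h2 := En_shift U h l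
  have h3 : ((U ×ˢ U).filter (fun z => h z.1 - h z.2 = l)) = ((U ×ˢ U).filter (fun z => h z.1 = h z.2 + l)) := by
    ext z; simp only [mem_filter, sub_eq_iff_eq_add']
  rw [h3]; exact_mod_cast h2

noncomputable def hv (s k : ℕ) (z : Fin s → ℕ) : Fin k → ℤ := ∑ i, pv k (z i : ℤ)

noncomputable def Vb (s P : ℕ) : Finset (Fin s → ℕ) := piFinset fun _ : Fin s => range P

lemma pow_expand (s k P : ℕ) (β : Fin k → ℝ) :
    ((‖∑ y ∈ range P, ee (∑ j, β j * (y:ℝ) ^ (j.1 + 1))‖ ^ (2 * s) : ℝ) : ℂ) =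
      ∑ z ∈ Vb s P ×ˢ Vb s P, ee (∑ j, β j * ((hv s k z.1 - hv s k z.2) j : ℤ)) := by
  have h1 : (∑ y ∈ range P, ee (∑ j, β j * (y:ℝ) ^ (j.1 + 1))) ^ s =
      ∑ z ∈ Vb s P, ee (∑ j, β j * (hv s k z j : ℤ)) := by
    have := prod_univ_sum (fun _ : Fin s => range P) (fun _ y => ee (∑ j : Fin k, β j * (y:ℝ) ^ (j.1 + 1)))
    rw [prod_const, card_univ, card_fin] at this
    rw [this]
    refine sum_congr rfl fun z _ => ?_
    rw [← ee_sum, sum_comm]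
    congr 1
    refine sum_congr rfl fun j _ => ?_
    rw [← mul_sum]
    congr 1
    simp [hv, pv, Finset.sum_apply]
  rw [pow_mul', ← norm_pow, h1]
  push_cast
  rw [← Complex.mul_conj', map_sum, Finset.sum_mul_sum, sum_product]
  refine sum_congr rfl fun z _ => sum_congr rfl fun w _ => ?_
  rw [← ee_neg, ← ee_add, ← Finset.sum_neg_distrib, ← Finset.sum_add_distrib]
  congr 1
  refine sum_congr rfl fun j _ => ?_
  push_cast [Pi.sub_apply]; ring

noncomputable def Ww (α : ℝ) (M : ℕ) : ℝ :=
  ∑ μ ∈ Finset.Icc (-(M:ℤ)) M, ‖∑ l ∈ Finset.Icc (-(M:ℤ)) M, ee (α * l * μ)‖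

lemma diff_box {s k P : ℕ} {a b : Fin s → ℕ} (ha : a ∈ Vb s P) (hb : b ∈ Vb s P) :
    hv s k a - hv s k b ∈ piFinset fun j : Fin k =>
      Finset.Icc (-((s * P ^ (j.1 + 1) : ℕ):ℤ)) ((s * P ^ (j.1 + 1) : ℕ) : ℤ) := by
  have key : ∀ a ∈ Vb s P, ∀ j : Fin k, 0 ≤ hv s k a j ∧ hv s k a j ≤ ((s * P ^ (j.1 + 1) : ℕ) : ℤ) := by
    intro a ha j
    simp only [Vb, mem_piFinset, mem_range] at ha
    simp only [hv, pv, Finset.sum_apply]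
    refine ⟨sum_nonneg fun i _ => by positivity, ?_⟩
    have : ∑ i : Fin s, (a i : ℤ) ^ (j.1 + 1) ≤ ∑ i : Fin s, (P : ℤ) ^ (j.1 + 1) :=
      sum_le_sum fun i _ => pow_le_pow_left₀ (by positivity) (by exact_mod_cast (ha i).le) _
    simpa using this
  rw [mem_piFinset]
  intro j
  rw [mem_Icc, Pi.sub_apply]
  have h1 := key a ha j
  have h2 := key b hb j
  constructor <;> linarith

lemma card_Vb (s P : ℕ) : (Vb s P).card = P ^ s := by simp [Vb]

lemma sum_pow_le {ι : Type*} (T : Finset ι) (f : ι → ℝ) (hf : ∀ i ∈ T, 0 ≤ f i) (n : ℕ) :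
    (∑ i ∈ T, f i) ^ (n + 1) ≤ (T.card : ℝ) ^ n * ∑ i ∈ T, f i ^ (n + 1) := by
  rcases T.eq_empty_or_nonempty with rfl | hT
  · simp
  have := pow_sum_div_card_le_sum_pow (s := T) (f := f) hf n
  have hc : (0:ℝ) < (T.card : ℝ) ^ n := by have := hT.card_pos; positivity
  rw [div_le_iff₀ hc] at this
  linarith

lemma real_le_of_cast {ι : Type*} {A : ℝ} {T : Finset ι} {f : ι → ℂ} (hA : 0 ≤ A) (h : (A : ℂ) = ∑ i ∈ T, f i) :
    A ≤ ∑ i ∈ T, ‖f i‖ := by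
  have : ‖(A:ℂ)‖ = A := by rw [norm_real, norm_of_nonneg hA]
  rw [← this, h]; exact norm_sum_le _ _

lemma bilinear (s k P : ℕ) (hs : 1 ≤ s) (α : Fin k → ℝ) :
    ‖∑ x ∈ range P, ∑ y ∈ range P, ee (∑ j, α j * ((x:ℝ) * y) ^ (j.1 + 1))‖ ^ ((2 * s) * (2 * s)) ≤
      ((P:ℝ) ^ (2 * s - 1)) ^ (2 * s) * (((P:ℝ) ^ (2 * s)) ^ (2 * s - 1) *
        ((Jv (Fin s) k P : ℝ) ^ 2 * ∏ j : Fin k, Ww (α j) (s * P ^ (j.1 + 1)))) := by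
  obtain ⟨n, hn⟩ : ∃ n, 2 * s = n + 1 := ⟨2 * s - 1, by omega⟩
  set J : ℝ := (Jv (Fin s) k P : ℝ) with hJ
  have hJE : J = En (Vb s P) (hv s k) := rfl
  set L : Finset (Fin k → ℤ) := piFinset fun j : Fin k =>
      Finset.Icc (-((s * P ^ (j.1 + 1) : ℕ):ℤ)) ((s * P ^ (j.1 + 1) : ℕ) : ℤ) with hL
  set S : (Fin k → ℤ) → ℂ := fun l => ∑ x ∈ range P, ee (∑ j, (α j * l j) * (x:ℝ) ^ (j.1 + 1)) with hS
  set F : (Fin k → ℤ) → ℂ := fun μ => ∑ l ∈ L, ee (∑ j, (α j * l j) * μ j) with hF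
  set g : ℕ → ℂ := fun x => ∑ y ∈ range P, ee (∑ j, (α j * (x:ℝ) ^ (j.1 + 1)) * (y:ℝ) ^ (j.1 + 1)) with hg
  have hU : ‖∑ x ∈ range P, ∑ y ∈ range P, ee (∑ j, α j * ((x:ℝ) * y) ^ (j.1 + 1))‖
      ≤ ∑ x ∈ range P, ‖g x‖ := by
    refine (norm_sum_le _ _).trans (le_of_eq ?_)
    refine sum_congr rfl fun x _ => ?_
    simp only [hg, mul_pow, mul_assoc]
  set A : ℝ := ∑ x ∈ range P, ‖g x‖ ^ (2 * s) with hA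
  set B : ℝ := ∑ z ∈ Vb s P ×ˢ Vb s P, ‖S (hv s k z.1 - hv s k z.2)‖ with hB
  set D : ℝ := ∑ l ∈ L, ‖S l‖ ^ (2 * s) with hD
  have hA0 : 0 ≤ A := sum_nonneg fun _ _ => by positivity
  have hB0 : 0 ≤ B := sum_nonneg fun _ _ => by positivity
  have hD0 : 0 ≤ D := sum_nonneg fun _ _ => by positivity
  have h1 : (∑ x ∈ range P, ‖g x‖) ^ (2 * s) ≤ (P:ℝ) ^ n * A := by
    rw [hA, hn]
    simpa using sum_pow_le (range P) (fun x => ‖g x‖) (fun _ _ => norm_nonneg _) n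
  have h2 : A ≤ B := by
    refine real_le_of_cast hA0 ?_
    rw [hA]
    rw [ofReal_sum]
    simp only [hg, pow_expand]
    rw [sum_comm]
    refine sum_congr rfl fun z _ => ?_
    simp only [hS]
    refine sum_congr rfl fun x _ => ?_
    congr 1
    refine sum_congr rfl fun j _ => ?_
    ring
  have h3 : B ^ (2 * s) ≤ ((P:ℝ) ^ (2 * s)) ^ n * (J * D) := by
    have := sum_pow_le (Vb s P ×ˢ Vb s P) (fun z => ‖S (hv s k z.1 - hv s k z.2)‖) (fun _ _ => norm_nonneg _) n
    rw [card_product, card_Vb, ← pow_add, ← two_mul, Nat.cast_pow, ← hn] at this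
    refine this.trans (mul_le_mul_of_nonneg_left ?_ (by positivity))
    rw [hJE, hD]
    exact diff_sum (Vb s P) (hv s k) L (fun a ha b hb => diff_box ha hb) (fun l => ‖S l‖ ^ (2 * s)) (fun _ => by positivity)
  have h4 : D ≤ ∑ z ∈ Vb s P ×ˢ Vb s P, ‖F (hv s k z.1 - hv s k z.2)‖ := by
    refine real_le_of_cast hD0 ?_
    rw [hD, ofReal_sum]
    simp only [hS, pow_expand]
    rw [sum_comm]
  have h5 : ∑ z ∈ Vb s P ×ˢ Vb s P, ‖F (hv s k z.1 - hv s k z.2)‖ ≤ J * ∑ μ ∈ L, ‖F μ‖ := by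
    rw [hJE]
    exact diff_sum (Vb s P) (hv s k) L (fun a ha b hb => diff_box ha hb) (fun l => ‖F l‖) (fun _ => by positivity)
  have h6 : ∑ μ ∈ L, ‖F μ‖ = ∏ j : Fin k, Ww (α j) (s * P ^ (j.1 + 1)) := by
    unfold Ww
    rw [prod_univ_sum]
    refine sum_congr rfl fun μ _ => ?_
    rw [← norm_prod, prod_univ_sum]
    simp only [hF, ee_sum]
    rfl
  rw [h6] at h5
  have hn' : 2 * s - 1 = n := by omega
  rw [hn', pow_mul]
  calc _ ≤ ((P:ℝ) ^ n * A) ^ (2 * s) := by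
        refine pow_le_pow_left₀ (by positivity) ?_ _
        exact (pow_le_pow_left₀ (norm_nonneg _) hU _).trans h1
    _ = ((P:ℝ) ^ n) ^ (2 * s) * A ^ (2 * s) := mul_pow _ _ _
    _ ≤ ((P:ℝ) ^ n) ^ (2 * s) * (((P:ℝ) ^ (2 * s)) ^ n * (J * D)) := by
        gcongr
        exact (pow_le_pow_left₀ hA0 h2 _).trans h3
    _ ≤ ((P:ℝ) ^ n) ^ (2 * s) * (((P:ℝ) ^ (2 * s)) ^ n * (J * (J * ∏ j : Fin k, Ww (α j) (s * P ^ (j.1 + 1))))) := by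
        gcongr
        exact h4.trans h5
    _ = _ := by ring

lemma Ww_nonneg (α : ℝ) (M : ℕ) : 0 ≤ Ww α M := sum_nonneg fun _ _ => norm_nonneg _

lemma Ww_triv (α : ℝ) (M : ℕ) : Ww α M ≤ (2 * M + 1) ^ 2 := by
  unfold Ww
  have hc : ((Finset.Icc (-(M:ℤ)) M).card : ℝ) = 2 * M + 1 := by
    rw [Int.card_Icc]
    have : ((M:ℤ) + 1 - -(M:ℤ)).toNat = 2 * M + 1 := by omega
    rw [this]; push_cast; ring
  calc _ ≤ ∑ μ ∈ Finset.Icc (-(M:ℤ)) M, (2 * M + 1 : ℝ) := by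
        refine sum_le_sum fun μ _ => ?_
        refine (norm_sum_le _ _).trans ?_
        simp only [norm_ee, sum_const, nsmul_eq_mul, mul_one, hc, le_refl]
    _ = _ := by rw [sum_const, nsmul_eq_mul, hc]; ring


lemma sum_Icc_symm {E : Type*} [AddCommGroup E] (f : ℤ → E) (M : ℕ) :
    ∑ l ∈ Finset.Icc (-((M + 1 : ℕ):ℤ)) ((M + 1 : ℕ) : ℤ), f l =
      ∑ l ∈ Finset.Icc (-(M:ℤ)) M, f l + f (M + 1) + f (-(M + 1 : ℤ)) := by
  have : Finset.Icc (-((M + 1 : ℕ):ℤ)) ((M + 1 : ℕ) : ℤ) =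
      insert ((M:ℤ) + 1) (insert (-((M:ℤ) + 1)) (Finset.Icc (-(M:ℤ)) M)) := by
    ext x; simp only [mem_Icc, Finset.mem_insert]; push_cast; omega
  rw [this, sum_insert, sum_insert]
  · abel
  · simp only [mem_Icc]; omega
  · simp only [mem_Icc, Finset.mem_insert]; omega

lemma geo_sum (θ : ℝ) (M : ℕ) :
    (∑ l ∈ Finset.Icc (-(M:ℤ)) M, ee (θ * l)) * (ee θ - 1) = ee (θ * (M + 1)) - ee (-(θ * M)) := by
  induction M with
  | zero => simp [ee_zero]
  | succ M ih =>
    rw [sum_Icc_symm, add_mul, add_mul, ih]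
    push_cast
    rw [mul_sub, mul_sub, ← ee_add, ← ee_add]
    have e1 : θ * (M + 1) + θ = θ * (M + 1 + 1) := by ring
    have e2 : θ * -((M:ℝ) + 1) + θ = - (θ * M) := by ring
    have e3 : θ * -((M:ℝ) + 1) = -(θ * (M + 1)) := by ring
    rw [e1, e2, e3]; ring

lemma norm_ee_sub_one {θ : ℝ} (h : |θ| ≤ 1 / 2) : 4 * |θ| ≤ ‖ee θ - 1‖ := by
  unfold ee
  rw [mul_comm _ I, Complex.norm_exp_I_mul_ofReal_sub_one, norm_mul, norm_eq_abs, norm_eq_abs]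
  have h1 : |π * θ| ≤ π / 2 := by
    rw [abs_mul, abs_of_pos pi_pos]; nlinarith [pi_pos]
  have h2 := mul_abs_le_abs_sin h1
  have h3 : 2 / π * |π * θ| = 2 * |θ| := by
    rw [abs_mul, abs_of_pos pi_pos]; field_simp
  rw [show 2 * π * θ / 2 = π * θ by ring, abs_two]
  linarith

lemma geo_bound {θ : ℝ} (h0 : θ ≠ 0) (h : |θ| ≤ 1 / 2) (M : ℕ) :
    ‖∑ l ∈ Finset.Icc (-(M:ℤ)) M, ee (θ * l)‖ ≤ 1 / (2 * |θ|) := by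
  have h1 := norm_ee_sub_one h
  have hp : 0 < |θ| := abs_pos.2 h0
  have h2 : ‖∑ l ∈ Finset.Icc (-(M:ℤ)) M, ee (θ * l)‖ * ‖ee θ - 1‖ ≤ 2 := by
    rw [← norm_mul, geo_sum]
    refine (norm_sub_le _ _).trans ?_
    rw [norm_ee, norm_ee]; norm_num
  rw [le_div_iff₀ (by positivity)]
  nlinarith [norm_nonneg (∑ l ∈ Finset.Icc (-(M:ℤ)) M, ee (θ * l))]

lemma inv_sum_symm (f : ℤ → ℝ) (c : ℝ) (M : ℕ) (h0 : f 0 ≤ 2 * M + 1) 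
    (hf : ∀ l : ℤ, l ≠ 0 → |l| ≤ M → f l ≤ c * (1 / |(l:ℝ)|)) :
    ∑ l ∈ Finset.Icc (-(M:ℤ)) M, f l ≤ 2 * M + 1 + 2 * c * (harmonic M : ℝ) := by
  have key : ∀ m ≤ M, ∑ l ∈ Finset.Icc (-(m:ℤ)) m, f l ≤ 2 * M + 1 + 2 * c * (harmonic m : ℝ) := by
    intro m
    induction m with
    | zero => intro _; simpa using h0
    | succ m ih =>
      intro hm
      have h1 := ih (by omega)
      have hm' : ((m:ℤ) + 1) ≤ M := by exact_mod_cast hm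
      have h2 := hf (m + 1) (by omega) (by rw [abs_of_nonneg (by omega)]; exact hm')
      have h3 := hf (-(m + 1)) (by omega) (by rw [abs_neg, abs_of_nonneg (by omega)]; exact hm')
      rw [sum_Icc_symm, harmonic_succ]
      push_cast at h2 h3 ⊢
      rw [abs_neg] at h3
      rw [abs_of_nonneg (by positivity), one_div] at h2 h3
      linarith
  exact key M le_rfl

lemma Ww_bound {α : ℝ} (M : ℕ) (hα : α ≠ 0) (h : |α| * M ≤ 1 / 2) :
    Ww α M ≤ 2 * M + 1 + (1 + log M) / |α| := by
  have hp : 0 < |α| := abs_pos.2 hα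
  have h1 : Ww α M ≤ 2 * M + 1 + 2 * (1 / (2 * |α|)) * (harmonic M : ℝ) := by
    refine inv_sum_symm _ _ M ?_ ?_
    · refine (norm_sum_le _ _).trans ?_
      simp only [norm_ee, sum_const, nsmul_eq_mul, mul_one]
      rw [Int.card_Icc]
      have : ((M:ℤ) + 1 - -(M:ℤ)).toNat = 2 * M + 1 := by omega
      rw [this]; push_cast; linarith
    · intro l hl hlM
      have hl0 : (0:ℝ) < |(l:ℝ)| := abs_pos.2 (by exact_mod_cast hl)
      have hlM' : |(l:ℝ)| ≤ M := by exact_mod_cast hlM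
      have := geo_bound (θ := α * l) (mul_ne_zero hα (by exact_mod_cast hl)) (by
        rw [abs_mul]; exact (mul_le_mul_of_nonneg_left hlM' hp.le).trans h) M
      simp_rw [mul_right_comm α _ (l:ℝ)]
      refine this.trans (le_of_eq ?_)
      rw [abs_mul]; field_simp
  refine h1.trans ?_
  have h2 := harmonic_le_one_add_log M
  have : 2 * (1 / (2 * |α|)) * (harmonic M : ℝ) = (harmonic M : ℝ) / |α| := by field_simp
  rw [this]
  gcongr

lemma E_bound {k : ℕ} (hk : 2 ≤ k) :
    (((72 * k ^ 2 : ℝ) ^ (27 * k ^ 2)) ^ (8 * k) * (k : ℝ) ^ (k ^ 3)) ^ 2 * (3 * (9 * k ^ 2 : ℝ)) ^ (2 * k)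
      ≤ Real.exp (7 * (324 * k ^ 4)) := by
  have hk1 : (2:ℝ) ≤ k := by exact_mod_cast hk
  have h1 : (k:ℝ) ≤ Real.exp k := by have := add_one_le_exp (k:ℝ); linarith
  have h72 : (72:ℝ) ≤ Real.exp 5 := by
    have := exp_one_gt_d9
    calc (72:ℝ) ≤ 2.7 ^ 5 := by norm_num
      _ ≤ (Real.exp 1) ^ 5 := pow_le_pow_left₀ (by norm_num) (by linarith) _
      _ = _ := by rw [← exp_nat_mul]; norm_num
  have h2 : (72 * k ^ 2 : ℝ) ≤ Real.exp (5 * k) := by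
    calc (72 * k ^ 2 : ℝ) ≤ Real.exp 5 * (Real.exp k) ^ 2 := by gcongr
      _ = Real.exp (5 + 2 * k) := by rw [← exp_nat_mul, ← Real.exp_add]; norm_num
      _ ≤ _ := exp_le_exp.2 (by linarith)
  have h3 : (3 * (9 * k ^ 2 : ℝ)) ≤ Real.exp (5 * k) := le_trans (by nlinarith) h2
  calc _ ≤ (((Real.exp (5 * k)) ^ (27 * k ^ 2)) ^ (8 * k) * (Real.exp k) ^ (k ^ 3)) ^ 2 * (Real.exp (5 * k)) ^ (2 * k) := by
        gcongr
    _ = Real.exp (2 * (1081 * k ^ 4) + 10 * k ^ 2) := by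
        simp only [← exp_nat_mul, ← Real.exp_add]
        congr 1; push_cast; ring
    _ ≤ _ := exp_le_exp.2 (by nlinarith [sq_nonneg (k:ℝ), mul_nonneg (sq_nonneg (k:ℝ)) (by nlinarith : (0:ℝ) ≤ (k:ℝ) ^ 2 - 1)])

lemma U_abs {k : ℕ} (hk : 2 ≤ k) (P : ℕ) (hP : 1 ≤ P) (α : Fin k → ℝ) (G : Finset (Fin k)) (ρ : ℝ) (hρ : 0 ≤ ρ)
    (hG : ∀ j ∈ G, Ww (α j) (9 * k ^ 2 * P ^ (j.1 + 1)) ≤ (3 * ((9 * k ^ 2 * P ^ (j.1 + 1) : ℕ) : ℝ)) ^ 2 * ρ) :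
    ‖∑ x ∈ range P, ∑ y ∈ range P, ee (∑ j, α j * ((x:ℝ) * y) ^ (j.1 + 1))‖ ^ (324 * k ^ 4) ≤
      ((P:ℝ) ^ 2 * Real.exp 7) ^ (324 * k ^ 4) * (P:ℝ) ^ ((k * (k + 1) / 2500 : ℝ)) * ρ ^ G.card := by
  have hk1 : (2:ℝ) ≤ k := by exact_mod_cast hk
  have hP1 : (1:ℝ) ≤ P := by exact_mod_cast hP
  have hP0 : (0:ℝ) < P := by linarith
  have hs : 1 ≤ 9 * k ^ 2 := by nlinarith
  have hb := bilinear (9 * k ^ 2) k P hs α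
  have hJ := J_main hk P hP
  set J : ℝ := (Jv (Fin (9 * k ^ 2)) k P : ℝ) with hJdef
  have hJ0 : 0 ≤ J := by rw [hJdef]; positivity
  set Ck : ℝ := ((72 * k ^ 2 : ℝ) ^ (27 * k ^ 2)) ^ (8 * k) * (k : ℝ) ^ (k ^ 3) with hCk
  have hCk0 : 0 < Ck := by positivity
  have hW : ∀ j : Fin k, Ww (α j) (9 * k ^ 2 * P ^ (j.1 + 1)) ≤
      (3 * (9 * k ^ 2 : ℝ)) ^ 2 * ((P:ℝ) ^ (j.1 + 1)) ^ 2 * (if j ∈ G then ρ else 1) := by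
    intro j
    split_ifs with hj
    · refine (hG j hj).trans (le_of_eq ?_)
      push_cast; ring
    · refine (Ww_triv _ _).trans ?_
      rw [mul_one, ← mul_pow]
      refine pow_le_pow_left₀ (by positivity) ?_ 2
      have : (1:ℝ) ≤ ((9 * k ^ 2 * P ^ (j.1 + 1) : ℕ) : ℝ) := by
        have : 1 ≤ 9 * k ^ 2 * P ^ (j.1 + 1) := Nat.mul_pos hs (pow_pos hP _)
        exact_mod_cast this
      push_cast at this ⊢
      linarith
  have hprod : ∏ j : Fin k, Ww (α j) (9 * k ^ 2 * P ^ (j.1 + 1)) ≤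
      (3 * (9 * k ^ 2 : ℝ)) ^ (2 * k) * (P:ℝ) ^ (k * (k + 1)) * ρ ^ G.card := by
    refine (Finset.prod_le_prod (fun j _ => Ww_nonneg _ _) (fun j _ => hW j)).trans (le_of_eq ?_)
    rw [Finset.prod_mul_distrib, Finset.prod_mul_distrib, prod_const, card_univ, card_fin,
      ← pow_mul, Finset.prod_ite_mem, Finset.univ_inter, prod_const, Finset.prod_pow, Finset.prod_pow_eq_pow_sum, ← pow_mul]
    congr 3
    have : ∑ i : Fin k, (i.1 + 1) = ∑ i ∈ range k, (i + 1) := (Finset.sum_range (fun i => i + 1)).symm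
    rw [this]
    have h2 := Finset.sum_range_succ' (fun i => i) k
    rw [add_zero] at h2
    rw [← h2, Finset.sum_range_id_mul_two]
    simp [mul_comm]
  have hexp : (2 * (9 * k ^ 2)) * (2 * (9 * k ^ 2)) = 324 * k ^ 4 := by ring
  rw [hexp] at hb
  refine hb.trans ?_
  have hJ2 : J ^ 2 ≤ Ck ^ 2 * (P:ℝ) ^ (36 * (k:ℝ) ^ 2 - k * (k + 1) + k * (k + 1) / 2500) := by
    refine (pow_le_pow_left₀ hJ0 hJ 2).trans (le_of_eq ?_)
    rw [mul_pow]; congr 1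
    rw [← rpow_natCast, ← rpow_mul hP0.le]; congr 1; push_cast; ring
  have hpw : ((P:ℝ) ^ (2 * (9 * k ^ 2) - 1)) ^ (2 * (9 * k ^ 2)) * (((P:ℝ) ^ (2 * (9 * k ^ 2))) ^ (2 * (9 * k ^ 2) - 1) *
      ((P:ℝ) ^ (36 * (k:ℝ) ^ 2 - k * (k + 1) + k * (k + 1) / 2500) * (P:ℝ) ^ (k * (k + 1)))) =
      ((P:ℝ) ^ 2) ^ (324 * k ^ 4) * (P:ℝ) ^ ((k * (k + 1) / 2500 : ℝ)) := by
    rw [← pow_mul, ← pow_mul, ← pow_mul]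
    simp only [← rpow_natCast (P:ℝ), ← rpow_add hP0]
    congr 1
    push_cast [Nat.cast_sub (by nlinarith : 1 ≤ 2 * (9 * k ^ 2))]
    ring
  have hE := E_bound hk
  rw [← hCk] at hE
  calc _ ≤ ((P:ℝ) ^ (2 * (9 * k ^ 2) - 1)) ^ (2 * (9 * k ^ 2)) * (((P:ℝ) ^ (2 * (9 * k ^ 2))) ^ (2 * (9 * k ^ 2) - 1) *
      ((Ck ^ 2 * (P:ℝ) ^ (36 * (k:ℝ) ^ 2 - k * (k + 1) + k * (k + 1) / 2500)) *
        ((3 * (9 * k ^ 2 : ℝ)) ^ (2 * k) * (P:ℝ) ^ (k * (k + 1)) * ρ ^ G.card))) := by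
        gcongr
        exact Finset.prod_nonneg fun j _ => Ww_nonneg _ _
    _ = (((P:ℝ) ^ (2 * (9 * k ^ 2) - 1)) ^ (2 * (9 * k ^ 2)) * (((P:ℝ) ^ (2 * (9 * k ^ 2))) ^ (2 * (9 * k ^ 2) - 1) *
      ((P:ℝ) ^ (36 * (k:ℝ) ^ 2 - k * (k + 1) + k * (k + 1) / 2500) * (P:ℝ) ^ (k * (k + 1)))))
        * (Ck ^ 2 * (3 * (9 * k ^ 2 : ℝ)) ^ (2 * k)) * ρ ^ G.card := by ring
    _ ≤ ((P:ℝ) ^ 2) ^ (324 * k ^ 4) * (P:ℝ) ^ ((k * (k + 1) / 2500 : ℝ)) * Real.exp (7 * (324 * k ^ 4)) * ρ ^ G.card := by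
        rw [hpw]; gcongr
    _ = _ := by
        rw [mul_pow _ (Real.exp 7), ← exp_nat_mul]
        push_cast
        rw [mul_comm (324 * (k:ℝ) ^ 4) 7]
        ring


lemma cube_le_exp {T : ℝ} (hT : 9 * 10 ^ 10 ≤ T) : T ^ 3 ≤ Real.exp (T / 100) := by
  have h1 : T / 400 ≤ Real.exp (T / 400) := by have := add_one_le_exp (T / 400); linarith
  calc T ^ 3 ≤ (T / 400) ^ 4 := by
        have h0 : 0 ≤ T ^ 3 := by positivity
        have : (T / 400) ^ 4 = T ^ 3 * (T / 400 ^ 4) := by ring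
        rw [this]
        refine le_mul_of_one_le_right h0 ?_
        rw [le_div_iff₀ (by norm_num)]; linarith
    _ ≤ (Real.exp (T / 400)) ^ 4 := pow_le_pow_left₀ (by linarith) h1 _
    _ = Real.exp (T / 100) := by rw [← exp_nat_mul]; congr 1; push_cast; ring

lemma exp_two_pow (i : ℕ) : (2:ℝ) ^ i ≤ Real.exp i := by
  have : (2:ℝ) ≤ Real.exp 1 := by have := exp_one_gt_d9; linarith
  calc (2:ℝ) ^ i ≤ (Real.exp 1) ^ i := pow_le_pow_left₀ (by norm_num) this _
    _ = _ := by rw [← exp_nat_mul, mul_one]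

set_option maxHeartbeats 1000000 in
lemma rho_bound {T L α n : ℝ} {k i P : ℕ} (hL : 10 ^ 11 ≤ L) (hTL : 0.9 * L ≤ T)
    (hi1 : 2 * T ≤ i * L) (hi2 : i * L ≤ 5 * T) (hk1 : 1 ≤ k) (hk : k * L ≤ 33 * T)
    (hP1 : Real.exp (0.45 * L) / 2 ≤ P) (hP2 : P ≤ Real.exp (0.45 * L))
    (hn1 : Real.exp L ≤ n) (hn2 : n ≤ 2 * Real.exp L)
    (hα : |α| = Real.exp T / (2 * π * i * n ^ i)) :
    Ww α (9 * k ^ 2 * P ^ i) ≤ (3 * ((9 * k ^ 2 * P ^ i : ℕ) : ℝ)) ^ 2 * Real.exp (-(0.45 * T)) := by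
  have hT : 9 * 10 ^ 10 ≤ T := by norm_num at *; linarith
  have hT0 : 0 < T := by linarith
  have hL0 : 0 < L := by linarith
  have hi0 : (0:ℝ) < i := by
    by_contra hc
    have : (i:ℝ) * L ≤ 0 := mul_nonpos_of_nonpos_of_nonneg (not_lt.1 hc) hL0.le
    linarith
  have hi1' : (1:ℝ) ≤ i := by
    have : 0 < i := by exact_mod_cast hi0
    exact_mod_cast this
  have hiT : (i:ℝ) ≤ T / 10 ^ 10 := by
    have : (i:ℝ) * 10 ^ 11 ≤ i * L := by gcongr
    rw [le_div_iff₀ (by norm_num)]; linarith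
  have hkT : (k:ℝ) ≤ T / 10 ^ 9 := by
    have : (k:ℝ) * 10 ^ 11 ≤ k * L := by gcongr
    rw [le_div_iff₀ (by norm_num)]; linarith
  have hk1' : (1:ℝ) ≤ k := by exact_mod_cast hk1
  have hE0 := exp_pos (0.45 * L)
  have hP0 : (0:ℝ) < P := by linarith
  have hn0 : 0 < n := lt_of_lt_of_le (exp_pos _) hn1
  have hcube := cube_le_exp hT
  set M : ℕ := 9 * k ^ 2 * P ^ i with hM
  have hMR : (M:ℝ) = 9 * k ^ 2 * (P:ℝ) ^ i := by rw [hM]; push_cast; ring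
  have hPi1 : Real.exp (0.45 * L * i - i) ≤ (P:ℝ) ^ i := by
    calc Real.exp (0.45 * L * i - i) = (Real.exp (0.45 * L)) ^ i / Real.exp i := by
          rw [exp_sub, ← exp_nat_mul]; congr 2; ring
      _ ≤ (Real.exp (0.45 * L)) ^ i / 2 ^ i := by gcongr; exact exp_two_pow i
      _ = (Real.exp (0.45 * L) / 2) ^ i := (div_pow _ _ _).symm
      _ ≤ _ := pow_le_pow_left₀ (by positivity) hP1 _
  have hPi2 : (P:ℝ) ^ i ≤ Real.exp (0.45 * L * i) := by
    calc (P:ℝ) ^ i ≤ (Real.exp (0.45 * L)) ^ i := pow_le_pow_left₀ hP0.le hP2 _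
      _ = _ := by rw [← exp_nat_mul]; congr 1; ring
  have hni1 : Real.exp (L * i) ≤ n ^ i := by
    calc Real.exp (L * i) = (Real.exp L) ^ i := by rw [← exp_nat_mul]; congr 1; ring
      _ ≤ _ := pow_le_pow_left₀ (exp_pos _).le hn1 _
  have hni2 : n ^ i ≤ Real.exp (L * i + i) := by
    calc n ^ i ≤ (2 * Real.exp L) ^ i := pow_le_pow_left₀ hn0.le hn2 _
      _ = 2 ^ i * (Real.exp L) ^ i := mul_pow _ _ _
      _ ≤ Real.exp i * (Real.exp L) ^ i := by gcongr; exact exp_two_pow i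
      _ = _ := by rw [← exp_nat_mul, ← Real.exp_add]; congr 1; ring
  have hni0 : 0 < n ^ i := pow_pos hn0 _
  have hk9 : 9 * (k:ℝ) ^ 2 ≤ T ^ 2 / 10 ^ 16 := by
    have : (k:ℝ) ^ 2 ≤ (T / 10 ^ 9) ^ 2 := pow_le_pow_left₀ (by positivity) hkT _
    have e : (T / 10 ^ 9) ^ 2 = T ^ 2 / 10 ^ 18 := by ring
    rw [e] at this
    have : 0 ≤ T ^ 2 := by positivity
    linarith
  have hT23 : T ^ 2 ≤ T ^ 3 := pow_le_pow_right₀ (by linarith) (by norm_num)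
  have hpi : 3 < π := pi_gt_three
  have hpi4 : π < 4 := pi_lt_four
  have hden : 1 ≤ 2 * π * i := by nlinarith only [hpi, hi1']
  have hα0 : α ≠ 0 := by
    rw [← abs_pos, hα]; positivity
  have hαM : |α| * M ≤ 1 / 2 := by
    rw [hα, hMR]
    have h1 : Real.exp T / (2 * π * i * n ^ i) ≤ Real.exp (T - L * i) := by
      rw [exp_sub]
      gcongr
      calc Real.exp (L * i) ≤ 1 * n ^ i := by rw [one_mul]; exact hni1
        _ ≤ _ := by gcongr
    calc _ ≤ Real.exp (T - L * i) * (T ^ 2 / 10 ^ 16 * Real.exp (0.45 * L * i)) := by gcongr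
      _ = T ^ 2 / 10 ^ 16 * Real.exp (T - 0.55 * (i * L)) := by
        rw [mul_left_comm, ← Real.exp_add]; congr 2; ring
      _ ≤ Real.exp (T / 100) / 10 ^ 16 * Real.exp (-(T / 100)) := by
        gcongr
        · linarith
        · linarith
      _ = 1 / 10 ^ 16 := by rw [div_mul_eq_mul_div, ← Real.exp_add]; simp
      _ ≤ 1 / 2 := by norm_num
  have hM1 : (1:ℝ) ≤ M := by
    have hP1' : 1 ≤ P := by exact_mod_cast hP0
    have : 1 ≤ M := Nat.mul_pos (by positivity) (pow_pos hP1' _)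
    exact_mod_cast this
  have hMlow : Real.exp (0.45 * L * i - i) ≤ M := by
    rw [hMR]
    refine hPi1.trans (le_mul_of_one_le_left (by positivity) ?_)
    nlinarith only [hk1']
  have hW := Ww_bound M hα0 hαM
  have h1 : 3 * (M:ℝ) ≤ (9 * (M:ℝ) ^ 2 * Real.exp (-(0.45 * T))) / 2 := by
    have : Real.exp (0.45 * T) ≤ M := by
      refine le_trans (exp_le_exp.2 ?_) hMlow
      linarith only [hi1, hiT, hT0]
    have h2 : 1 ≤ M * Real.exp (-(0.45 * T)) := by
      rw [exp_neg, ← div_eq_mul_inv, one_le_div (exp_pos _)]; exact this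
    nlinarith only [h2, hM1]
  have hlog : 1 + log M ≤ T ^ 2 / 10 := by
    have e1 : log M = log (9 * k ^ 2) + log ((P:ℝ) ^ i) := by
      rw [hMR, log_mul (by positivity) (by positivity)]
    have e2 : log (9 * (k:ℝ) ^ 2) ≤ 9 * (k:ℝ) ^ 2 := by
      have := log_le_sub_one_of_pos (show 0 < 9 * (k:ℝ) ^ 2 by positivity); linarith
    have e3 : log ((P:ℝ) ^ i) ≤ 0.45 * L * i := by
      rw [log_le_iff_le_exp (by positivity)]; exact hPi2
    have e4 : T * (9 * 10 ^ 10) ≤ T ^ 2 := by nlinarith only [hT]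
    linarith only [e1, e2, e3, e4, hk9, hi2, hT]
  have h2 : (1 + log M) / |α| ≤ (9 * (M:ℝ) ^ 2 * Real.exp (-(0.45 * T))) / 2 := by
    rw [hα, div_div_eq_mul_div]
    have e1 : 2 * π * i * n ^ i ≤ T * Real.exp (L * i + i) := by
      have : 2 * π * i ≤ T := by nlinarith only [hpi4, hi0, hiT, hT0]
      gcongr
    have e0 : 0 ≤ 1 + log M := by have := log_nonneg hM1; linarith
    calc (1 + log M) * (2 * π * i * n ^ i) / Real.exp T
        ≤ (T ^ 2 / 10) * (T * Real.exp (L * i + i)) / Real.exp T := by gcongr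
      _ = (T ^ 3) / 10 * Real.exp (L * i + i - T) := by rw [exp_sub]; ring
      _ ≤ Real.exp (T / 100) / 10 * Real.exp (L * i + i - T) := by gcongr
      _ = 1 / 10 * Real.exp (T / 100 + (L * i + i - T)) := by rw [Real.exp_add (T / 100)]; ring
      _ ≤ 9 / 2 * Real.exp (2 * (0.45 * L * i - i) - 0.45 * T) := by
        have : Real.exp (T / 100 + (L * i + i - T)) ≤ Real.exp (2 * (0.45 * L * i - i) - 0.45 * T) := by
          refine exp_le_exp.2 ?_
          linarith only [hi1, hi2, hiT, hT0]
        have := exp_pos (2 * (0.45 * L * i - i) - 0.45 * T)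
        linarith
      _ = (9 * (Real.exp (0.45 * L * i - i)) ^ 2 * Real.exp (-(0.45 * T))) / 2 := by
        rw [← exp_nat_mul, sub_eq_add_neg, Real.exp_add]; push_cast; ring
      _ ≤ _ := by gcongr
  calc Ww α M ≤ 2 * M + 1 + (1 + log M) / |α| := hW
    _ ≤ 3 * M + (1 + log M) / |α| := by linarith
    _ ≤ 9 * (M:ℝ) ^ 2 * Real.exp (-(0.45 * T)) := by linarith
    _ = _ := by ring


lemma G_card {κ : ℝ} (hκ : 0.9 ≤ κ) {k : ℕ} (hk : 5 * κ ≤ k) :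
    1.8 * κ ≤ ((univ.filter (fun j : Fin k => 2 * κ ≤ ((j.1 + 1 : ℕ) : ℝ) ∧
      ((j.1 + 1 : ℕ) : ℝ) ≤ 5 * κ)).card : ℝ) := by
  set G := univ.filter (fun j : Fin k => 2 * κ ≤ ((j.1 + 1 : ℕ) : ℝ) ∧
      ((j.1 + 1 : ℕ) : ℝ) ≤ 5 * κ) with hG
  have hsub : Finset.Icc ⌈2 * κ⌉₊ ⌊5 * κ⌋₊ ⊆ G.image (fun j => j.1 + 1) := by
    intro i hi
    rw [mem_Icc] at hi
    have h1 : 2 * κ ≤ i := Nat.ceil_le.1 hi.1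
    have h2 : (i:ℝ) ≤ 5 * κ := (Nat.le_floor_iff (by linarith)).1 hi.2
    have hi0 : 1 ≤ i := by
      have : (0:ℝ) < i := by linarith
      exact_mod_cast this
    have hik : i ≤ k := by
      have : (i:ℝ) ≤ k := h2.trans hk
      exact_mod_cast this
    rw [mem_image]
    refine ⟨⟨i - 1, by omega⟩, ?_, by simp; omega⟩
    rw [hG, mem_filter]
    have e : i - 1 + 1 = i := by omega
    simp only [e]
    exact ⟨mem_univ _, h1, h2⟩
  have h3 := (card_le_card hsub).trans Finset.card_image_le
  rw [Nat.card_Icc] at h3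
  have h4 : (⌈2 * κ⌉₊ : ℝ) < 2 * κ + 1 := Nat.ceil_lt_add_one (by linarith)
  have h5 : 5 * κ < ⌊5 * κ⌋₊ + 1 := Nat.lt_floor_add_one _
  have h6 : (⌊5 * κ⌋₊ : ℝ) + 1 ≤ G.card + ⌈2 * κ⌉₊ := by
    have : ⌊5 * κ⌋₊ + 1 ≤ G.card + ⌈2 * κ⌉₊ := by omega
    exact_mod_cast this
  linarith

noncomputable def dl (L T : ℝ) : ℝ := Real.exp (-(10:ℝ)⁻¹ ^ 9 * (L ^ 3 / T ^ 2))

noncomputable def kk (L T : ℝ) : ℕ := ⌊10 * (T / L)⌋₊ + 20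
noncomputable def PP (L : ℝ) : ℕ := ⌊Real.exp (0.45 * L)⌋₊

lemma PP_le (L : ℝ) : (PP L : ℝ) ≤ Real.exp (0.45 * L) := Nat.floor_le (exp_pos _).le

lemma PP_ge {L : ℝ} (hL : 10 ^ 11 ≤ L) : Real.exp (0.45 * L) / 2 ≤ PP L := by
  have h1 : Real.exp (0.45 * L) < PP L + 1 := Nat.lt_floor_add_one _
  have h2 := add_one_le_exp (0.45 * L)
  norm_num at *
  linarith

lemma kk_bounds {L T : ℝ} (hL : 0 < L) (hTL : 0.9 * L ≤ T) :
    10 * (T / L) + 19 ≤ kk L T ∧ (kk L T : ℝ) + 1 ≤ 34 * (T / L) ∧ (kk L T : ℝ) ≤ 33 * (T / L) := by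
  have hκ : 0.9 ≤ T / L := by rw [le_div_iff₀ hL]; exact hTL
  have h1 : 10 * (T / L) < ⌊10 * (T / L)⌋₊ + 1 := Nat.lt_floor_add_one _
  have h2 : (⌊10 * (T / L)⌋₊ : ℝ) ≤ 10 * (T / L) := Nat.floor_le (by linarith)
  unfold kk
  push_cast
  norm_num at *
  refine ⟨by linarith, by linarith, by linarith⟩

lemma U_n {L T τ n : ℝ} (hL : 10 ^ 11 ≤ L) (hTL : 0.9 * L ≤ T) (hτ : |τ| = Real.exp T)
    (hn1 : Real.exp L ≤ n) (hn2 : n ≤ 2 * Real.exp L) :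
    ‖∑ x ∈ range (PP L), ∑ y ∈ range (PP L), ee (∑ j : Fin (kk L T),
      (-(τ * (-1) ^ j.1 / (2 * π * ((j.1 + 1 : ℕ) : ℝ) * n ^ (j.1 + 1)))) *
        ((x:ℝ) * y) ^ (j.1 + 1))‖ ≤ (PP L : ℝ) ^ 2 * Real.exp 7 * dl L T := by
  have hL0 : 0 < L := by linarith
  have hT0 : 0 < T := by linarith
  obtain ⟨hka, hkb, hkc⟩ := kk_bounds hL0 hTL
  set κ := T / L with hκd
  have hκ : 0.9 ≤ κ := by rw [hκd, le_div_iff₀ hL0]; exact hTL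
  have hκL : κ * L = T := by rw [hκd]; field_simp
  set k := kk L T with hkdef
  have hk2 : 2 ≤ k := by have : 20 ≤ k := by rw [hkdef]; unfold kk; omega
                         omega
  have hP1 := PP_ge hL
  have hP2 := PP_le L
  set P := PP L with hPdef
  have hP0 : (0:ℝ) < P := lt_of_lt_of_le (by positivity) hP1
  have hPn : 1 ≤ P := by exact_mod_cast hP0
  have hn0 : 0 < n := lt_of_lt_of_le (exp_pos _) hn1
  have key := U_abs hk2 P hPn (fun j : Fin k => -(τ * (-1) ^ j.1 / (2 * π * ((j.1 + 1 : ℕ) : ℝ) * n ^ (j.1 + 1))))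
    (univ.filter (fun j : Fin k => 2 * κ ≤ ((j.1 + 1 : ℕ) : ℝ) ∧
      ((j.1 + 1 : ℕ) : ℝ) ≤ 5 * κ)) (Real.exp (-(0.45 * T))) (exp_pos _).le (by
      intro j hj
      rw [mem_filter] at hj
      obtain ⟨-, hj1, hj2⟩ := hj
      refine rho_bound (n := n) hL hTL ?_ ?_ (by omega) ?_ hP1 hP2 hn1 hn2 ?_
      · calc 2 * T = 2 * κ * L := by rw [← hκL]; ring
          _ ≤ _ := by gcongr
      · calc _ ≤ 5 * κ * L := by gcongr
          _ = 5 * T := by rw [← hκL]; ring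
      · calc (k:ℝ) * L ≤ 33 * κ * L := by gcongr
          _ = 33 * T := by rw [← hκL]; ring
      · have hd : 0 < 2 * π * ((j.1 + 1 : ℕ) : ℝ) * n ^ (j.1 + 1) := by positivity
        rw [abs_neg, abs_div, abs_mul, hτ, abs_pow, abs_neg, abs_one, one_pow, mul_one,
          abs_of_pos hd])
  have hcard := G_card (k := k) hκ (by linarith)
  set g := (univ.filter (fun j : Fin k => 2 * κ ≤ ((j.1 + 1 : ℕ) : ℝ) ∧
      ((j.1 + 1 : ℕ) : ℝ) ≤ 5 * κ)).card
  have hm : 324 * k ^ 4 ≠ 0 := by positivity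
  rw [← pow_le_pow_iff_left₀ (norm_nonneg _) (by unfold dl; positivity) hm]
  refine key.trans ?_
  rw [mul_pow _ (dl L T), mul_assoc]
  refine mul_le_mul_of_nonneg_left ?_ (by positivity)
  have e1 : (P:ℝ) ^ ((k:ℝ) * (k + 1) / 2500 : ℝ) ≤ Real.exp (0.45 * L * ((k:ℝ) * (k + 1) / 2500)) := by
    rw [exp_mul]
    exact rpow_le_rpow hP0.le hP2 (by positivity)
  have e2 : Real.exp (-(0.45 * T)) ^ g = Real.exp (-(0.45 * T) * g) := by
    rw [← exp_nat_mul, mul_comm]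
  have e3 : dl L T ^ (324 * k ^ 4) = Real.exp (-((324 * (k:ℝ) ^ 4) * ((10:ℝ)⁻¹ ^ 9 * (L ^ 3 / T ^ 2)))) := by
    unfold dl
    rw [← exp_nat_mul]; congr 1; push_cast; ring
  rw [e2, e3]
  refine (mul_le_mul_of_nonneg_right e1 (exp_pos _).le).trans ?_
  rw [← Real.exp_add, exp_le_exp]
  have f1 : 0.45 * L * ((k:ℝ) * (k + 1) / 2500) ≤ 0.202 * (κ * T) := by
    calc 0.45 * L * ((k:ℝ) * (k + 1) / 2500) ≤ 0.45 * L * ((33 * κ) * (34 * κ) / 2500) := by gcongr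
      _ = 0.45 * (33 * 34) / 2500 * (κ * (κ * L)) := by ring
      _ ≤ 0.202 * (κ * T) := by
        rw [hκL]
        have : 0 ≤ κ * T := by positivity
        norm_num
        linarith
  have f2 : (0.45 * T) * (1.8 * κ) ≤ (0.45 * T) * g := by gcongr
  have f3 : (324 * (k:ℝ) ^ 4) * ((10:ℝ)⁻¹ ^ 9 * (L ^ 3 / T ^ 2)) ≤ 0.6 * (κ * T) := by
    calc (324 * (k:ℝ) ^ 4) * ((10:ℝ)⁻¹ ^ 9 * (L ^ 3 / T ^ 2))
        ≤ (324 * (33 * κ) ^ 4) * ((10:ℝ)⁻¹ ^ 9 * (L ^ 3 / T ^ 2)) := by gcongr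
      _ = (324 * 33 ^ 4 * (10:ℝ)⁻¹ ^ 9) * (κ * T) := by
        rw [hκd]; field_simp
      _ ≤ _ := by
        have : 0 ≤ κ * T := by positivity
        norm_num
        linarith
  have : 0 ≤ κ * T := by positivity
  norm_num at f1 f2 f3 ⊢
  linarith

noncomputable def ft (τ : ℝ) (n : ℝ) : ℂ := ee (-(τ * log n / (2 * π)))

lemma norm_ft (τ n : ℝ) : ‖ft τ n‖ = 1 := norm_ee _

lemma ee_dist (a b : ℝ) : ‖ee a - ee b‖ ≤ 2 * π * |a - b| := by
  have e : ee a - ee b = ee b * (ee (a - b) - 1) := by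
    rw [mul_sub, ← ee_add, mul_one]; congr 2; ring
  rw [e, norm_mul, norm_ee, one_mul]
  unfold ee
  have := norm_exp_I_mul_ofReal_sub_one_le (x := 2 * π * (a - b))
  rw [mul_comm] at this
  refine this.trans (le_of_eq ?_)
  rw [norm_eq_abs, abs_mul, abs_of_pos (by positivity)]

lemma ft_taylor {L T τ n w : ℝ} (hL : 10 ^ 11 ≤ L) (hTL : 0.9 * L ≤ T) (hτ : |τ| = Real.exp T)
    (hn1 : Real.exp L ≤ n) (hw0 : 0 ≤ w) (hw : w ≤ Real.exp (0.9 * L)) :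
    ‖ft τ (n + w) - ft τ n * ee (∑ j : Fin (kk L T),
      (-(τ * (-1) ^ j.1 / (2 * π * ((j.1 + 1 : ℕ) : ℝ) * n ^ (j.1 + 1)))) * w ^ (j.1 + 1))‖
      ≤ 2 * Real.exp (-(2 * L)) := by
  have hL0 : 0 < L := by linarith
  have hT0 : 0 < T := by linarith
  obtain ⟨hka, hkb, hkc⟩ := kk_bounds hL0 hTL
  have hκL : (T / L) * L = T := by field_simp
  set κ := T / L with hκd
  set k := kk L T with hkdef
  have hn0 : 0 < n := lt_of_lt_of_le (exp_pos _) hn1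
  set z := w / n with hz
  have hz0 : 0 ≤ z := by positivity
  have hz1 : z ≤ Real.exp (-(0.1 * L)) := by
    rw [hz, div_le_iff₀ hn0]
    calc w ≤ Real.exp (0.9 * L) := hw
      _ = Real.exp (-(0.1 * L)) * Real.exp L := by rw [← Real.exp_add]; congr 1; ring
      _ ≤ _ := by gcongr
  have hzh : z ≤ 1 / 2 := by
    refine hz1.trans ?_
    rw [exp_neg]
    have := add_one_le_exp (0.1 * L)
    rw [inv_le_comm₀ (exp_pos _) (by norm_num)]
    norm_num at *
    linarith
  have tay := abs_log_sub_add_sum_range_le (x := -z) (by rw [abs_neg, abs_of_nonneg hz0]; linarith) k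
  rw [abs_neg, abs_of_nonneg hz0, sub_neg_eq_add] at tay
  have hlog : log (n + w) = log n + log (1 + z) := by
    rw [← log_mul (by positivity) (by positivity)]
    congr 1; rw [hz]; field_simp
  have hsum : ∑ j : Fin k,
      (-(τ * (-1) ^ j.1 / (2 * π * ((j.1 + 1 : ℕ) : ℝ) * n ^ (j.1 + 1)))) * w ^ (j.1 + 1)
      = τ / (2 * π) * ∑ i ∈ range k, (-z) ^ (i + 1) / (i + 1) := by
    rw [mul_sum, Finset.sum_range]
    refine sum_congr rfl fun j _ => ?_
    rw [hz, neg_pow (w / n), div_pow]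
    push_cast
    have : (j.1:ℝ) + 1 ≠ 0 := by positivity
    field_simp
    ring
  rw [hsum]
  unfold ft
  rw [← ee_add]
  refine (ee_dist _ _).trans ?_
  rw [hlog]
  set Sg := ∑ i ∈ range k, (-z) ^ (i + 1) / ((i:ℝ) + 1)
  have e : (-(τ * (log n + log (1 + z)) / (2 * π)) -
      (-(τ * log n / (2 * π)) + τ / (2 * π) * Sg)) = -(τ / (2 * π)) * (Sg + log (1 + z)) := by ring
  rw [e, abs_mul, abs_neg, abs_div, hτ, abs_of_pos (show 0 < 2 * π by positivity)]
  calc 2 * π * (Real.exp T / (2 * π) * |Sg + log (1 + z)|)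
      = Real.exp T * |Sg + log (1 + z)| := by field_simp
    _ ≤ Real.exp T * (z ^ (k + 1) / (1 - z)) := by gcongr
    _ ≤ Real.exp T * (Real.exp (-(T + 2 * L)) / (1 / 2)) := by
      gcongr
      · calc z ^ (k + 1) ≤ (Real.exp (-(0.1 * L))) ^ (k + 1) := pow_le_pow_left₀ hz0 hz1 _
          _ = Real.exp (-(0.1 * L) * (k + 1)) := by rw [← exp_nat_mul]; push_cast; congr 1; ring
          _ ≤ _ := by
            rw [exp_le_exp]
            have : (10 * κ + 20) * L ≤ (k + 1) * L := mul_le_mul_of_nonneg_right (by linarith) hL0.le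
            norm_num
            linarith
      · linarith
    _ = 2 * Real.exp (-(2 * L)) := by
      have : Real.exp T * (Real.exp (-(T + 2 * L)) / (1 / 2)) = 2 * (Real.exp T * Real.exp (-(T + 2 * L))) := by ring
      rw [this, ← Real.exp_add]; congr 2; ring

lemma shift_sum (f : ℕ → ℂ) (hf : ∀ n, ‖f n‖ = 1) (a b : ℕ) (hab : a ≤ b) (h : ℕ) :
    ‖∑ n ∈ Ico a b, f n - ∑ n ∈ Ico a b, f (n + h)‖ ≤ 2 * h := by
  have e : ∑ n ∈ Ico a b, f (n + h) = ∑ n ∈ Ico (a + h) (b + h), f n :=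
    Finset.sum_Ico_add' f a b h
  have e1 := sum_Ico_consecutive f (show a ≤ a + h by omega) (show a + h ≤ b + h by omega)
  have e2 := sum_Ico_consecutive f hab (show b ≤ b + h by omega)
  have e3 : ∑ n ∈ Ico a b, f n - ∑ n ∈ Ico a b, f (n + h) =
      ∑ n ∈ Ico a (a + h), f n - ∑ n ∈ Ico b (b + h), f n := by
    rw [e]; linear_combination e2 - e1
  have tr : ∀ c, ‖∑ n ∈ Ico c (c + h), f n‖ ≤ h := by
    intro c
    refine (norm_sum_le _ _).trans ?_
    simp [hf]
  rw [e3]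
  refine (norm_sub_le _ _).trans ?_
  have := tr a; have := tr b; linarith

lemma dl_pos (L T : ℝ) : 0 < dl L T := exp_pos _

lemma exp_sum {N N' : ℕ} {T τ : ℝ} (hL : 10 ^ 11 ≤ log N) (hTL : 0.9 * log N ≤ T)
    (hτ : |τ| = Real.exp T) (h1 : N ≤ N') (h2 : N' ≤ 2 * N) :
    ‖∑ n ∈ Ico N N', ft τ n‖ ≤ N * ((Real.exp 7 + 4) * dl (log N) T) := by
  set L := log N with hLd
  have hN0 : (0:ℝ) < N := by
    rcases Nat.eq_zero_or_pos N with h | h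
    · rw [hLd, h] at hL; norm_num at hL
    · exact_mod_cast h
  have hNe : Real.exp L = N := exp_log hN0
  have hL0 : 0 < L := by linarith
  have hT0 : 0 < T := by linarith
  set P := PP L with hP
  have hP0 : (0:ℝ) < P := lt_of_lt_of_le (by positivity) (PP_ge hL)
  have hPsq : (P:ℝ) ^ 2 ≤ Real.exp (0.9 * L) := by
    calc (P:ℝ) ^ 2 ≤ (Real.exp (0.45 * L)) ^ 2 := pow_le_pow_left₀ hP0.le (PP_le L) _
      _ = _ := by rw [← exp_nat_mul]; congr 1; push_cast; ring
  set S := ∑ n ∈ Ico N N', ft τ n with hS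
  set δ := dl L T with hδ
  have hshift : ∀ x ∈ range P, ∀ y ∈ range P,
      ‖S - ∑ n ∈ Ico N N', ft τ ((n:ℝ) + (x:ℝ) * y)‖ ≤ 2 * (P:ℝ) ^ 2 := by
    intro x hx y hy
    have := shift_sum (fun n => ft τ n) (fun n => norm_ft _ _) N N' h1 (x * y)
    simp only [Nat.cast_add, Nat.cast_mul] at this
    refine this.trans ?_
    have hx' : (x:ℝ) ≤ P := by exact_mod_cast (mem_range.1 hx).le
    have hy' : (y:ℝ) ≤ P := by exact_mod_cast (mem_range.1 hy).le
    rw [sq]; gcongr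
  have hxy : ∀ x ∈ range P, ∀ y ∈ range P, (x:ℝ) * y ≤ Real.exp (0.9 * L) := by
    intro x hx y hy
    have hx' : (x:ℝ) ≤ P := by exact_mod_cast (mem_range.1 hx).le
    have hy' : (y:ℝ) ≤ P := by exact_mod_cast (mem_range.1 hy).le
    refine le_trans ?_ hPsq
    rw [sq]; gcongr
  have hper : ∀ n ∈ Ico N N', ‖∑ x ∈ range P, ∑ y ∈ range P,
      ft τ ((n:ℝ) + (x:ℝ) * y)‖ ≤ (P:ℝ) ^ 2 * (Real.exp 7 * δ + 2 * Real.exp (-(2 * L))) := by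
    intro n hn
    rw [mem_Ico] at hn
    have hn1 : Real.exp L ≤ n := by rw [hNe]; exact_mod_cast hn.1
    have hn2 : (n:ℝ) ≤ 2 * Real.exp L := by
      rw [hNe]; exact_mod_cast (hn.2.le.trans h2)
    have hU := U_n hL hTL hτ hn1 hn2
    rw [← hP] at hU
    set V : ℕ → ℕ → ℂ := fun x y => ee (∑ j : Fin (kk L T),
      (-(τ * (-1) ^ j.1 / (2 * π * ((j.1 + 1 : ℕ) : ℝ) * (n:ℝ) ^ (j.1 + 1)))) *
        ((x:ℝ) * y) ^ (j.1 + 1)) with hV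
    have hd : ‖∑ x ∈ range P, ∑ y ∈ range P, ft τ ((n:ℝ) + (x:ℝ) * y)
        - ft τ n * ∑ x ∈ range P, ∑ y ∈ range P, V x y‖
        ≤ (P:ℝ) ^ 2 * (2 * Real.exp (-(2 * L))) := by
      simp only [mul_sum, ← sum_sub_distrib]
      refine (norm_sum_le_of_le _ (fun x hx => norm_sum_le_of_le _ (fun y hy =>
        ft_taylor hL hTL hτ hn1 (by positivity) (hxy x hx y hy)))).trans ?_
      simp only [sum_const, card_range, nsmul_eq_mul]
      refine le_of_eq ?_; ring
    have hm : ‖ft τ n * ∑ x ∈ range P, ∑ y ∈ range P, V x y‖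
        ≤ (P:ℝ) ^ 2 * Real.exp 7 * δ := by rw [norm_mul, norm_ft, one_mul]; exact hU
    calc _ ≤ _ + _ := norm_le_norm_sub_add _ (ft τ n * ∑ x ∈ range P, ∑ y ∈ range P, V x y)
      _ ≤ _ := add_le_add hd hm
      _ = _ := by ring
  have hmain : ‖((P:ℂ) ^ 2) * S‖ ≤ (P:ℝ) ^ 2 * (2 * (P:ℝ) ^ 2) +
      N * ((P:ℝ) ^ 2 * (Real.exp 7 * δ + 2 * Real.exp (-(2 * L)))) := by
    have e : ((P:ℂ) ^ 2) * S = ∑ x ∈ range P, ∑ y ∈ range P,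
        (S - ∑ n ∈ Ico N N', ft τ ((n:ℝ) + (x:ℝ) * y)) +
        ∑ n ∈ Ico N N', ∑ x ∈ range P, ∑ y ∈ range P,
          ft τ ((n:ℝ) + (x:ℝ) * y) := by
      rw [sum_comm (s := Ico N N')]
      simp only [sum_comm (s := Ico N N')]
      simp only [sum_sub_distrib, sum_const, card_range, nsmul_eq_mul]
      ring
    rw [e]
    refine (norm_add_le _ _).trans (add_le_add ?_ ?_)
    · refine (norm_sum_le_of_le _ (fun x hx => norm_sum_le_of_le _ (fun y hy => hshift x hx y hy))).trans ?_
      simp only [sum_const, card_range, nsmul_eq_mul]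
      refine le_of_eq ?_; ring
    · refine (norm_sum_le_of_le _ hper).trans ?_
      rw [sum_const, Nat.card_Ico, nsmul_eq_mul]
      have : ((N' - N : ℕ):ℝ) ≤ N := by
        have : N' - N ≤ N := by omega
        exact_mod_cast this
      have hδ0 := dl_pos L T
      gcongr
  have hmain2 : ‖S‖ ≤ 2 * (P:ℝ) ^ 2 + N * (Real.exp 7 * δ + 2 * Real.exp (-(2 * L))) := by
    rw [norm_mul, norm_pow, Complex.norm_natCast] at hmain
    have h : (P:ℝ) ^ 2 * ‖S‖ ≤ (P:ℝ) ^ 2 * (2 * (P:ℝ) ^ 2 + N * (Real.exp 7 * δ + 2 * Real.exp (-(2 * L)))) := by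
      refine hmain.trans (le_of_eq ?_); ring
    exact le_of_mul_le_mul_left h (by positivity)
  have hδlow : Real.exp (-(0.1 * L)) ≤ δ := by
    rw [hδ]; unfold dl
    rw [exp_le_exp]
    have : L ^ 3 / T ^ 2 ≤ 2 * L := by
      rw [div_le_iff₀ (by positivity)]
      have : (0.9 * L) ^ 2 ≤ T ^ 2 := pow_le_pow_left₀ (by positivity) hTL _
      have h3 : L * (0.9 * L) ^ 2 ≤ L * T ^ 2 := by gcongr
      have : 0 ≤ L ^ 3 := by positivity
      norm_num at h3 ⊢
      nlinarith only [this, h3]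
    norm_num at this ⊢
    linarith
  have e1 : (P:ℝ) ^ 2 ≤ N * δ := by
    refine hPsq.trans ?_
    calc Real.exp (0.9 * L) = Real.exp L * Real.exp (-(0.1 * L)) := by rw [← Real.exp_add]; congr 1; ring
      _ ≤ _ := by rw [hNe]; gcongr
  have e2 : Real.exp (-(2 * L)) ≤ δ := le_trans (exp_le_exp.2 (by linarith)) hδlow
  calc ‖S‖ ≤ 2 * (N * δ) + N * (Real.exp 7 * δ + 2 * δ) := by
        refine hmain2.trans ?_; gcongr
    _ = _ := by ring


noncomputable def An (n : ℕ) (s : ℂ) : ℂ :=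
  (s - 1) * (n:ℂ) ^ (-s) - ((n:ℂ) ^ (1 - s) - ((n + 1 : ℕ) : ℂ) ^ (1 - s))

lemma cpow_diff {n : ℕ} (hn : 1 ≤ n) {s : ℂ} (hs : 0 < s.re) {u : ℝ} (hu : (n:ℝ) ≤ u)
    (hu1 : u ≤ n + 1) : ‖(n:ℂ) ^ (-s) - (u:ℂ) ^ (-s)‖ ≤ ‖s‖ * (n:ℝ) ^ (-s.re - 1) := by
  have hn0 : (0:ℝ) < n := by exact_mod_cast hn
  have hs0 : -s ≠ 0 := by intro h; rw [neg_eq_zero] at h; rw [h] at hs; simp at hs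
  have := norm_image_sub_le_of_norm_deriv_le_segment' (f := fun y : ℝ => (y:ℂ) ^ (-s))
    (f' := fun y => (-s) * (y:ℂ) ^ (-s - 1)) (a := n) (b := n + 1) (C := ‖s‖ * (n:ℝ) ^ (-s.re - 1))
    (fun x hx => (hasDerivAt_ofReal_cpow_const (by have := hx.1; linarith) hs0).hasDerivWithinAt)
    (fun x hx => by
      have hx0 : 0 < x := lt_of_lt_of_le hn0 hx.1
      rw [norm_mul, norm_neg, norm_cpow_eq_rpow_re_of_pos hx0]
      simp only [Complex.sub_re, neg_re, Complex.one_re]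
      gcongr ‖s‖ * ?_
      exact rpow_le_rpow_of_nonpos hn0 hx.1 (by linarith)) u ⟨hu, hu1⟩
  rw [norm_sub_rev]
  simp only [ofReal_natCast] at this
  refine this.trans ?_
  refine mul_le_of_le_one_right (by positivity) (by linarith)

lemma An_norm {n : ℕ} (hn : 1 ≤ n) {s : ℂ} (hs : 0 < s.re) :
    ‖An n s‖ ≤ ‖s - 1‖ * ‖s‖ * (n:ℝ) ^ (-s.re - 1) := by
  have hn0 : (0:ℝ) < n := by exact_mod_cast hn
  by_cases h1 : s = 1
  · subst h1; simp [An]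
  have h1' : 1 - s ≠ 0 := by rwa [sub_ne_zero, ne_comm]
  have := norm_image_sub_le_of_norm_deriv_le_segment'
    (f := fun y : ℝ => (s - 1) * (n:ℂ) ^ (-s) * (y:ℂ) + (y:ℂ) ^ (1 - s))
    (f' := fun y => (s - 1) * (n:ℂ) ^ (-s) * 1 + (1 - s) * (y:ℂ) ^ (1 - s - 1)) (a := n) (b := n + 1)
    (C := ‖s - 1‖ * (‖s‖ * (n:ℝ) ^ (-s.re - 1)))
    (fun x hx => ((Complex.ofRealCLM.hasDerivAt.const_mul _).add
      (hasDerivAt_ofReal_cpow_const (by have := hx.1; linarith) h1')).hasDerivWithinAt)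
    (fun x hx => by
      have e : (s - 1) * (n:ℂ) ^ (-s) * 1 + (1 - s) * (x:ℂ) ^ (1 - s - 1)
        = (s - 1) * ((n:ℂ) ^ (-s) - (x:ℂ) ^ (-s)) := by
        rw [show 1 - s - 1 = -s by ring]; ring
      rw [e, norm_mul]
      gcongr
      exact cpow_diff hn hs hx.1 hx.2.le) (n + 1) ⟨by linarith, le_rfl⟩
  have e : An n s = (s - 1) * (n:ℂ) ^ (-s) * ((n + 1 : ℝ):ℂ) + ((n + 1 : ℝ):ℂ) ^ (1 - s)
      - ((s - 1) * (n:ℂ) ^ (-s) * ((n : ℝ):ℂ) + ((n : ℝ):ℂ) ^ (1 - s)) := by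
    unfold An; push_cast; ring
  rw [e]
  refine this.trans (le_of_eq ?_)
  ring

lemma rpow_tele {n : ℕ} (hn : 1 ≤ n) {a : ℝ} (ha : 0 < a) (ha3 : a ≤ 3) :
    (n:ℝ) ^ (-a - 1) ≤ 16 / a * ((n:ℝ) ^ (-a) - ((n + 1 : ℕ):ℝ) ^ (-a)) := by
  have hn0 : (0:ℝ) < n := by exact_mod_cast hn
  have hn1 : (1:ℝ) ≤ n := by exact_mod_cast hn
  push_cast
  have h1 : (n:ℝ) ^ (-a - 1) ≤ 16 * ((n:ℝ) + 1) ^ (-a - 1) := by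
    have h2 : (2 * (n:ℝ)) ^ (-a - 1) ≤ ((n:ℝ) + 1) ^ (-a - 1) :=
      rpow_le_rpow_of_nonpos (by positivity) (by linarith) (by linarith)
    rw [mul_rpow (by norm_num) hn0.le] at h2
    have h3 : (1:ℝ) ≤ 16 * (2:ℝ) ^ (-a - 1) := by
      have h4 : (16:ℝ) = (2:ℝ) ^ (4:ℝ) := by norm_num
      rw [h4, ← rpow_add (by norm_num)]
      exact one_le_rpow (by norm_num) (by linarith)
    have h5 : 0 ≤ (n:ℝ) ^ (-a - 1) := by positivity
    nlinarith
  have h2 : a * ((n:ℝ) + 1) ^ (-a - 1) ≤ (n:ℝ) ^ (-a) - ((n:ℝ) + 1) ^ (-a) := by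
    have hm : (0:ℝ) < (n:ℝ) + 1 := by linarith
    set y := 1 / ((n:ℝ) + 1) with hy
    have hny : (n:ℝ) = (n + 1) * (1 - y) := by rw [hy]; field_simp; ring
    have hy1 : 0 < 1 - y := by
      rw [hy, sub_pos, div_lt_one hm]; linarith
    have e : (n:ℝ) ^ (-a) = ((n:ℝ) + 1) ^ (-a) * (1 - y) ^ (-a) := by
      rw [← mul_rpow hm.le hy1.le, ← hny]
    have h3 : 1 + a * y ≤ (1 - y) ^ (-a) := by
      rw [rpow_def_of_pos hy1]
      have h4 : log (1 - y) ≤ -y := by have := log_le_sub_one_of_pos hy1; linarith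
      have h5 := add_one_le_exp (log (1 - y) * -a)
      nlinarith
    have e2 : ((n:ℝ) + 1) ^ (-a - 1) = ((n:ℝ) + 1) ^ (-a) * y := by
      rw [rpow_sub hm, rpow_one, hy]; ring
    have h6 : 0 < ((n:ℝ) + 1) ^ (-a) := by positivity
    rw [e2, e]
    nlinarith
  rw [div_mul_eq_mul_div, le_div_iff₀ ha]
  nlinarith

lemma rpow_tail {N : ℕ} (hN : 1 ≤ N) {a : ℝ} (ha : 0 < a) (ha3 : a ≤ 3) :
    Summable (fun m : ℕ => ((N + m : ℕ):ℝ) ^ (-a - 1)) ∧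
    ∑' m : ℕ, ((N + m : ℕ):ℝ) ^ (-a - 1) ≤ 16 / a * (N:ℝ) ^ (-a) := by
  have hb : ∀ M : ℕ, ∑ m ∈ range M, ((N + m : ℕ):ℝ) ^ (-a - 1) ≤ 16 / a * (N:ℝ) ^ (-a) := by
    intro M
    calc ∑ m ∈ range M, ((N + m : ℕ):ℝ) ^ (-a - 1)
        ≤ ∑ m ∈ range M, 16 / a * (((N + m : ℕ):ℝ) ^ (-a) - ((N + (m + 1) : ℕ):ℝ) ^ (-a)) :=
          sum_le_sum fun m _ => rpow_tele (by omega) ha ha3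
      _ = 16 / a * (((N + 0 : ℕ):ℝ) ^ (-a) - ((N + M : ℕ):ℝ) ^ (-a)) := by
          rw [← mul_sum, Finset.sum_range_sub' (fun m => ((N + m : ℕ):ℝ) ^ (-a))]
      _ ≤ _ := by
          have : 0 ≤ ((N + M : ℕ):ℝ) ^ (-a) := by positivity
          rw [Nat.add_zero]
          gcongr
          linarith
  exact ⟨summable_of_sum_range_le (fun _ => by positivity) hb,
    tsum_le_of_sum_range_le (fun _ => by positivity) hb⟩

lemma An_summable {N : ℕ} (hN : 1 ≤ N) {s : ℂ} (hs : 0 < s.re) (hs3 : s.re ≤ 3) :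
    Summable (fun m => An (N + m) s) ∧
    ‖∑' m, An (N + m) s‖ ≤ ‖s - 1‖ * ‖s‖ * (16 / s.re * (N:ℝ) ^ (-s.re)) := by
  obtain ⟨h1, h2⟩ := rpow_tail hN hs hs3
  have h3 := h1.mul_left (‖s - 1‖ * ‖s‖)
  have hle : ∀ m, ‖An (N + m) s‖ ≤ ‖s - 1‖ * ‖s‖ * ((N + m : ℕ):ℝ) ^ (-s.re - 1) :=
    fun m => An_norm (by omega) hs
  refine ⟨Summable.of_norm_bounded h3 hle, ?_⟩
  refine (tsum_of_norm_bounded h3.hasSum hle).trans ?_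
  rw [tsum_mul_left]
  gcongr

lemma An_sum_of_one_lt {N : ℕ} (hN : 1 ≤ N) {s : ℂ} (hs : 1 < s.re) (hs3 : s.re ≤ 3) :
    riemannZeta₁ s = (s - 1) * ∑ n ∈ Ico 1 N, (n:ℂ) ^ (-s) + (N:ℂ) ^ (1 - s)
      + ∑' m, An (N + m) s := by
  have hs1 : s ≠ 1 := by intro h; rw [h] at hs; simp at hs
  have hs1' : s - 1 ≠ 0 := sub_ne_zero.2 hs1
  have hz : riemannZeta₁ s = (s - 1) * riemannZeta s := by
    rw [riemannZeta_eq_inv_sub_mul hs1, mul_inv_cancel_left₀ hs1']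
  have hsum : Summable (fun n : ℕ => 1 / (n:ℂ) ^ s) := Complex.summable_one_div_nat_cpow.2 hs
  have hT := hsum.hasSum.tendsto_sum_nat
  rw [← zeta_eq_tsum_one_div_nat_cpow hs] at hT
  have hA := (An_summable hN (by linarith) hs3).1.hasSum.tendsto_sum_nat
  have hT2 : Tendsto (fun M : ℕ => ∑ n ∈ range (M + N), 1 / (n:ℂ) ^ s) atTop (nhds (riemannZeta s)) :=
    hT.comp (tendsto_add_atTop_nat N)
  have h0 : Tendsto (fun M : ℕ => ((M + N : ℕ):ℂ) ^ (1 - s)) atTop (nhds 0) := by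
    rw [tendsto_zero_iff_norm_tendsto_zero]
    have : Tendsto (fun M : ℕ => ((M : ℕ):ℝ) ^ (-(s.re - 1))) atTop (nhds 0) :=
      (tendsto_rpow_neg_atTop (by linarith)).comp tendsto_natCast_atTop_atTop
    refine (this.comp (tendsto_add_atTop_nat N)).congr (fun M => ?_)
    have hp : 0 < M + N := by omega
    have := norm_natCast_cpow_of_pos hp (1 - s)
    rw [this]
    simp
  have key : ∀ M : ℕ, (s - 1) * ∑ n ∈ range (M + N), 1 / (n:ℂ) ^ s =
      (s - 1) * ∑ n ∈ Ico 1 N, (n:ℂ) ^ (-s) + (N:ℂ) ^ (1 - s)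
      + ∑ m ∈ range M, An (N + m) s - ((M + N : ℕ):ℂ) ^ (1 - s) := by
    intro M
    induction M with
    | zero =>
      have : ∑ n ∈ range N, 1 / (n:ℂ) ^ s = ∑ n ∈ Ico 1 N, (n:ℂ) ^ (-s) := by
        rw [Finset.range_eq_Ico, Finset.sum_eq_sum_Ico_succ_bot hN]
        have hs0 : s ≠ 0 := by intro h; rw [h] at hs; simp at hs; linarith
        simp [Complex.zero_cpow hs0, cpow_neg]
      rw [Nat.zero_add, this, Finset.sum_range_zero]; ring
    | succ M ih =>
      rw [show M + 1 + N = M + N + 1 by ring, sum_range_succ, mul_add, ih, sum_range_succ]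
      unfold An
      rw [show N + M = M + N by ring, cpow_neg, one_div]
      ring
  have hl := (hT2.const_mul (s - 1))
  simp only [key] at hl
  have hr := (hA.const_add ((s - 1) * ∑ n ∈ Ico 1 N, (n:ℂ) ^ (-s) + (N:ℂ) ^ (1 - s))).sub h0
  rw [hz, tendsto_nhds_unique hl hr, sub_zero]

lemma zeta_approx {N : ℕ} (hN : 1 ≤ N) {s : ℂ} (hs : 0 < s.re) (hs3 : s.re < 3) :
    riemannZeta₁ s = (s - 1) * ∑ n ∈ Ico 1 N, (n:ℂ) ^ (-s) + (N:ℂ) ^ (1 - s)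
      + ∑' m, An (N + m) s := by
  set a := s.re / 2 with ha
  set R := ‖s‖ + 3 with hR
  set U : Set ℂ := {z | a < z.re} ∩ {z | z.re < 3} ∩ Metric.ball 0 R with hU
  have hUo : IsOpen U := ((isOpen_lt continuous_const continuous_re).inter
    (isOpen_lt continuous_re continuous_const)).inter Metric.isOpen_ball
  have hUc : Convex ℝ U := ((convex_halfSpace_re_gt a).inter (convex_halfSpace_re_lt 3)).inter (convex_ball 0 R)
  have hsU : s ∈ U := ⟨⟨show a < s.re by rw [ha]; linarith, hs3⟩, by simp [hR]⟩
  have h2U : (2:ℂ) ∈ U := ⟨⟨show a < (2:ℂ).re by simp; linarith, by show (2:ℂ).re < 3; simp; norm_num⟩, by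
    simp [hR]; have := norm_nonneg s; linarith⟩
  have hcp : ∀ n : ℕ, 1 ≤ n → Differentiable ℂ (fun z : ℂ => (n:ℂ) ^ (-z)) := fun n hn z =>
    (differentiableAt_id.neg).const_cpow (Or.inl (by exact_mod_cast (by omega : n ≠ 0)))
  have hcp1 : ∀ n : ℕ, 1 ≤ n → Differentiable ℂ (fun z : ℂ => (n:ℂ) ^ (1 - z)) := fun n hn z =>
    (differentiableAt_id.const_sub 1).const_cpow (Or.inl (by exact_mod_cast (by omega : n ≠ 0)))
  have hAd : ∀ n : ℕ, 1 ≤ n → Differentiable ℂ (An n) := fun n hn => by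
    unfold An
    exact ((differentiable_id.sub_const 1).mul (hcp n hn)).sub ((hcp1 n hn).sub (hcp1 (n + 1) (by omega)))
  have ha0 : 0 < a := by rw [ha]; linarith
  have hts : DifferentiableOn ℂ (fun z => ∑' m, An (N + m) z) U := by
    refine Complex.differentiableOn_tsum_of_summable_norm
      (u := fun m => ((R + 1) * R) * ((N + m : ℕ):ℝ) ^ (-a - 1))
      ((rpow_tail hN ha0 (by linarith)).1.mul_left _)
      (fun m => (hAd _ (by omega)).differentiableOn) hUo ?_
    intro m w hw
    have hw1 : a < w.re := hw.1.1
    have hw2 : ‖w‖ < R := by simpa using hw.2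
    refine (An_norm (by omega) (by linarith)).trans ?_
    have : ‖w - 1‖ ≤ R + 1 := by
      refine (norm_sub_le _ _).trans ?_
      simp; linarith
    have h1 : (1:ℝ) ≤ ((N + m : ℕ):ℝ) := by exact_mod_cast (by omega : 1 ≤ N + m)
    have hR0 : 0 ≤ R := by positivity
    have h3 : ((N + m : ℕ):ℝ) ^ (-w.re - 1) ≤ ((N + m : ℕ):ℝ) ^ (-a - 1) :=
      rpow_le_rpow_of_exponent_le h1 (by linarith)
    exact mul_le_mul (mul_le_mul this hw2.le (norm_nonneg _) (by linarith)) h3 (by positivity) (by positivity)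
  have hrhs : DifferentiableOn ℂ (fun z => (z - 1) * ∑ n ∈ Ico 1 N, (n:ℂ) ^ (-z) + (N:ℂ) ^ (1 - z)
      + ∑' m, An (N + m) z) U := by
    refine DifferentiableOn.add (Differentiable.differentiableOn ?_) hts
    refine ((differentiable_id.sub_const 1).mul ?_).add (hcp1 N hN)
    exact Differentiable.fun_sum fun n hn => hcp n (mem_Ico.1 hn).1
  refine (differentiable_riemannZeta₁.differentiableOn.analyticOnNhd hUo).eqOn_of_preconnected_of_eventuallyEq
    (hrhs.analyticOnNhd hUo) hUc.isPreconnected h2U ?_ hsU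
  have : {z : ℂ | 1 < z.re} ∩ {z | z.re < 3} ∈ nhds (2:ℂ) :=
    ((isOpen_lt continuous_const continuous_re).inter
    (isOpen_lt continuous_re continuous_const)).mem_nhds ⟨by show 1 < (2:ℂ).re; simp, by show (2:ℂ).re < 3; simp; norm_num⟩
  filter_upwards [this] with z hz
  exact An_sum_of_one_lt hN hz.1 (le_of_lt hz.2)


lemma abel_range (w : ℕ → ℝ) (f : ℕ → ℂ) (hw : Antitone w) (hw0 : ∀ n, 0 ≤ w n) (B : ℝ) (m : ℕ)
    (hB : ∀ j ≤ m, ‖∑ i ∈ range j, f i‖ ≤ B) :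
    ‖∑ i ∈ range m, (w i : ℂ) * f i‖ ≤ w 0 * B := by
  rcases Nat.eq_zero_or_pos m with rfl | hm
  · have := hB 0 le_rfl
    simp at this ⊢
    exact mul_nonneg (hw0 0) this
  have := Finset.sum_range_by_parts (fun i => (w i : ℂ)) f m
  simp only [smul_eq_mul] at this
  rw [this]
  refine (norm_sub_le _ _).trans ?_
  have h1 : ‖(w (m - 1) : ℂ) * ∑ i ∈ range m, f i‖ ≤ w (m - 1) * B := by
    rw [norm_mul, norm_real, norm_of_nonneg (hw0 _)]
    exact mul_le_mul_of_nonneg_left (hB m le_rfl) (hw0 _)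
  have h2 : ‖∑ i ∈ range (m - 1), ((w (i + 1) : ℂ) - w i) * ∑ j ∈ range (i + 1), f j‖
      ≤ ∑ i ∈ range (m - 1), (w i - w (i + 1)) * B := by
    refine norm_sum_le_of_le _ fun i hi => ?_
    rw [mem_range] at hi
    rw [norm_mul, ← Complex.ofReal_sub, norm_real, norm_eq_abs, abs_sub_comm,
      abs_of_nonneg (sub_nonneg.2 (hw (Nat.le_succ i)))]
    exact mul_le_mul_of_nonneg_left (hB _ (by omega)) (sub_nonneg.2 (hw (Nat.le_succ i)))
  rw [← Finset.sum_mul, Finset.sum_range_sub'] at h2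
  refine (add_le_add h1 h2).trans (le_of_eq ?_)
  ring

lemma cpow_ft {n : ℕ} (hn : 1 ≤ n) (s : ℂ) :
    (n:ℂ) ^ (-s) = (((n:ℝ) ^ (-s.re) : ℝ) : ℂ) * ft s.im n := by
  have hn0 : (0:ℝ) < n := by exact_mod_cast hn
  have hn0' : (n:ℂ) ≠ 0 := by exact_mod_cast hn0.ne'
  unfold ft ee
  rw [Complex.cpow_def_of_ne_zero hn0', rpow_def_of_pos hn0, Complex.ofReal_exp, ← Complex.exp_add]
  congr 1
  have hpi : (2 * (π:ℂ)) ≠ 0 := by exact_mod_cast (by positivity : 2 * π ≠ 0)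
  have hs := Complex.re_add_im s
  have : 2 * π * -(s.im * log n / (2 * π)) = -(s.im * log n) := by
    field_simp
  rw [this]
  conv_lhs => rw [← hs]
  rw [← ofReal_natCast, ← Complex.ofReal_log hn0.le, ofReal_mul, Complex.ofReal_neg,
    Complex.ofReal_neg, ofReal_mul]
  ring

lemma block_bound {N : ℕ} {T : ℝ} {s : ℂ} (hL : 10 ^ 11 ≤ log N) (hTL : 0.9 * log N ≤ T)
    (hτ : |s.im| = Real.exp T) (hs : 0 ≤ s.re) :
    ‖∑ n ∈ Ico N (2 * N), (n:ℂ) ^ (-s)‖ ≤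
      (N:ℝ) ^ (1 - s.re) * ((Real.exp 7 + 4) * dl (log N) T) := by
  have hN0 : 1 ≤ N := by
    rcases Nat.eq_zero_or_pos N with h | h
    · rw [h] at hL; norm_num at hL
    · exact h
  have hN0' : (0:ℝ) < N := by exact_mod_cast hN0
  rw [Finset.sum_Ico_eq_sum_range, show 2 * N - N = N by omega]
  have e : ∀ k : ℕ, ((N + k : ℕ):ℂ) ^ (-s) = ((((N + k : ℕ):ℝ) ^ (-s.re) : ℝ) : ℂ) * ft s.im ((N + k : ℕ):ℝ) :=
    fun k => cpow_ft (by omega) s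
  simp only [e]
  refine (abel_range (fun k => ((N + k : ℕ):ℝ) ^ (-s.re)) (fun k => ft s.im ((N + k : ℕ):ℝ)) ?_
    (fun _ => by positivity) (N * ((Real.exp 7 + 4) * dl (log N) T)) N ?_).trans ?_
  · intro a b hab
    refine rpow_le_rpow_of_nonpos (by positivity) ?_ (by linarith)
    exact_mod_cast (by omega : N + a ≤ N + b)
  · intro j hj
    have := exp_sum (N := N) (N' := N + j) hL hTL hτ (by omega) (by omega)
    rw [Finset.sum_Ico_eq_sum_range, show N + j - N = j by omega] at this
    exact this
  · rw [Nat.add_zero, sub_eq_add_neg, rpow_add hN0', rpow_one]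
    refine le_of_eq ?_; ring

lemma harm_bound {N : ℕ} {Y : ℝ} (hY : 0 ≤ Y) (hN : ∀ n < N, (n:ℝ) ≤ Real.exp Y) :
    ∑ n ∈ Ico 1 N, (n:ℝ)⁻¹ ≤ 1 + Y := by
  rcases Nat.lt_or_ge N 2 with h | h
  · rw [Finset.Ico_eq_empty (by omega)]; simp; linarith
  · have h1 := harmonic_le_one_add_log (N - 1)
    have h2 : ((harmonic (N - 1) : ℚ) : ℝ) = ∑ n ∈ Ico 1 N, (n:ℝ)⁻¹ := by
      rw [harmonic_eq_sum_Icc]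
      push_cast
      refine sum_congr ?_ fun _ _ => rfl
      ext x; simp only [mem_Icc, mem_Ico]; omega
    rw [h2] at h1
    refine h1.trans ?_
    have h3 : log ((N - 1 : ℕ):ℝ) ≤ Y := by
      rw [log_le_iff_le_exp (by exact_mod_cast (by omega : 0 < N - 1))]
      exact hN _ (by omega)
    linarith

lemma sum_dyadic (f : ℕ → ℂ) (N J : ℕ) : ∑ n ∈ Ico N (2 ^ J * N), f n =
    ∑ j ∈ range J, ∑ n ∈ Ico (2 ^ j * N) (2 * (2 ^ j * N)), f n := by
  induction J with
  | zero => simp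
  | succ J ih =>
    rw [sum_range_succ, ← ih, pow_succ, show 2 ^ J * 2 * N = 2 * (2 ^ J * N) by ring]
    have h1 : N ≤ 2 ^ J * N := Nat.le_mul_of_pos_left _ (by positivity)
    rw [sum_Ico_consecutive _ h1 (by omega)]

set_option maxHeartbeats 1000000 in
theorem zeta_bound_aux {T Y η : ℝ} {s : ℂ} (hτ : |s.im| = Real.exp T) (hYη : Y * η = 1)
    (hY : 10 ^ 11 ≤ Y) (hYT : Y + 2 ≤ T) (hη0 : 0 < η) (hη : η ≤ 0.05) (hs : 1 - η ≤ s.re) (hs2 : s.re ≤ 2)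
    (hsave : η ≤ (10:ℝ)⁻¹ ^ 9 * (Y ^ 2 / T ^ 2)) :
    ‖riemannZeta s‖ ≤ (2 * (Real.exp 7 + 4) + 100) * T := by
  have hσ : 0.95 ≤ s.re := by linarith
  have hσ0 : 0 < s.re := by linarith
  have hT0 : 0 < T := by linarith
  set K := Real.exp 7 + 4 with hK
  set N₀ := ⌈Real.exp Y⌉₊ with hN₀
  have hN1 : Real.exp Y ≤ N₀ := Nat.le_ceil _
  have hN₀pos : (0:ℝ) < N₀ := lt_of_lt_of_le (exp_pos _) hN1
  have hN₀1 : 1 ≤ N₀ := by exact_mod_cast hN₀pos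
  have hN2 : (N₀:ℝ) ≤ Real.exp (Y + 1) := by
    have h1 : (N₀:ℝ) < Real.exp Y + 1 := Nat.ceil_lt_add_one (exp_pos _).le
    have h2 : 1 ≤ Real.exp Y := one_le_exp (by linarith)
    have h3 := add_one_le_exp (1:ℝ)
    rw [Real.exp_add]
    nlinarith
  have hlN1 : Y ≤ log N₀ := (le_log_iff_exp_le hN₀pos).2 hN1
  have hlN2 : log N₀ ≤ Y + 1 := (log_le_iff_le_exp hN₀pos).2 hN2
  have hl2 : 0.69 < log 2 := by have := log_two_gt_d9; linarith
  have hl2' : log 2 < 0.7 := by have := log_two_lt_d9; linarith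
  set J := ⌊(1.1 * T - log N₀) / log 2⌋₊ with hJ
  have hl20 : 0 < log 2 := by linarith
  have hJ0 : 0 ≤ (1.1 * T - log N₀) / log 2 := by
    apply div_nonneg _ hl20.le; linarith
  have hJ1 : (J:ℝ) * log 2 ≤ 1.1 * T - log N₀ := by
    have := Nat.floor_le hJ0
    rwa [le_div_iff₀ hl20] at this
  have hJ2 : 1.1 * T - log N₀ ≤ ((J:ℝ) + 1) * log 2 := by
    have := (Nat.lt_floor_add_one ((1.1 * T - log N₀) / log 2)).le
    rwa [div_le_iff₀ hl20] at this
  have hJT : (J:ℝ) ≤ 2 * T := by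
    have : (J:ℝ) * 0.69 ≤ J * log 2 := by gcongr
    linarith
  set N := 2 ^ J * N₀ with hN
  have hNpos : 1 ≤ N := Nat.mul_pos (by positivity) hN₀1
  have hNpos' : (0:ℝ) < N := by exact_mod_cast hNpos
  have hlog : ∀ j : ℕ, log ((2 ^ j * N₀ : ℕ):ℝ) = j * log 2 + log N₀ := by
    intro j
    push_cast
    rw [log_mul (by positivity) (by positivity), log_pow]
  have hlN : log N = J * log 2 + log N₀ := hlog J
  have hfirst : ‖∑ n ∈ Ico 1 N₀, (n:ℂ) ^ (-s)‖ ≤ Real.exp 1 * (1 + Y) := by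
    have hlt : ∀ n < N₀, (n:ℝ) ≤ Real.exp Y := fun n hn => (Nat.lt_ceil.1 hn).le
    calc _ ≤ ∑ n ∈ Ico 1 N₀, Real.exp 1 * (n:ℝ)⁻¹ := by
          refine norm_sum_le_of_le _ fun n hn => ?_
          rw [mem_Ico] at hn
          have hn0 : (0:ℝ) < n := by exact_mod_cast hn.1
          have hn1 : (1:ℝ) ≤ n := by exact_mod_cast hn.1
          rw [norm_natCast_cpow_of_pos hn.1, neg_re]
          have : (n:ℝ) ^ (-s.re) = (n:ℝ) ^ (1 - s.re) * (n:ℝ)⁻¹ := by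
            rw [← rpow_neg_one, ← rpow_add hn0]; congr 1; ring
          rw [this]
          gcongr
          calc (n:ℝ) ^ (1 - s.re) ≤ (n:ℝ) ^ η := rpow_le_rpow_of_exponent_le hn1 (by linarith)
            _ ≤ (Real.exp Y) ^ η := rpow_le_rpow hn0.le (hlt n hn.2) hη0.le
            _ = _ := by rw [← exp_mul, hYη]
      _ = Real.exp 1 * ∑ n ∈ Ico 1 N₀, (n:ℝ)⁻¹ := by rw [mul_sum]
      _ ≤ _ := by gcongr; exact harm_bound (by linarith) hlt
  have hblock : ∀ j ∈ range J, ‖∑ n ∈ Ico (2 ^ j * N₀) (2 * (2 ^ j * N₀)), (n:ℂ) ^ (-s)‖ ≤ K := by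
    intro j hj
    rw [mem_range] at hj
    have hLj := hlog j
    set Nj := 2 ^ j * N₀ with hNj
    have hNjpos : (0:ℝ) < Nj := by rw [hNj]; push_cast; positivity
    have hNj1 : (1:ℝ) ≤ Nj := by
      have : 1 ≤ Nj := Nat.mul_pos (by positivity) hN₀1
      exact_mod_cast this
    set L := log Nj with hL
    have hjJ : (j:ℝ) * log 2 ≤ J * log 2 := by gcongr
    have hj0 : 0 ≤ (j:ℝ) * log 2 := by positivity
    have hLY : Y ≤ L := by linarith
    have hLT : 0.9 * L ≤ T := by linarith
    refine (block_bound (by linarith) hLT hτ hσ0.le).trans ?_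
    have h1 : (Nj:ℝ) ^ (1 - s.re) ≤ Real.exp (η * L) := by
      rw [rpow_def_of_pos hNjpos, exp_le_exp, mul_comm]
      have : 0 ≤ L := by linarith
      gcongr
      linarith
    have h2 : η * L ≤ (10:ℝ)⁻¹ ^ 9 * (L ^ 3 / T ^ 2) := by
      have hL0 : 0 ≤ L := by linarith
      calc η * L ≤ ((10:ℝ)⁻¹ ^ 9 * (Y ^ 2 / T ^ 2)) * L := by gcongr
        _ ≤ ((10:ℝ)⁻¹ ^ 9 * (L ^ 2 / T ^ 2)) * L := by gcongr
        _ = _ := by ring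
    have h3 : (Nj:ℝ) ^ (1 - s.re) * dl L T ≤ 1 := by
      calc _ ≤ Real.exp (η * L) * dl L T := by gcongr; exact (dl_pos _ _).le
        _ ≤ Real.exp ((10:ℝ)⁻¹ ^ 9 * (L ^ 3 / T ^ 2)) * dl L T := by
          gcongr; exact (dl_pos _ _).le
        _ = 1 := by unfold dl; rw [← Real.exp_add, ← exp_zero]; congr 1; ring
    have hK0 : 0 ≤ K := by positivity
    calc _ = K * ((Nj:ℝ) ^ (1 - s.re) * dl L T) := by ring
      _ ≤ K * 1 := by gcongr
      _ = K := mul_one _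
  have hsumb : ‖∑ n ∈ Ico 1 N, (n:ℂ) ^ (-s)‖ ≤ Real.exp 1 * (1 + Y) + 2 * T * K := by
    rw [← sum_Ico_consecutive _ hN₀1 (show N₀ ≤ N from Nat.le_mul_of_pos_left _ (by positivity)),
      hN, sum_dyadic]
    refine (norm_add_le _ _).trans (add_le_add hfirst ?_)
    refine (norm_sum_le_of_le _ hblock).trans ?_
    rw [sum_const, card_range, nsmul_eq_mul]
    have hK0 : 0 ≤ K := by positivity
    gcongr
  have him : Real.exp T ≤ ‖s - 1‖ := by
    have := Complex.abs_im_le_norm (s - 1)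
    simp only [Complex.sub_im, Complex.one_im, sub_zero] at this
    rw [← hτ]; exact this
  have heT : 1 + T ≤ Real.exp T := by have := add_one_le_exp T; linarith
  have hs1' : s - 1 ≠ 0 := by
    rw [← norm_pos_iff]; exact lt_of_lt_of_le (exp_pos _) him
  have hs1 : s ≠ 1 := sub_ne_zero.1 hs1'
  have hapx := zeta_approx hNpos hσ0 (by linarith : s.re < 3)
  have htail := (An_summable hNpos hσ0 (by linarith)).2
  have hz : riemannZeta s = ∑ n ∈ Ico 1 N, (n:ℂ) ^ (-s) + (s - 1)⁻¹ * (N:ℂ) ^ (1 - s)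
      + (s - 1)⁻¹ * ∑' m, An (N + m) s := by
    rw [riemannZeta_eq_inv_sub_mul hs1, hapx]
    field_simp
  have hp2 : ‖(s - 1)⁻¹ * (N:ℂ) ^ (1 - s)‖ ≤ 1 := by
    rw [norm_mul, norm_inv, norm_natCast_cpow_of_pos hNpos, inv_mul_le_iff₀ (norm_pos_iff.2 hs1'), mul_one]
    refine le_trans ?_ him
    rw [Complex.sub_re, Complex.one_re, rpow_def_of_pos hNpos', exp_le_exp]
    have h0 : 0 ≤ log N := log_nonneg (by exact_mod_cast hNpos)
    have h1 : log N ≤ 1.1 * T := by linarith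
    calc log N * (1 - s.re) ≤ log N * 0.05 := by
          apply mul_le_mul_of_nonneg_left _ h0
          linarith
      _ ≤ T := by linarith
  have hp3 : ‖(s - 1)⁻¹ * ∑' m, An (N + m) s‖ ≤ 64 := by
    rw [norm_mul, norm_inv, inv_mul_le_iff₀ (norm_pos_iff.2 hs1')]
    refine htail.trans ?_
    rw [mul_assoc]
    refine mul_le_mul_of_nonneg_left ?_ (norm_nonneg _)
    have h1 : ‖s‖ ≤ 2 * Real.exp T := by
      refine (Complex.norm_le_abs_re_add_abs_im s).trans ?_
      rw [hτ, abs_of_pos hσ0]; linarith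
    have h2 : 16 / s.re ≤ 32 := by
      rw [div_le_iff₀ hσ0]; linarith
    have h3 : (N:ℝ) ^ (-s.re) ≤ Real.exp (-T) := by
      rw [rpow_def_of_pos hNpos', exp_le_exp]
      have h4 : 1.1 * T - 1 ≤ log N := by linarith
      have h5 : (1.1 * T - 1) * 0.95 ≤ log N * s.re := by
        apply mul_le_mul h4 hσ (by norm_num) (le_trans _ h4)
        linarith
      linarith
    calc ‖s‖ * (16 / s.re * (N:ℝ) ^ (-s.re)) ≤ (2 * Real.exp T) * (32 * Real.exp (-T)) := by
          gcongr
      _ = 64 * (Real.exp T * Real.exp (-T)) := by ring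
      _ = 64 := by rw [← Real.exp_add]; simp
  rw [hz]
  refine (norm_add₃_le).trans ?_
  have he : Real.exp 1 ≤ 3 := by have := exp_one_lt_d9; linarith
  have : Real.exp 1 * (1 + Y) ≤ 3 * T := by
    calc _ ≤ 3 * (1 + Y) := by gcongr
      _ ≤ _ := by linarith
  linarith

theorem zeta_bound {θ : ℝ} (hθ : 2 / 3 < θ) (hθ1 : θ < 1) : ∃ C > 0, ∃ T₀ > 0, ∀ s : ℂ, ∀ T ≥ T₀,
    |s.im| = Real.exp T → 1 - T ^ (-θ) ≤ s.re → s.re ≤ 2 → ‖riemannZeta s‖ ≤ C * T := by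
  have h1 : ∀ᶠ T : ℝ in atTop, 10 ^ 11 ≤ T ^ θ := (tendsto_rpow_atTop (by linarith)).eventually_ge_atTop _
  have h2 : ∀ᶠ T : ℝ in atTop, 3 ≤ T ^ (1 - θ) := (tendsto_rpow_atTop (by linarith)).eventually_ge_atTop _
  have h3 : ∀ᶠ T : ℝ in atTop, 10 ^ 9 ≤ T ^ (3 * θ - 2) := (tendsto_rpow_atTop (by linarith)).eventually_ge_atTop _
  obtain ⟨T₀, hT₀⟩ := eventually_atTop.1 ((h1.and h2).and (h3.and (eventually_ge_atTop 1)))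
  refine ⟨2 * (Real.exp 7 + 4) + 100, by positivity, max T₀ 1, by positivity, ?_⟩
  intro s T hT hτ hs hs2
  obtain ⟨⟨a1, a2⟩, a3, a4⟩ := hT₀ T (le_trans (le_max_left _ _) hT)
  have hT0 : 0 < T := by linarith
  have e1 : T ^ θ * T ^ (-θ) = 1 := by rw [← rpow_add hT0]; simp
  have hpos : 0 < T ^ (-θ) := by positivity
  refine zeta_bound_aux (Y := T ^ θ) (η := T ^ (-θ)) hτ e1 a1 ?_ hpos ?_ hs hs2 ?_
  · have : T ^ θ * T ^ (1 - θ) = T := by rw [← rpow_add hT0]; simp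
    nlinarith
  · have : T ^ (-θ) * 10 ^ 11 ≤ 1 := by nlinarith
    linarith
  · have e2 : (T ^ θ) ^ 2 / T ^ 2 = T ^ (3 * θ - 2) * T ^ (-θ) := by
      rw [← rpow_natCast (T ^ θ), ← rpow_mul hT0.le, ← rpow_natCast T, ← rpow_sub hT0,
        ← rpow_add hT0]
      congr 1; push_cast; ring
    rw [e2]
    have : 10 ^ 9 * T ^ (-θ) ≤ T ^ (3 * θ - 2) * T ^ (-θ) := by gcongr
    linarith


lemma bc_logderiv {f : ℂ → ℂ} {r M : ℝ} (hr : 0 < r) (hM : 0 < M)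
    (hf : DifferentiableOn ℂ f (ball 0 r)) (h0 : ∀ z ∈ ball (0:ℂ) r, f z ≠ 0)
    (hb : ∀ z ∈ ball (0:ℂ) r, ‖f z‖ ≤ ‖f 0‖ * exp M) {z : ℂ} (hz : ‖z‖ ≤ 3 / 4 * r) :
    ‖deriv f z / f z‖ ≤ 112 * M / r := by
  have hd : DifferentiableOn ℂ (fun w => deriv f w / f w) (ball 0 r) :=
    (hf.deriv isOpen_ball).div hf h0
  obtain ⟨F, hF0, hF⟩ := hd.isExactOn_ball.with_val_at 0 0
  have hmem0 : (0:ℂ) ∈ ball (0:ℂ) r := mem_ball_self hr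
  have hfd : ∀ w ∈ ball (0:ℂ) r, HasDerivAt f (deriv f w) w := fun w hw =>
    (hf.differentiableAt (isOpen_ball.mem_nhds hw)).hasDerivAt
  have hFd : DifferentiableOn ℂ F (ball 0 r) := fun w hw =>
    (hF w hw).differentiableAt.differentiableWithinAt
  have hconst : ∀ w ∈ ball (0:ℂ) r, f w * Complex.exp (-F w) = f 0 := by
    intro w hw
    have hder : ∀ v ∈ ball (0:ℂ) r, HasDerivWithinAt (fun w => f w * Complex.exp (-F w)) 0
        (ball 0 r) v := by
      intro v hv
      have h1 := (hfd v hv).mul ((hF v hv).neg.cexp)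
      refine HasDerivAt.hasDerivWithinAt (h1.congr_deriv ?_)
      have := h0 v hv
      field_simp
      ring
    have h2 := (convex_ball (0:ℂ) r).norm_image_sub_le_of_norm_hasDerivWithin_le
      (C := 0) hder (by simp) hmem0 hw
    simp [hF0] at h2
    exact sub_eq_zero.mp h2
  have hFre : ∀ w ∈ ball (0:ℂ) r, (F w).re ≤ M := by
    intro w hw
    have h1 : f w = f 0 * Complex.exp (F w) := by
      rw [← hconst w hw, mul_assoc, ← Complex.exp_add]; simp
    have h2 := hb w hw
    rw [h1, norm_mul, Complex.norm_exp] at h2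
    have h3 : 0 < ‖f 0‖ := norm_pos_iff.mpr (h0 0 hmem0)
    exact exp_le_exp.mp (le_of_mul_le_mul_left h2 h3)
  have hFb : ∀ w, ‖w‖ ≤ 7 / 8 * r → ‖F w‖ ≤ 14 * M := by
    intro w hw
    have hwb : w ∈ ball (0:ℂ) r := by rw [mem_ball_zero_iff]; linarith
    have := Complex.borelCaratheodory_zero hM hFd (fun v hv => hFre v hv) hr hwb hF0
    refine this.trans ?_
    rw [div_le_iff₀ (by linarith)]
    nlinarith [norm_nonneg w]
  have hzb : z ∈ ball (0:ℂ) r := by rw [mem_ball_zero_iff]; linarith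
  rw [← (hF z hzb).deriv]
  have hsub : closedBall z (r/8) ⊆ ball 0 r := by
    intro w hw
    rw [mem_closedBall, dist_eq_norm] at hw
    rw [mem_ball_zero_iff]
    have := norm_add_le (w - z) z
    simp at this
    linarith
  have := Complex.norm_deriv_le_of_forall_mem_sphere_norm_le (c := z) (R := r/8) (C := 14*M)
    (f := F) (by positivity)
    ((hFd.mono hsub).diffContOnCl_ball (Set.Subset.refl _)) (by
      intro w hw
      apply hFb
      rw [mem_sphere, dist_eq_norm] at hw
      have := norm_add_le (w - z) z
      simp at this
      linarith)
  refine this.trans (le_of_eq ?_)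
  field_simp
  norm_num

lemma blaschke {U : Set ℂ} (hU : IsOpen U) {f : ℂ → ℂ} {R K : ℝ} (hR : 0 < R)
    (hUR : closedBall 0 R ⊆ U) (hf : DifferentiableOn ℂ f U)
    (hK : ∀ z ∈ closedBall (0:ℂ) R, ‖f z‖ ≤ K) {ρ : ℂ} (hρ : f ρ = 0) (hρ0 : ρ ≠ 0) (hρR : ‖ρ‖ < R)
    (hf0 : f 0 ≠ 0) :
    ∃ g : ℂ → ℂ, DifferentiableOn ℂ g U ∧ (∀ z ∈ closedBall (0:ℂ) R, ‖g z‖ ≤ K) ∧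
      ‖g 0‖ = ‖f 0‖ * (R / ‖ρ‖) ∧ (∀ z ∈ closedBall (0:ℂ) R, g z = 0 → f z = 0) ∧
      (deriv f 0 / f 0).re = (deriv g 0 / g 0).re + ρ.re * (1 / R ^ 2 - 1 / ‖ρ‖ ^ 2) := by
  set D := dslope f ρ with hD
  have hfD : ∀ z, f z = (z - ρ) * D z := by
    intro z
    have := sub_smul_dslope f ρ z
    rw [hρ, sub_zero] at this
    rw [← this]; rfl
  have hDd : DifferentiableOn ℂ D U := (Complex.differentiableOn_dslope
    (hU.mem_nhds (hUR (by rw [mem_closedBall_zero_iff]; exact hρR.le)))).mpr hf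
  have hRc : (R:ℂ) ≠ 0 := by exact_mod_cast hR.ne'
  set B : ℂ → ℂ := fun z => ((R:ℂ)^2 - (starRingEnd ℂ) ρ * z) / R with hB
  have hBd : Differentiable ℂ B := by
    rw [hB]; fun_prop
  have hgd : DifferentiableOn ℂ (fun z => D z * B z) U := hDd.mul hBd.differentiableOn
  refine ⟨fun z => D z * B z, hgd, ?_, ?_, ?_, ?_⟩
  · intro z hz
    have hcl : closure (ball (0:ℂ) R) = closedBall 0 R := closure_ball 0 hR.ne'
    refine Complex.norm_le_of_forall_mem_frontier_norm_le (U := ball (0:ℂ) R) isBounded_ball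
      ((hgd.mono hUR).diffContOnCl_ball (Set.Subset.refl _)) ?_ (hcl ▸ hz)
    intro w hw
    rw [frontier_ball 0 hR.ne', mem_sphere_zero_iff_norm] at hw
    have h1 : (R:ℂ)^2 - (starRingEnd ℂ) ρ * w = w * (starRingEnd ℂ) (w - ρ) := by
      rw [map_sub, mul_sub, Complex.mul_conj, Complex.normSq_eq_norm_sq, hw]
      push_cast; ring
    have h2 : ‖B w‖ = ‖w - ρ‖ := by
      rw [hB]; simp only
      rw [h1, norm_div, norm_mul, hw, Complex.norm_conj, norm_real, norm_of_nonneg hR.le]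
      field_simp
    rw [norm_mul, h2, mul_comm, ← norm_mul, ← hfD]
    exact hK w (by rw [mem_closedBall_zero_iff, hw])
  · have h1 := hfD 0
    have h2 : B 0 = R := by rw [hB]; simp; field_simp
    have hρn : ‖ρ‖ ≠ 0 := norm_ne_zero_iff.mpr hρ0
    show ‖D 0 * B 0‖ = _
    rw [h1, h2]
    simp [abs_of_pos hR]
    field_simp
  · intro z hz h
    rcases mul_eq_zero.mp h with h | h
    · rw [hfD, h, mul_zero]
    · exfalso
      rw [hB] at h
      simp only [div_eq_zero_iff, hRc, or_false] at h
      have h3 : ‖(R:ℂ)^2‖ = ‖(starRingEnd ℂ) ρ * z‖ := by rw [sub_eq_zero.mp h]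
      rw [norm_mul, Complex.norm_conj, norm_pow, norm_real, norm_of_nonneg hR.le] at h3
      rw [mem_closedBall_zero_iff] at hz
      nlinarith [norm_nonneg z, norm_nonneg ρ]
  · have hU0 : U ∈ nhds (0:ℂ) := hU.mem_nhds (hUR (mem_closedBall_self hR.le))
    have hD0 : HasDerivAt D (deriv D 0) 0 := (hDd.differentiableAt hU0).hasDerivAt
    have hB0 : HasDerivAt B (-(starRingEnd ℂ) ρ / R) 0 := by
      rw [hB]
      have := (((hasDerivAt_id (0:ℂ)).const_mul ((starRingEnd ℂ) ρ)).const_sub ((R:ℂ)^2)).div_const (R:ℂ)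
      simpa using this
    have h1 : deriv f 0 = D 0 + (-ρ) * deriv D 0 := by
      have : HasDerivAt f (1 * D 0 + (0 - ρ) * deriv D 0) 0 := by
        have h := ((hasDerivAt_id (0:ℂ)).sub_const ρ).mul hD0
        have e : f = fun z => (z - ρ) * D z := funext hfD
        rw [e]; exact h
      rw [this.deriv]; ring
    have h2 : deriv (fun z => D z * B z) 0 = deriv D 0 * B 0 + D 0 * (-(starRingEnd ℂ) ρ / R) :=
      (hD0.mul hB0).deriv
    have hB00 : B 0 = R := by rw [hB]; simp; field_simp
    have hD00 : D 0 ≠ 0 := fun h => hf0 (by rw [hfD, h, mul_zero])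
    have h3 : deriv f 0 / f 0 = deriv (fun z => D z * B z) 0 / (D 0 * B 0) +
        (-ρ⁻¹ + (starRingEnd ℂ) ρ / (R:ℂ)^2) := by
      rw [h1, h2, hfD 0, hB00]
      field_simp
      ring
    simp only
    rw [h3, add_re, add_re, neg_re, Complex.inv_re,
      Complex.normSq_eq_norm_sq]
    have h4 : ((starRingEnd ℂ) ρ / (R:ℂ)^2).re = ρ.re / R^2 := by
      rw [← Complex.ofReal_pow, Complex.div_ofReal_re, Complex.conj_re]
    rw [h4]; ring

lemma landau_ind {U : Set ℂ} (hU : IsOpen U) {R r K M : ℝ} (hr : 0 < r) (hrR : r < R)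
    (hUR : closedBall 0 R ⊆ U) (hM : 0 < M) : ∀ (n : ℕ) (f : ℂ → ℂ), DifferentiableOn ℂ f U →
    (∀ z ∈ closedBall (0:ℂ) R, ‖f z‖ ≤ K) → K ≤ ‖f 0‖ * exp M → f 0 ≠ 0 →
    K < ‖f 0‖ * (R / r) ^ n → (∀ z ∈ closedBall (0:ℂ) r, f z = 0 → z.re < 0) →
    -(112 * M / r) ≤ (deriv f 0 / f 0).re := by
  have hR : 0 < R := hr.trans hrR
  intro n
  induction n with
  | zero =>
    intro f _ hK _ _ h _
    have := hK 0 (mem_closedBall_self hR.le)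
    simp at h
    linarith
  | succ n ih =>
    intro f hf hK hM' hf0 hn hz
    by_cases hex : ∀ z ∈ ball (0:ℂ) r, f z ≠ 0
    · have hsub : ball (0:ℂ) r ⊆ closedBall 0 R :=
        ball_subset_closedBall.trans (closedBall_subset_closedBall hrR.le)
      have := bc_logderiv hr hM (hf.mono (hsub.trans hUR)) hex
        (fun z hz => (hK z (hsub hz)).trans hM') (z := 0) (by simp; positivity)
      have h2 := abs_re_le_norm (deriv f 0 / f 0)
      linarith [(abs_le.mp h2).1]
    · push Not at hex
      obtain ⟨ρ, hρr, hρ⟩ := hex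
      have hρ0 : ρ ≠ 0 := fun h => hf0 (h ▸ hρ)
      have hρr' : ‖ρ‖ < r := mem_ball_zero_iff.mp hρr
      have hρp : 0 < ‖ρ‖ := norm_pos_iff.mpr hρ0
      have hre := hz ρ (ball_subset_closedBall hρr) hρ
      obtain ⟨g, hg, hgK, hg0, hgz, hgd⟩ := blaschke hU hR hUR hf hK hρ hρ0 (hρr'.trans hrR) hf0
      have hfp : 0 < ‖f 0‖ := norm_pos_iff.mpr hf0
      have h1 : R / r ≤ R / ‖ρ‖ := by gcongr
      have h2 : 1 ≤ R / r := by rw [le_div_iff₀ hr]; linarith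
      have hgg : ‖f 0‖ * (R / r) ≤ ‖g 0‖ := by rw [hg0]; gcongr
      have hgp : ‖f 0‖ ≤ ‖g 0‖ := by nlinarith
      have := ih g hg hgK (hM'.trans (by gcongr)) (norm_pos_iff.mp (hfp.trans_le hgp)) (by
          refine hn.trans_le ?_
          rw [pow_succ', ← mul_assoc]
          gcongr) (fun z hzr h => hz z hzr (hgz z (closedBall_subset_closedBall hrR.le hzr) h))
      rw [hgd]
      have h3 : 1 / R ^ 2 ≤ 1 / ‖ρ‖ ^ 2 := by gcongr; linarith
      nlinarith

lemma landau {U : Set ℂ} (hU : IsOpen U) {f : ℂ → ℂ} {R r K M : ℝ} (hr : 0 < r) (hrR : r < R)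
    (hUR : closedBall 0 R ⊆ U) (hM : 0 < M) (hf : DifferentiableOn ℂ f U)
    (hK : ∀ z ∈ closedBall (0:ℂ) R, ‖f z‖ ≤ K) (hM' : K ≤ ‖f 0‖ * exp M) (hf0 : f 0 ≠ 0)
    (hz : ∀ z ∈ closedBall (0:ℂ) r, f z = 0 → z.re < 0) :
    -(112 * M / r) ≤ (deriv f 0 / f 0).re := by
  have hfp : 0 < ‖f 0‖ := norm_pos_iff.mpr hf0
  obtain ⟨n, hn⟩ := pow_unbounded_of_one_lt (K / ‖f 0‖) ((one_lt_div hr).mpr hrR)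
  rw [div_lt_iff₀' hfp] at hn
  exact landau_ind hU hr hrR hUR hM n f hf hK hM' hf0 hn hz

lemma landau_zero {U : Set ℂ} (hU : IsOpen U) {f : ℂ → ℂ} {R r K M d : ℝ} (hr : 0 < r) (hrR : r < R)
    (hUR : closedBall 0 R ⊆ U) (hM : 0 < M) (hf : DifferentiableOn ℂ f U)
    (hK : ∀ z ∈ closedBall (0:ℂ) R, ‖f z‖ ≤ K) (hM' : K ≤ ‖f 0‖ * exp M) (hf0 : f 0 ≠ 0)
    (hz : ∀ z ∈ closedBall (0:ℂ) r, f z = 0 → z.re < 0) (hd : 0 < d) (hdR : d < R)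
    (hfd : f (-d) = 0) :
    1 / d - d / R ^ 2 - 112 * M / r ≤ (deriv f 0 / f 0).re := by
  have hR : 0 < R := hr.trans hrR
  have hn : ‖(-(d:ℂ))‖ = d := by rw [norm_neg, norm_real, norm_of_nonneg hd.le]
  obtain ⟨g, hg, hgK, hg0, hgz, hgd⟩ := blaschke hU hR hUR hf hK hfd
    (neg_ne_zero.mpr (by exact_mod_cast hd.ne')) (by rw [hn]; exact hdR) hf0
  have hfp : 0 < ‖f 0‖ := norm_pos_iff.mpr hf0
  rw [hn] at hg0 hgd
  have hgp : ‖f 0‖ ≤ ‖g 0‖ := by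
    rw [hg0]
    have : 1 ≤ R / d := by rw [le_div_iff₀ hd]; linarith
    nlinarith
  have := landau hU hr hrR hUR hM hg hgK (hM'.trans (by gcongr)) (norm_pos_iff.mp (hfp.trans_le hgp))
    (fun z hzr h => hz z hzr (hgz z (closedBall_subset_closedBall hrR.le hzr) h))
  rw [hgd]
  simp only [neg_re, ofReal_re]
  have e : 1 / d = d * (1 / d^2) := by field_simp
  rw [e]
  have e2 : d / R^2 = d * (1/R^2) := by ring
  rw [e2]
  linarith


lemma zeta1_ne_zero {s : ℂ} (hs : 1 ≤ s.re) : riemannZeta₁ s ≠ 0 := by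
  by_cases h : s = 1
  · simp [h]
  · intro h0
    have := riemannZeta_eq_inv_sub_mul h
    rw [h0, mul_zero] at this
    exact riemannZeta_ne_zero_of_one_le_re hs this

lemma zeta_logderiv_eq {s : ℂ} (hs : s ≠ 1) (h0 : riemannZeta₁ s ≠ 0) :
    deriv riemannZeta s / riemannZeta s = -(s - 1)⁻¹ + deriv riemannZeta₁ s / riemannZeta₁ s := by
  have h1 := sub_ne_zero_of_ne hs
  rw [deriv_riemannZeta_eq_neg_inv_sub_sq_mul_add hs, riemannZeta_eq_inv_sub_mul hs]
  field_simp

lemma zeta_real : ∃ C > 0, ∀ σ : ℝ, 1 < σ → σ ≤ 2 → ‖riemannZeta σ‖ ≤ C / (σ - 1) ∧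
    ‖deriv riemannZeta σ / riemannZeta σ‖ ≤ 1 / (σ - 1) + C := by
  have hc1 : ContinuousOn (fun σ : ℝ => riemannZeta₁ σ) (Set.Icc 1 2) :=
    (differentiable_riemannZeta₁.continuous.comp Complex.continuous_ofReal).continuousOn
  have hc2 : ContinuousOn (fun σ : ℝ => deriv riemannZeta₁ σ / riemannZeta₁ σ) (Set.Icc 1 2) := by
    refine ContinuousOn.div ?_ hc1 (fun x hx => zeta1_ne_zero (by simpa using hx.1))
    exact (differentiable_riemannZeta₁.deriv.continuous.comp Complex.continuous_ofReal).continuousOn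
  obtain ⟨A, hA⟩ := isCompact_Icc.exists_bound_of_continuousOn hc1
  obtain ⟨B, hB⟩ := isCompact_Icc.exists_bound_of_continuousOn hc2
  refine ⟨max 1 (max A B), by positivity, fun σ h1 h2 => ?_⟩
  have hne : (σ:ℂ) ≠ 1 := by exact_mod_cast h1.ne'
  have hp : 0 < σ - 1 := by linarith
  have hn : ‖((σ:ℂ) - 1)⁻¹‖ = 1 / (σ - 1) := by
    rw [norm_inv, show (σ:ℂ) - 1 = ((σ - 1 : ℝ):ℂ) by push_cast; ring, norm_real,
      norm_of_nonneg hp.le, one_div]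
  constructor
  · rw [riemannZeta_eq_inv_sub_mul hne, norm_mul, hn, div_mul_eq_mul_div, one_mul]
    gcongr
    exact (hA σ ⟨h1.le, h2⟩).trans (by simp)
  · rw [zeta_logderiv_eq hne (zeta1_ne_zero (by simpa using h1.le))]
    refine (norm_add_le _ _).trans ?_
    rw [norm_neg, hn]
    gcongr
    exact (hB σ ⟨h1.le, h2⟩).trans (by simp)

lemma norm_term_eq (f : ℕ → ℂ) (s : ℂ) (n : ℕ) :
    ‖LSeries.term f s n‖ = if n = 0 then 0 else ‖f n‖ / (n:ℝ) ^ s.re := by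
  rw [LSeries.norm_term_eq]

lemma zeta_inv_le {s : ℂ} (hs : 1 < s.re) : 1 ≤ ‖riemannZeta s‖ * ‖riemannZeta (s.re : ℂ)‖ := by
  have hs' : 1 < ((s.re : ℝ) : ℂ).re := by simpa using hs
  have h1 := LSeries_one_mul_Lseries_moebius hs
  rw [LSeries_one_eq_riemannZeta hs] at h1
  have h2 : ‖LSeries (fun n => ((moebius n : ℤ) : ℂ)) s‖ ≤
      ‖riemannZeta (s.re : ℂ)‖ := by
    have hsum := (LSeriesHasSum_one hs')
    have hre := hasSum_re hsum
    have hle : ∀ n, ‖LSeries.term (fun n => ((moebius n : ℤ) : ℂ)) s n‖ ≤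
        (LSeries.term 1 (s.re : ℂ) n).re := by
      intro n
      rw [norm_term_eq, LSeries.term_def]
      split_ifs with h
      · simp
      · have hn : (0:ℝ) < n := by positivity
        have e : (1:ℕ → ℂ) n / (n:ℂ) ^ (s.re:ℂ) = ((1 / (n:ℝ)^s.re : ℝ) : ℂ) := by
          push_cast
          rw [ofReal_cpow hn.le]; simp
        rw [e, ofReal_re]
        gcongr
        simp only [Complex.norm_intCast]
        exact_mod_cast ArithmeticFunction.abs_moebius_le_one
    have := tsum_of_norm_bounded hre hle
    exact this.trans ((le_abs_self _).trans (abs_re_le_norm _))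
  calc (1:ℝ) = ‖riemannZeta s * LSeries (fun n => ((moebius n : ℤ) : ℂ)) s‖ := by
        rw [h1]; simp
    _ ≤ _ := by rw [norm_mul]; gcongr

lemma vm_hasSum {s : ℂ} (hs : 1 < s.re) :
    HasSum (LSeries.term (fun n => ((vonMangoldt n : ℝ):ℂ)) s)
      (-deriv riemannZeta s / riemannZeta s) := by
  rw [← ArithmeticFunction.LSeries_vonMangoldt_eq_deriv_riemannZeta_div hs]
  exact (ArithmeticFunction.LSeriesSummable_vonMangoldt hs).LSeriesHasSum

lemma logderiv_norm_le {s : ℂ} (hs : 1 < s.re) : ‖deriv riemannZeta s / riemannZeta s‖ ≤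
    ‖deriv riemannZeta (s.re:ℂ) / riemannZeta (s.re:ℂ)‖ := by
  have hs' : 1 < ((s.re : ℝ) : ℂ).re := by simpa using hs
  have h1 := vm_hasSum hs
  have h2 := hasSum_re (vm_hasSum hs')
  have := tsum_of_norm_bounded h2 (f := LSeries.term (fun n => ((vonMangoldt n : ℝ):ℂ)) s) (by
      intro n
      rw [norm_term_eq, LSeries.term_def]
      split_ifs with h
      · simp
      · have hn : (0:ℝ) < n := by positivity
        have e : ((vonMangoldt n : ℝ):ℂ) / (n:ℂ) ^ (s.re:ℂ) = ((vonMangoldt n / (n:ℝ)^s.re : ℝ) : ℂ) := by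
          push_cast
          rw [ofReal_cpow hn.le]; simp
        rw [e, ofReal_re, norm_real, norm_of_nonneg vonMangoldt_nonneg])
  rw [h1.tsum_eq] at this
  rw [neg_div, norm_neg] at this
  refine this.trans ((le_abs_self _).trans ((abs_re_le_norm _).trans (le_of_eq ?_)))
  rw [neg_div, norm_neg]

lemma term_re (σ t : ℝ) (n : ℕ) :
    (LSeries.term (fun n => ((vonMangoldt n : ℝ):ℂ)) (σ + t * I) n).re =
      vonMangoldt n * (n:ℝ) ^ (-σ) * cos (t * log n) := by
  rw [LSeries.term_def]
  split_ifs with h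
  · simp [h]
  · have hn : (0:ℝ) < n := by positivity
    have hn' : (n:ℂ) ≠ 0 := by exact_mod_cast h
    rw [div_eq_mul_inv, ← cpow_neg, neg_add, Complex.cpow_add _ _ hn']
    rw [show (n:ℂ) ^ (-(σ:ℂ)) = (((n:ℝ) ^ (-σ) : ℝ) : ℂ) by
      rw [ofReal_cpow hn.le]; simp]
    rw [Complex.cpow_def_of_ne_zero hn', ← mul_assoc, ← ofReal_mul, Complex.re_ofReal_mul]
    congr 1
    rw [show Complex.log n * -(t * I) = ((-(t * log n) : ℝ):ℂ) * I by
      rw [← ofReal_natCast, ← Complex.ofReal_log hn.le]; push_cast; ring,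
      Complex.exp_ofReal_mul_I_re, cos_neg]

lemma three41 {σ t : ℝ} (hσ : 1 < σ) :
    0 ≤ 3 * (-(deriv riemannZeta σ / riemannZeta σ)).re +
      4 * (-(deriv riemannZeta (σ + t * I) / riemannZeta (σ + t * I))).re +
      (-(deriv riemannZeta (σ + (2 * t : ℝ) * I) / riemannZeta (σ + (2 * t : ℝ) * I))).re := by
  have h0 := hasSum_re (vm_hasSum (s := (σ:ℂ)) (by simpa using hσ))
  have h1 := hasSum_re (vm_hasSum (s := (σ + t * I)) (by simpa using hσ))
  have h2 := hasSum_re (vm_hasSum (s := (σ + (2 * t : ℝ) * I)) (by simpa using hσ))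
  rw [neg_div] at h0 h1 h2
  have h3 := ((h0.mul_left 3).add (h1.mul_left 4)).add h2
  refine h3.nonneg fun n => ?_
  have e0 := term_re σ 0 n
  simp only [Complex.ofReal_zero, zero_mul, add_zero, cos_zero, mul_one] at e0
  rw [e0, term_re, term_re]
  have hp : 0 ≤ vonMangoldt n * (n:ℝ) ^ (-σ) :=
    mul_nonneg vonMangoldt_nonneg (by positivity)
  rw [show 2 * t * log n = 2 * (t * log n) by ring, cos_two_mul]
  nlinarith [mul_nonneg hp (sq_nonneg (cos (t * log n) + 1))]

lemma ev_rpow {a b : ℝ} (hab : a < b) (C : ℝ) : ∀ᶠ T : ℝ in atTop, C * T ^ a ≤ T ^ b := by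
  have h := (tendsto_rpow_atTop (sub_pos.mpr hab)).eventually_ge_atTop C
  filter_upwards [h, eventually_gt_atTop 0] with T h1 h2
  calc C * T ^ a ≤ T ^ (b - a) * T ^ a := by gcongr
    _ = T ^ b := by rw [← rpow_add h2]; ring_nf

lemma ev_exp {κ : ℝ} (hκ : 0 < κ) (a C : ℝ) : ∀ᶠ T : ℝ in atTop, C * T ^ a ≤ exp (T ^ κ) := by
  have h := (isLittleO_rpow_exp_atTop (a / κ)).comp_tendsto (tendsto_rpow_atTop hκ)
  have h' := h.bound (c := 1 / (|C| + 1)) (by positivity)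
  filter_upwards [h', eventually_gt_atTop 0] with T h1 h2
  simp only [Function.comp] at h1
  rw [← rpow_mul h2.le, mul_div_cancel₀ _ hκ.ne', norm_of_nonneg (by positivity),
    norm_of_nonneg (by positivity), div_mul_eq_mul_div, one_mul, le_div_iff₀ (by positivity)] at h1
  have h3 : 0 ≤ T ^ a := by positivity
  nlinarith [le_abs_self C]

lemma height {θ T : ℝ} (h0 : 0 < θ) (h1 : θ < 1) (hT : 2 ≤ T) {y : ℝ} (hy1 : exp T / 2 ≤ |y|)
    (hy2 : |y| ≤ 3 * exp T) : ∃ T', |y| = exp T' ∧ T - 1 ≤ T' ∧ T' ≤ 2 * T ∧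
      T ^ (-θ) / 2 ≤ T' ^ (-θ) := by
  have hp : 0 < |y| := lt_of_lt_of_le (by positivity) hy1
  have h2 : T - 1 ≤ log |y| := by
    rw [le_log_iff_exp_le hp, exp_sub]
    refine le_trans ?_ hy1
    gcongr
    linarith [add_one_le_exp 1]
  have h3 : log |y| ≤ 2 * T := by
    rw [log_le_iff_le_exp hp, two_mul, Real.exp_add]
    refine hy2.trans ?_
    gcongr
    linarith [add_one_le_exp T]
  refine ⟨log |y|, (exp_log hp).symm, h2, h3, ?_⟩
  calc T ^ (-θ) / 2 = 2 ^ (-1:ℝ) * T ^ (-θ) := by rw [rpow_neg_one]; ring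
    _ ≤ 2 ^ (-θ) * T ^ (-θ) := by gcongr <;> linarith
    _ = (2 * T) ^ (-θ) := by rw [mul_rpow (by norm_num) (by linarith)]
    _ ≤ _ := rpow_le_rpow_of_nonpos (by linarith) h3 (by linarith)

lemma zeta_bound' {θ : ℝ} (hθ : 2/3 < θ) (hθ1 : θ < 1) : ∃ C > 0, ∀ᶠ T : ℝ in atTop, ∀ s : ℂ,
    exp T / 2 ≤ |s.im| → |s.im| ≤ 3 * exp T → 1 - T ^ (-θ) / 2 ≤ s.re → s.re ≤ 2 →
    ‖riemannZeta s‖ ≤ C * T := by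
  obtain ⟨C, hC, T₀, hT₀, h⟩ := zeta_bound hθ hθ1
  refine ⟨2 * C, by positivity, ?_⟩
  filter_upwards [eventually_ge_atTop (T₀ + 1), eventually_ge_atTop 2] with T h1 h2 s hs1 hs2 hs3 hs4
  obtain ⟨T', e1, e2, e3, e4⟩ := height (by linarith) hθ1 h2 hs1 hs2
  refine (h s T' (by linarith) e1 (by linarith) hs4).trans ?_
  nlinarith

lemma zeta_low : ∃ C > 0, ∀ s : ℂ, 1 < s.re → s.re ≤ 2 → (s.re - 1) / C ≤ ‖riemannZeta s‖ := by
  obtain ⟨C, hC, h⟩ := zeta_real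
  refine ⟨C, hC, fun s h1 h2 => ?_⟩
  have h3 := (h s.re h1 h2).1
  have h4 := zeta_inv_le h1
  have h5 : 0 < s.re - 1 := by linarith
  rw [le_div_iff₀ h5] at h3
  rw [div_le_iff₀ hC]
  nlinarith [norm_nonneg (riemannZeta s), norm_nonneg (riemannZeta (s.re:ℂ))]

lemma disc_mem {T R : ℝ} (hT : 1 ≤ T) (hR : R ≤ 1/2) {s z : ℂ} (h1 : exp T ≤ |s.im|)
    (h2 : |s.im| ≤ 2 * exp T) (hz : ‖z‖ ≤ R) :
    exp T / 2 ≤ |(s + z).im| ∧ |(s + z).im| ≤ 3 * exp T ∧ s.re - R ≤ (s + z).re ∧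
      (s + z).re ≤ s.re + R := by
  have h3 := (Complex.abs_im_le_norm z).trans hz
  have h4 := (abs_re_le_norm z).trans hz
  have h5 := abs_add_le s.im z.im
  have h6 := abs_sub_abs_le_abs_sub s.im (-z.im)
  rw [abs_neg, sub_neg_eq_add] at h6
  rw [Complex.add_im, add_re]
  have := add_one_le_exp T
  rw [abs_le] at h4
  refine ⟨by linarith, by linarith, by linarith, by linarith⟩

lemma zeta_comp_deriv (s z : ℂ) : deriv (fun z => riemannZeta (s + z)) z = deriv riemannZeta (s + z) :=
  deriv_comp_const_add riemannZeta s z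

lemma neg_re_bound {θ κ θ' : ℝ} (hθ : 2/3 < θ) (hθ1 : θ < 1) (hκ : 0 < κ) :
    ∀ᶠ T : ℝ in atTop, ∀ s : ℂ, exp T ≤ |s.im| → |s.im| ≤ 2 * exp T → 1 + T ^ (-θ') ≤ s.re →
    s.re ≤ 3/2 →
    -(448 * T ^ (θ + κ)) ≤ (deriv riemannZeta s / riemannZeta s).re ∧
    ∀ d : ℝ, 0 < d → d < T ^ (-θ) / 2 → riemannZeta (s - d) = 0 →
    1 / d - 4 * d * T ^ (2 * θ) - 448 * T ^ (θ + κ) ≤ (deriv riemannZeta s / riemannZeta s).re := by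
  obtain ⟨C, hC, hb⟩ := zeta_bound' hθ hθ1
  obtain ⟨C₀, hC₀, hl⟩ := zeta_low
  filter_upwards [hb, ev_exp hκ (1 + θ') (C * C₀), eventually_ge_atTop 2] with T hb he hT s h1 h2 h3 h4
  have hTp : 0 < T := by linarith
  have hTθ : 0 < T ^ (-θ) := by positivity
  have hTθ1 : T ^ (-θ) ≤ 1 := rpow_le_one_of_one_le_of_nonpos (by linarith) (by linarith)
  set R := T ^ (-θ) / 2 with hR
  have hRp : 0 < R := by positivity
  have hR2 : R ≤ 1/2 := by linarith
  have hTθ' : 0 < T ^ (-θ') := by positivity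
  have hTκ : 0 < T ^ κ := by positivity
  set f : ℂ → ℂ := fun z => riemannZeta (s + z) with hf
  have hfd0 : deriv f 0 = deriv riemannZeta s := by rw [hf, zeta_comp_deriv, add_zero]
  have hf00 : f 0 = riemannZeta s := by rw [hf]; simp
  have hmem : ∀ z ∈ closedBall (0:ℂ) R, s + z ≠ 1 := by
    intro z hz h
    have := (disc_mem (by linarith) hR2 h1 h2 (mem_closedBall_zero_iff.mp hz)).1
    rw [h] at this
    simp at this
    linarith [exp_pos T]
  have hU : IsOpen {z : ℂ | s + z ≠ 1} :=
    isOpen_ne.preimage (continuous_const_add s)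
  have hfU : DifferentiableOn ℂ f {z : ℂ | s + z ≠ 1} := by
    intro z hz
    refine DifferentiableAt.differentiableWithinAt ?_
    exact (differentiableAt_riemannZeta hz).comp z (by fun_prop)
  have hK : ∀ z ∈ closedBall (0:ℂ) R, ‖f z‖ ≤ C * T := by
    intro z hz
    obtain ⟨e1, e2, e3, e4⟩ := disc_mem (by linarith) hR2 h1 h2 (mem_closedBall_zero_iff.mp hz)
    exact hb _ e1 e2 (by linarith) (by linarith)
  have hlow := hl s (by linarith) (by linarith)
  have hM' : C * T ≤ ‖f 0‖ * exp (T ^ κ) := by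
    rw [hf00]
    have : T ^ (-θ') / C₀ ≤ ‖riemannZeta s‖ := le_trans (by gcongr; linarith) hlow
    have e : C * T = T ^ (-θ') / C₀ * (C * C₀ * T ^ (1 + θ')) := by
      rw [rpow_add hTp, rpow_neg hTp.le, rpow_one]
      field_simp
    rw [e]
    gcongr
  have hf0 : f 0 ≠ 0 := by
    rw [hf00]; exact riemannZeta_ne_zero_of_one_le_re (by linarith)
  have hzz : ∀ z ∈ closedBall (0:ℂ) (R/2), f z = 0 → z.re < 0 := by
    intro z hz h
    by_contra hc
    push Not at hc
    exact riemannZeta_ne_zero_of_one_le_re (by rw [add_re]; linarith) h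
  have hRR : 112 * T ^ κ / (R / 2) = 448 * T ^ (θ + κ) := by
    rw [hR, rpow_neg hTp.le, rpow_add hTp]; field_simp; norm_num
  have hsub : closedBall (0:ℂ) R ⊆ {z : ℂ | s + z ≠ 1} := hmem
  constructor
  · have := landau hU (by positivity : 0 < R/2) (by linarith) hsub hTκ hfU hK hM' hf0 hzz
    rw [hRR, hfd0, hf00] at this
    exact this
  · intro d hd hdR hzd
    have := landau_zero hU (by positivity : 0 < R/2) (by linarith) hsub hTκ hfU hK hM' hf0 hzz hd hdR
      (by rw [hf]; simpa [sub_eq_add_neg] using hzd)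
    rw [hRR, hfd0, hf00] at this
    have e : d / R ^ 2 = 4 * d * T ^ (2 * θ) := by
      rw [hR, rpow_neg hTp.le, two_mul θ, rpow_add hTp]; field_simp; norm_num
    rw [e] at this
    exact this

theorem zero_free {θ₁ : ℝ} (h1 : 2/3 < θ₁) (h2 : θ₁ < 1) : ∀ᶠ T : ℝ in atTop, ∀ s : ℂ,
    |s.im| = exp T → 1 - T ^ (-θ₁) ≤ s.re → riemannZeta s ≠ 0 := by
  obtain ⟨θ, hθ, hθ1⟩ := exists_between h1
  set κ := (θ₁ - θ) / 2 with hκ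
  have hκp : 0 < κ := by linarith
  obtain ⟨C₀, hC₀, hr⟩ := zeta_real
  filter_upwards [neg_re_bound (θ' := θ₁) hθ (by linarith) hκp, eventually_ge_atTop 2,
    ev_rpow (by linarith : θ + κ < θ₁) (60 * (5 * 448 + 3 * C₀ + 96)),
    ev_rpow (by linarith : -θ₁ < -θ) 13, ev_rpow (by linarith : -θ₁ < 0) 10]
    with T hL hT hE hE2 hE3 ρ him hre h0
  have hTp : 0 < T := by linarith
  set η := T ^ (-θ₁) with hη
  have hηp : 0 < η := by positivity
  rw [rpow_zero] at hE3
  have hρ1 : ρ.re < 1 := by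
    by_contra hc
    push Not at hc
    exact riemannZeta_ne_zero_of_one_le_re hc h0
  set σ := 1 + 5 * η with hσ
  set t := ρ.im with ht
  have him1 : ((σ:ℂ) + t * I).im = t := by simp
  have him2 : ((σ:ℂ) + (2 * t : ℝ) * I).im = 2 * t := by simp
  have hre1 : ((σ:ℂ) + t * I).re = σ := by simp
  have hre2 : ((σ:ℂ) + (2 * t : ℝ) * I).re = σ := by simp
  have b2 := (hL ((σ:ℂ) + (2 * t : ℝ) * I) (by rw [him2, abs_mul, him]; norm_num; linarith [exp_pos T])
    (by rw [him2, abs_mul, him]; norm_num) (by rw [hre2]; linarith) (by rw [hre2]; linarith)).1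
  have b1 := (hL ((σ:ℂ) + t * I) (by rw [him1, him])
    (by rw [him1, him]; linarith [exp_pos T]) (by rw [hre1]; linarith) (by rw [hre1]; linarith)).2
    (σ - ρ.re) (by linarith) (by linarith) (by
      have : (σ:ℂ) + t * I - ((σ - ρ.re : ℝ):ℂ) = ρ := by
        apply ext <;> simp [ht]
      rw [this, h0])
  have b0 := (hr σ (by linarith) (by linarith)).2
  have b0' := (neg_le_abs _).trans (abs_re_le_norm (deriv riemannZeta σ / riemannZeta σ))
  have key := three41 (t := t) (by linarith : 1 < σ)
  simp only [neg_re] at key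
  have hd6 : σ - ρ.re ≤ 6 * η := by linarith
  have hd : 1 / (6 * η) ≤ 1 / (σ - ρ.re) := one_div_le_one_div_of_le (by linarith) hd6
  have e1 : 1 / (6 * η) = T ^ θ₁ / 6 := by rw [hη, rpow_neg hTp.le]; field_simp
  have e2 : 1 / (σ - 1) = T ^ θ₁ / 5 := by
    rw [hσ, hη, rpow_neg hTp.le]; field_simp; ring
  have e3 : 4 * (σ - ρ.re) * T ^ (2 * θ) ≤ 24 * T ^ (θ + κ) := by
    calc 4 * (σ - ρ.re) * T ^ (2 * θ) ≤ 4 * (6 * η) * T ^ (2 * θ) := by gcongr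
      _ = 24 * T ^ (2 * θ - θ₁) := by rw [hη, sub_eq_add_neg, rpow_add hTp]; ring
      _ ≤ _ := by
        gcongr
        · linarith
        · linarith
  have e4 : 1 ≤ T ^ (θ + κ) := one_le_rpow (by linarith) (by linarith)
  have e5 : C₀ ≤ C₀ * T ^ (θ + κ) := by nlinarith
  rw [e2] at b0
  rw [e1] at hd
  have hTT : 0 < T ^ θ₁ := by positivity
  linarith


noncomputable def GG (s : ℂ) : ℂ := deriv riemannZeta₁ s / riemannZeta₁ s + riemannZeta₀ s

lemma zeta1_of_zeta {s : ℂ} (hs : s ≠ 1) (h : riemannZeta s ≠ 0) : riemannZeta₁ s ≠ 0 := by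
  intro h0
  apply h
  rw [riemannZeta_eq_inv_sub_mul hs, h0, mul_zero]

lemma GG_eq {s : ℂ} (hs : s ≠ 1) (h : riemannZeta₁ s ≠ 0) :
    GG s = deriv riemannZeta s / riemannZeta s + riemannZeta s := by
  rw [zeta_logderiv_eq hs h, riemannZeta_eq_inv_sub_add hs, GG]; ring

lemma logder_high {θ : ℝ} (h1 : 2/3 < θ) (h2 : θ < 1) : ∀ᶠ T : ℝ in atTop, ∀ s : ℂ,
    |s.im| = exp T → 1 - T ^ (-θ) ≤ s.re → s.re ≤ 2 →
    ‖deriv riemannZeta s / riemannZeta s‖ ≤ T := by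
  obtain ⟨θ₁, hθ, hθ1⟩ := exists_between h1
  set κ := (1 - θ₁) / 2 with hκ
  have hκp : 0 < κ := by linarith
  obtain ⟨C₀, hC₀, hr⟩ := zeta_real
  obtain ⟨C, hC, hb⟩ := zeta_bound' hθ (by linarith)
  obtain ⟨C₁, hC₁, hl⟩ := zeta_low
  obtain ⟨T₁, hT₁⟩ := (eventually_atTop.mp (zero_free hθ (by linarith)))
  filter_upwards [hb, ev_exp hκp (1 + θ₁) (C * (C₁ * 8)), eventually_ge_atTop 2,
    eventually_ge_atTop (T₁ + 1), ev_rpow (by linarith : θ₁ < 1) (8 + C₀),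
    ev_rpow (by linarith : κ + θ₁ < 1) 448, ev_rpow (by linarith : -θ < -θ₁) 16]
    with T hb he hT hTT1 hE1 hE2 hE3 s him hre hre2
  rw [rpow_one] at hE1 hE2
  have hTp : 0 < T := by linarith
  set w := T ^ (-θ₁) / 8 with hw
  have hwp : 0 < w := by positivity
  have hw8 : w ≤ 1 / 8 := by
    have : T ^ (-θ₁) ≤ 1 := rpow_le_one_of_one_le_of_nonpos (by linarith) (by linarith)
    rw [hw]; linarith
  have hw1 : 1 / w = 8 * T ^ θ₁ := by rw [hw, rpow_neg hTp.le]; field_simp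
  have e4 : 1 ≤ T ^ θ₁ := one_le_rpow (by linarith) (by linarith)
  rcases le_or_gt (1 + w) s.re with hc | hc
  · have a1 := logderiv_norm_le (s := s) (by linarith)
    have a2 := (hr s.re (by linarith) hre2).2
    have a3 : 1 / (s.re - 1) ≤ 1 / w := one_div_le_one_div_of_le hwp (by linarith)
    rw [hw1] at a3
    nlinarith
  · set s₀ : ℂ := (1 + w : ℝ) + s.im * I with hs₀
    have hs₀re : s₀.re = 1 + w := by simp [hs₀]
    have hs₀im : s₀.im = s.im := by simp [hs₀]
    set z : ℂ := s - s₀ with hz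
    have hzr : z = ((s.re - (1 + w) : ℝ) : ℂ) := by
      apply ext <;> simp [hz, hs₀re, hs₀im]
    have hTθ : 0 < T ^ (-θ) := by positivity
    have hzn : ‖z‖ ≤ 3 / 4 * (2 * w) := by
      rw [hzr, norm_real, norm_eq_abs, abs_le]
      constructor <;> linarith
    set f : ℂ → ℂ := fun z => riemannZeta (s₀ + z) with hf
    have h1' : exp T ≤ |s₀.im| := by rw [hs₀im, him]
    have h2' : |s₀.im| ≤ 2 * exp T := by rw [hs₀im, him]; linarith [exp_pos T]
    have hdm := fun {z : ℂ} (hz : z ∈ ball (0:ℂ) (2 * w)) =>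
      disc_mem (R := 2 * w) (by linarith) (by linarith) h1' h2' (mem_ball_zero_iff.mp hz).le
    have hTθ₁ : 0 < T ^ (-θ₁) := by positivity
    have hl' : w / C₁ ≤ ‖f 0‖ := by
      have := hl s₀ (by linarith) (by linarith)
      rw [hs₀re] at this
      simpa [hf] using this
    have hfd : DifferentiableOn ℂ f (ball 0 (2 * w)) := by
      intro v hv
      refine DifferentiableAt.differentiableWithinAt ?_
      refine (differentiableAt_riemannZeta ?_).comp v (by fun_prop)
      intro h
      have := (hdm hv).1
      rw [h] at this
      simp at this
      linarith [exp_pos T]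
    have := bc_logderiv (f := f) (r := 2 * w) (M := T ^ κ) (by positivity) (by positivity) hfd
      (by
        intro v hv
        obtain ⟨e1, e2, e3, e4⟩ := hdm hv
        obtain ⟨T', g1, g2, g3, g4⟩ := height (θ := θ₁) (by linarith) (by linarith) hT e1 e2
        exact hT₁ T' (by linarith) _ g1 (by linarith))
      (by
        intro v hv
        obtain ⟨e1, e2, e3, e4⟩ := hdm hv
        refine (hb _ e1 e2 (by linarith) (by linarith)).trans ?_
        have e : C * T = w / C₁ * (C * (C₁ * 8) * T ^ (1 + θ₁)) := by
          rw [hw, rpow_add hTp, rpow_neg hTp.le, rpow_one]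
          field_simp
        rw [e]
        gcongr) hzn
    rw [hf, zeta_comp_deriv] at this
    simp only [hz, add_sub_cancel] at this
    refine this.trans ?_
    have e : 112 * T ^ κ / (2 * w) = 448 * T ^ (κ + θ₁) := by
      rw [hw, rpow_add hTp, rpow_neg hTp.le]; field_simp; norm_num
    rw [e]; exact hE2

lemma GG_contAt {s : ℂ} (h : riemannZeta₁ s ≠ 0) : DifferentiableAt ℂ GG s := by
  unfold GG
  have := differentiable_riemannZeta₁.deriv
  fun_prop (disch := exact h)

theorem GG_bound {θ : ℝ} (h1 : 2/3 < θ) (h2 : θ < 1) : ∃ C > 0, ∀ᶠ T : ℝ in atTop, ∀ s : ℂ,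
    |s.im| ≤ exp T → 1 - T ^ (-θ) ≤ s.re → s.re ≤ 2 → riemannZeta₁ s ≠ 0 ∧ ‖GG s‖ ≤ C * T := by
  obtain ⟨C, hC, T₀, hT₀, hb⟩ := zeta_bound h1 h2
  obtain ⟨T₁, hT₁⟩ := eventually_atTop.mp ((zero_free h1 h2).and (logder_high h1 h2))
  set T₂ := max T₀ (max T₁ 1) with hT₂
  have h20 : T₀ ≤ T₂ := le_max_left _ _
  have h21 : T₁ ≤ T₂ := (le_max_left _ _).trans (le_max_right _ _)
  have h22 : 1 ≤ T₂ := (le_max_right _ _).trans (le_max_right _ _)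
  set K : Set ℂ := Set.Icc 1 2 ×ℂ Set.Icc (-exp T₂) (exp T₂) with hK
  have hKc : IsCompact K := isCompact_Icc.reProdIm isCompact_Icc
  have hO : IsOpen {s : ℂ | riemannZeta₁ s ≠ 0} :=
    isOpen_ne.preimage differentiable_riemannZeta₁.continuous
  have hKO : K ⊆ {s : ℂ | riemannZeta₁ s ≠ 0} := fun s hs => zeta1_ne_zero (mem_reProdIm.mp hs).1.1
  obtain ⟨δ, hδ, hδK⟩ := hKc.exists_cthickening_subset_open hO hKO
  have hcc : IsCompact (cthickening δ K) := hKc.cthickening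
  obtain ⟨B, hB⟩ := hcc.exists_bound_of_continuousOn (f := GG)
    (fun s hs => (GG_contAt (hδK hs)).continuousAt.continuousWithinAt)
  refine ⟨1 + C + |B|, by positivity, ?_⟩
  filter_upwards [eventually_ge_atTop T₂, ev_rpow (by linarith : -θ < 0) δ⁻¹] with T hT hδT s him hre hre2
  rw [rpow_zero, inv_mul_le_iff₀ hδ, mul_one] at hδT
  have hT1 : 1 ≤ T := h22.trans hT
  by_cases hc : |s.im| ≤ exp T₂
  · have hmem : s ∈ cthickening δ K := by
      refine mem_cthickening_of_dist_le s ((max s.re 1 : ℝ) + s.im * I) δ K ?_ ?_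
      · rw [hK, mem_reProdIm]
        rw [abs_le] at hc
        simp [hc, hre2]
      · have e : s - ((max s.re 1 : ℝ) + s.im * I) = ((s.re - max s.re 1 : ℝ):ℂ) := by
          apply ext <;> simp
        rw [dist_eq_norm, e, norm_real, norm_eq_abs, abs_le]
        constructor
        · have : max s.re 1 ≤ s.re + δ := max_le (by linarith) (by linarith)
          linarith
        · have := le_max_left s.re 1
          linarith
    refine ⟨hδK hmem, (hB s hmem).trans ?_⟩
    have := le_abs_self B
    have := abs_nonneg B
    nlinarith
  · push Not at hc
    have hp : 0 < |s.im| := (exp_pos _).trans hc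
    set T' := log |s.im| with hT'
    have e1 : |s.im| = exp T' := (exp_log hp).symm
    have e2 : T₂ ≤ T' := by rw [hT', le_log_iff_exp_le hp]; exact hc.le
    have e3 : T' ≤ T := by rw [hT', log_le_iff_le_exp hp]; exact him
    have e4 : T ^ (-θ) ≤ T' ^ (-θ) := rpow_le_rpow_of_nonpos (by linarith) e3 (by linarith)
    have hs1 : s ≠ 1 := by rintro rfl; simp at hp
    obtain ⟨a1, a2⟩ := hT₁ T' (by linarith)
    have z1 := zeta1_of_zeta hs1 (a1 s e1 (by linarith))
    refine ⟨z1, ?_⟩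
    rw [GG_eq hs1 z1]
    refine (norm_add_le _ _).trans ?_
    have b1 := a2 s e1 (by linarith) hre2
    have b2 := hb s T' (by linarith) e1 (by linarith) hre2
    have := abs_nonneg B
    nlinarith


noncomputable def ker (s : ℂ) : ℂ := 1 / (s * (s + 1))

lemma ker_norm {σ v : ℝ} (hσ : 1/2 ≤ σ) : ‖ker (σ + v * I)‖ ≤ 4 * (1 + v ^ 2)⁻¹ := by
  have e1 : ‖(σ + v * I : ℂ)‖ = √(σ^2 + v^2) := Complex.norm_add_mul_I σ v
  have e2 : ‖(σ + v * I + 1 : ℂ)‖ = √((σ+1)^2 + v^2) := by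
    rw [← Complex.norm_add_mul_I]; congr 1; push_cast; ring
  have h1 : √((1 + v^2)/4) ≤ √(σ^2 + v^2) := sqrt_le_sqrt (by nlinarith [sq_nonneg v])
  have h2 : √((1 + v^2)/4) ≤ √((σ+1)^2 + v^2) := sqrt_le_sqrt (by nlinarith [sq_nonneg v])
  have h3 : 0 < √((1 + v^2)/4) := sqrt_pos.mpr (by positivity)
  rw [ker, norm_div, norm_one, norm_mul, e1, e2]
  calc 1 / (√(σ^2 + v^2) * √((σ+1)^2 + v^2)) ≤ 1 / (√((1 + v^2)/4) * √((1 + v^2)/4)) := by gcongr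
    _ = _ := by rw [mul_self_sqrt (by positivity)]; field_simp

lemma line_ne {σ v : ℝ} (hσ : 0 < σ) : (σ + v * I : ℂ) ≠ 0 ∧ (σ + v * I + 1 : ℂ) ≠ 0 := by
  constructor
  · intro h; have := congrArg re h; simp at this; linarith
  · intro h; have := congrArg re h; simp at this; linarith

lemma ker_cont {σ : ℝ} (hσ : 0 < σ) : Continuous fun v : ℝ => ker (σ + v * I) := by
  unfold ker
  refine Continuous.div continuous_const (by fun_prop) (fun v => mul_ne_zero (line_ne hσ).1 (line_ne hσ).2)

lemma ker_int {σ : ℝ} (hσ : 1/2 ≤ σ) : Integrable fun v : ℝ => ker (σ + v * I) := by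
  refine Integrable.mono' (integrable_inv_one_add_sq.const_mul 4)
    (ker_cont (by linarith)).aestronglyMeasurable (Eventually.of_forall fun v => ker_norm hσ)

lemma perron_ker {σ u : ℝ} (hσ : 1/2 ≤ σ) (hu : 0 < u) :
    ∫ v : ℝ, (u:ℂ) ^ (-(σ + v * I)) * ker (σ + v * I) =
      ((2 * π * max (1 - u) 0 : ℝ) : ℂ) := by
  set f : ℝ → ℂ := fun t => Set.indicator (Set.Ioc 0 1) (fun _ => 1 : ℝ → ℂ) t -
    Set.indicator (Set.Ioc 0 1) (fun t => (t:ℂ) ^ (1:ℂ) : ℝ → ℂ) t with hf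
  have hm : ∀ s : ℂ, 0 < s.re → HasMellin f s (ker s) := by
    intro s hs
    have h1 := hasMellin_one_Ioc hs
    have h2 := hasMellin_cpow_Ioc 1 (s := s) (by simp; linarith)
    have h3 := hasMellin_sub h1.1 h2.1
    rw [h1.2, h2.2] at h3
    have e : 1 / s - 1 / (s + 1) = ker s := by
      have a1 : s ≠ 0 := by rintro rfl; simp at hs
      have a2 : s + 1 ≠ 0 := by
        intro h; have := congrArg re h; simp at this; linarith
      rw [ker]; field_simp; ring
    rw [e] at h3
    exact h3
  have hfe : ∀ t : ℝ, 0 < t → f t = ((max (1 - t) 0 : ℝ) : ℂ) := by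
    intro t ht
    rw [hf]
    simp only [Set.indicator, Set.mem_Ioc, ht, true_and, Complex.cpow_one]
    split_ifs with h
    · rw [max_eq_left (by linarith)]; push_cast; ring
    · rw [max_eq_right (by linarith)]; simp
  have hre : ∀ v : ℝ, (σ + v * I : ℂ).re = σ := by intro v; simp
  have hme : ∀ v : ℝ, mellin f (σ + v * I) = ker (σ + v * I) := fun v =>
    (hm _ (by rw [hre]; linarith)).2
  have key := mellinInv_mellin_eq σ f hu (hm σ (by simp; linarith)).1
    (by rw [Complex.VerticalIntegrable]; simp_rw [hme]; exact ker_int hσ)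
    (by
      have : ContinuousAt (fun t : ℝ => ((max (1 - t) 0 : ℝ) : ℂ)) u := by fun_prop
      refine this.congr ?_
      filter_upwards [lt_mem_nhds hu] with t ht using (hfe t ht).symm)
  rw [mellinInv, hfe u hu] at key
  simp_rw [hme, smul_eq_mul] at key
  rw [Complex.real_smul] at key
  have hπ : (π:ℂ) ≠ 0 := by exact_mod_cast pi_ne_zero
  have h4 : ((2 * π * max (1 - u) 0 : ℝ) : ℂ) = 2 * π * ((max (1 - u) 0 : ℝ) : ℂ) := by push_cast; ring
  rw [h4, ← key, ← mul_assoc]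
  have h5 : (2 * π : ℂ) * ((1 / (2 * π) : ℝ) : ℂ) = 1 := by push_cast; field_simp
  rw [h5, one_mul]

noncomputable def aa (n : ℕ) : ℝ := vonMangoldt n - 1

lemma aa_hasSum {s : ℂ} (hs : 1 < s.re) :
    HasSum (LSeries.term (fun n => (aa n : ℂ)) s) (-GG s) := by
  have h1 := (vm_hasSum hs).sub (LSeriesHasSum_one hs)
  have hs1 : s ≠ 1 := by rintro rfl; simp at hs
  rw [GG_eq hs1 (zeta1_ne_zero hs.le)]
  have e1 : -(deriv riemannZeta s / riemannZeta s + riemannZeta s) =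
      -deriv riemannZeta s / riemannZeta s - riemannZeta s := by ring
  have e2 : LSeries.term (fun n => (aa n : ℂ)) s = fun n => LSeries.term
      (fun n => ((vonMangoldt n : ℝ):ℂ)) s n - LSeries.term 1 s n := by
    funext n
    simp only [LSeries.term_def, aa]
    split_ifs
    · simp
    · push_cast; simp [sub_div]
  rw [e1, e2]
  exact h1

lemma GG_right : ∃ C > 0, ∀ s : ℂ, 1 < s.re → s.re ≤ 2 → ‖GG s‖ ≤ C / (s.re - 1) := by
  obtain ⟨C, hC, h⟩ := zeta_real
  refine ⟨2 * C + 1, by positivity, fun s h1 h2 => ?_⟩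
  have hs1 : s ≠ 1 := by rintro rfl; simp at h1
  have hp : 0 < s.re - 1 := by linarith
  rw [GG_eq hs1 (zeta1_ne_zero h1.le)]
  obtain ⟨a1, a2⟩ := h s.re h1 h2
  have a3 := logderiv_norm_le h1
  have a4 : ‖riemannZeta s‖ ≤ ‖riemannZeta (s.re:ℂ)‖ := by
    have hs' : 1 < ((s.re : ℝ) : ℂ).re := by simpa using h1
    have hle := tsum_of_norm_bounded (hasSum_re (LSeriesHasSum_one hs'))
      (f := LSeries.term 1 s) (by
      intro n
      rw [norm_term_eq, LSeries.term_def]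
      split_ifs with h
      · simp
      · have hn : (0:ℝ) < n := by positivity
        have e : (1:ℕ → ℂ) n / (n:ℂ) ^ (s.re:ℂ) = ((1 / (n:ℝ)^s.re : ℝ) : ℂ) := by
          push_cast
          rw [ofReal_cpow hn.le]; simp
        rw [e, ofReal_re]; simp)
    rw [(LSeriesHasSum_one h1).tsum_eq] at hle
    exact hle.trans ((le_abs_self _).trans (abs_re_le_norm _))
  have e : (2 * C + 1) / (s.re - 1) = 1 / (s.re - 1) + C / (s.re - 1) + C / (s.re - 1) := by ring
  have e2 : C ≤ C / (s.re - 1) := by rw [le_div_iff₀ hp]; nlinarith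
  rw [e]
  refine (norm_add_le _ _).trans ?_
  linarith

lemma perron {σ x : ℝ} (hσ : 1 < σ) (hx : 0 < x) {N : ℕ} (hN : x ≤ N) :
    ((2 * π * ∑ n ∈ Finset.Icc 1 N, aa n * max (1 - n / x) 0 : ℝ) : ℂ) =
      ∫ v : ℝ, -(GG (σ + v * I) * (x:ℂ) ^ (σ + v * I : ℂ) * ker (σ + v * I)) := by
  have hre : ∀ v : ℝ, (σ + v * I : ℂ).re = σ := by intro v; simp
  have hxc : (x:ℂ) ≠ 0 := by exact_mod_cast hx.ne'
  set F : ℕ → ℝ → ℂ := fun n v => LSeries.term (fun n => (aa n : ℂ)) (σ + v * I) n *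
    ((x:ℂ) ^ (σ + v * I : ℂ) * ker (σ + v * I)) with hF
  have hxn : ∀ v : ℝ, ‖(x:ℂ) ^ (σ + v * I : ℂ)‖ = x ^ σ := by
    intro v; rw [norm_cpow_eq_rpow_re_of_pos hx, hre]
  have hF' : ∀ n : ℕ, n ≠ 0 → ∀ v, F n v = aa n * (((n / x : ℝ) : ℂ) ^ (-(σ + v * I)) *
      ker (σ + v * I)) := by
    intro n hn v
    have hn0 : (0:ℝ) < n := by positivity
    rw [hF]; simp only
    have e : (n:ℂ) ^ (σ + v * I : ℂ) = (x:ℂ) ^ (σ + v * I : ℂ) *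
        ((n / x : ℝ) : ℂ) ^ (σ + v * I : ℂ) := by
      rw [← Complex.mul_cpow_ofReal_nonneg hx.le (by positivity), ← ofReal_mul,
        mul_div_cancel₀ _ hx.ne', ofReal_natCast]
    have e2 : (x:ℂ) ^ (σ + v * I : ℂ) ≠ 0 := by
      rw [Complex.cpow_ne_zero_iff]; exact Or.inl hxc
    have e3 : ((n / x : ℝ) : ℂ) ^ (σ + v * I : ℂ) ≠ 0 := by
      rw [Complex.cpow_ne_zero_iff]; left; exact_mod_cast (div_pos hn0 hx).ne'
    rw [LSeries.term_of_ne_zero hn, e, cpow_neg]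
    field_simp
  have hnorm : ∀ n v, ‖F n v‖ = ‖LSeries.term (fun n => (aa n : ℂ)) σ n‖ * (x ^ σ * ‖ker (σ + v * I)‖) := by
    intro n v
    rw [hF]; simp only
    rw [norm_mul, norm_mul, hxn, norm_term_eq, norm_term_eq, hre, ofReal_re]
  have hint : ∀ n, Integrable (F n) := by
    intro n
    by_cases hn : n = 0
    · have : F n = fun _ => 0 := by funext v; simp [hF, hn]
      rw [this]; exact integrable_zero _ _ _
    · refine Integrable.mono' ((ker_int (by linarith : (1:ℝ)/2 ≤ σ)).norm.const_mul
        (‖LSeries.term (fun n => (aa n : ℂ)) σ n‖ * x ^ σ)) ?_ ?_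
      · have : F n = fun v : ℝ => (aa n : ℂ) * (((n / x : ℝ) : ℂ) ^ (-(σ + v * I)) *
          ker (σ + v * I)) := funext (hF' n hn)
        rw [this]
        refine (continuous_const.mul (Continuous.mul ?_ (ker_cont (by linarith)))).aestronglyMeasurable
        have hne : ((n / x : ℝ) : ℂ) ≠ 0 := by
          have : (0:ℝ) < n := by positivity
          exact_mod_cast (div_pos this hx).ne'
        exact Continuous.const_cpow (by fun_prop) (Or.inl hne)
      · refine Eventually.of_forall fun v => ?_
        rw [hnorm, mul_assoc]
  have hsum : Summable fun n => ∫ v, ‖F n v‖ := by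
    simp_rw [hnorm, integral_const_mul]
    refine Summable.mul_right _ ?_
    exact (aa_hasSum (s := (σ:ℂ)) (by simpa using hσ)).summable.norm
  have h1 := hasSum_integral_of_summable_integral_norm hint hsum
  have h2 : ∀ v, ∑' n, F n v = -(GG (σ + v * I) * (x:ℂ) ^ (σ + v * I : ℂ) * ker (σ + v * I)) := by
    intro v
    rw [hF]; simp only
    rw [tsum_mul_right, (aa_hasSum (by rw [hre]; exact hσ)).tsum_eq]; ring
  simp_rw [h2] at h1
  rw [← h1.tsum_eq, tsum_eq_sum (s := Finset.Icc 1 N)]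
  · rw [mul_sum]; push_cast
    refine sum_congr rfl fun n hn => ?_
    have hn1 := (mem_Icc.mp hn).1
    simp_rw [hF' n (by omega)]
    rw [integral_const_mul, perron_ker (by linarith) (by positivity)]
    push_cast; ring
  · intro n hn
    by_cases h0 : n = 0
    · simp [hF, h0]
    · have hn1 : N < n := by
        by_contra hc
        exact hn (mem_Icc.mpr ⟨by omega, by omega⟩)
      simp_rw [hF' n h0]
      have : (N:ℝ) < n := by exact_mod_cast hn1
      have : 1 ≤ n / x := by rw [le_div_iff₀ hx]; linarith
      rw [integral_const_mul, perron_ker (by linarith) (by positivity), max_eq_right (by linarith)]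
      simp


noncomputable def hh (x : ℝ) (s : ℂ) : ℂ := GG s * (x:ℂ) ^ s * ker s

lemma hh_norm {x σ v B : ℝ} (hx : 0 < x) (hσ : 1/2 ≤ σ) (hB : ‖GG (σ + v * I)‖ ≤ B) :
    ‖hh x (σ + v * I)‖ ≤ B * x ^ σ * (4 * (1 + v ^ 2)⁻¹) := by
  have hre : (σ + v * I : ℂ).re = σ := by simp
  rw [hh, norm_mul, norm_mul, norm_cpow_eq_rpow_re_of_pos hx, hre]
  have h0 : 0 ≤ B := (norm_nonneg _).trans hB
  gcongr
  exact ker_norm hσ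

lemma hh_diff {x : ℝ} (hx : 0 < x) {s : ℂ} (hs : 0 < s.re) (h : riemannZeta₁ s ≠ 0) :
    DifferentiableAt ℂ (hh x) s := by
  have a1 : s ≠ 0 := by rintro rfl; simp at hs
  have a2 : s + 1 ≠ 0 := by
    intro h; have := congrArg re h; simp at this; linarith
  have hxc : (x:ℂ) ≠ 0 := by exact_mod_cast hx.ne'
  unfold hh ker
  refine ((GG_contAt h).mul ?_).mul ?_
  · exact differentiableAt_id.const_cpow (Or.inl hxc)
  · exact (differentiableAt_const _).div (by fun_prop) (mul_ne_zero a1 a2)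

lemma arctan_le_self' {y : ℝ} (hy : 0 ≤ y) : arctan y ≤ y := by
  have := le_tan (arctan_nonneg.2 hy) (arctan_lt_pi_div_two y)
  rwa [tan_arctan] at this

lemma tail_int {Y : ℝ} (hY : 0 < Y) : ∫ v in Set.Ioi Y, (1 + v ^ 2)⁻¹ ≤ 1 / Y := by
  rw [integral_Ioi_inv_one_add_sq]
  have := arctan_inv_of_pos hY
  rw [← this, one_div]
  exact arctan_le_self' (by positivity)

lemma tail_int' {Y : ℝ} (hY : 0 < Y) : ∫ v in Set.Iic (-Y), (1 + v ^ 2)⁻¹ ≤ 1 / Y := by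
  rw [integral_Iic_inv_one_add_sq, arctan_neg]
  have := arctan_inv_of_pos hY
  have h2 := arctan_le_self' (by positivity : 0 ≤ Y⁻¹)
  rw [one_div]; linarith

lemma contour {x η T B D : ℝ} (hx : exp 1 ≤ x) (hη : 0 < η) (hη2 : η ≤ 1/2) (hT : 0 ≤ T) (hB0 : 0 ≤ B)
    (hB : ∀ s : ℂ, |s.im| ≤ exp T → 1 - η ≤ s.re → s.re ≤ 2 → riemannZeta₁ s ≠ 0 ∧ ‖GG s‖ ≤ B)
    (hD : ∀ s : ℂ, 1 < s.re → s.re ≤ 2 → ‖GG s‖ ≤ D / (s.re - 1)) {N : ℕ} (hN : x ≤ N) :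
    2 * π * |∑ n ∈ Finset.Icc 1 N, aa n * max (1 - n / x) 0| ≤
      2 * (D * log x * (exp 1 * x) * 4 * exp (-T)) + 2 * (B * (exp 1 * x) * 8 * exp (-T)) +
      B * x ^ (1 - η) * (4 * π) := by
  have hxp : 0 < x := (exp_pos _).trans_le hx
  have hlog : 1 ≤ log x := by rw [le_log_iff_exp_le hxp]; exact hx
  set b := 1 / log x with hb
  have hbp : 0 < b := by positivity
  have hb1 : b ≤ 1 := by rw [hb, div_le_one (by linarith)]; exact hlog
  have hxσ : x ^ (1 + b) = exp 1 * x := by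
    rw [rpow_add hxp, rpow_one, hb, rpow_def_of_pos hxp, mul_one_div_cancel (by linarith)]
    ring
  set Y := exp T with hY
  have hY1 : 1 ≤ Y := one_le_exp hT
  have hYi : exp (-T) = 1 / Y := by rw [exp_neg, one_div]
  have hre : ∀ σ v : ℝ, (σ + v * I : ℂ).re = σ := by intro σ v; simp
  have him : ∀ σ v : ℝ, (σ + v * I : ℂ).im = v := by intro σ v; simp
  have hP := perron (by linarith : 1 < 1 + b) hxp hN
  set S := ∑ n ∈ Finset.Icc 1 N, aa n * max (1 - n / x) 0 with hS
  have e0 : 2 * π * |S| = ‖((2 * π * S : ℝ) : ℂ)‖ := by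
    rw [norm_real, norm_eq_abs, abs_mul, abs_of_pos (by positivity : 0 < 2 * π)]
  rw [e0, hP, integral_neg, norm_neg]
  change ‖∫ v : ℝ, hh x ((1 + b : ℝ) + v * I)‖ ≤ _
  have hline : ∀ v : ℝ, ‖hh x ((1 + b : ℝ) + v * I)‖ ≤
      D * log x * (exp 1 * x) * (4 * (1 + v ^ 2)⁻¹) := by
    intro v
    rw [← hxσ]
    refine hh_norm hxp (by linarith) ?_
    refine (hD _ (by rw [hre]; linarith) (by rw [hre]; linarith)).trans (le_of_eq ?_)
    rw [hre, hb]; field_simp; ring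
  have hcont : Continuous fun v : ℝ => hh x ((1 + b : ℝ) + v * I) := by
    rw [continuous_iff_continuousAt]
    intro v
    have h1 := (hh_diff hxp (s := (1 + b : ℝ) + v * I) (by rw [hre]; linarith)
      (zeta1_ne_zero (by rw [hre]; linarith))).continuousAt
    exact ContinuousAt.comp (f := fun v : ℝ => (((1 + b : ℝ) + v * I : ℂ))) h1 (by fun_prop)
  have hI0 : Integrable fun v : ℝ => D * log x * (exp 1 * x) * (4 * (1 + v ^ 2)⁻¹) :=
    (integrable_inv_one_add_sq.const_mul 4).const_mul _
  have hI : Integrable fun v : ℝ => hh x ((1 + b : ℝ) + v * I) :=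
    Integrable.mono' hI0 hcont.aestronglyMeasurable (Eventually.of_forall hline)
  have hsplit : ∫ v : ℝ, hh x ((1 + b : ℝ) + v * I) =
      (∫ v in Set.Iic (-Y), hh x ((1 + b : ℝ) + v * I)) +
      (∫ v in (-Y)..Y, hh x ((1 + b : ℝ) + v * I)) +
      ∫ v in Set.Ioi Y, hh x ((1 + b : ℝ) + v * I) := by
    rw [← intervalIntegral.integral_Iic_add_Ioi (b := Y) hI.integrableOn hI.integrableOn]
    congr 1
    have := intervalIntegral.integral_Iic_sub_Iic (a := -Y) (b := Y) (f := fun v : ℝ => hh x ((1 + b : ℝ) + v * I))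
      hI.integrableOn hI.integrableOn
    rw [← this]; ring
  have hD0 : 0 ≤ D * log x * (exp 1 * x) := by
    have h1 := hline 0
    have h2 := (norm_nonneg _).trans h1
    norm_num at h2
    linarith
  have ht1 : ‖∫ v in Set.Ioi Y, hh x ((1 + b : ℝ) + v * I)‖ ≤
      D * log x * (exp 1 * x) * 4 * exp (-T) := by
    refine (norm_integral_le_of_norm_le hI0.integrableOn (Eventually.of_forall hline)).trans ?_
    rw [integral_const_mul, integral_const_mul, hYi, mul_assoc _ (4:ℝ)]
    gcongr
    exact tail_int (by linarith)
  have ht2 : ‖∫ v in Set.Iic (-Y), hh x ((1 + b : ℝ) + v * I)‖ ≤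
      D * log x * (exp 1 * x) * 4 * exp (-T) := by
    refine (norm_integral_le_of_norm_le hI0.integrableOn (Eventually.of_forall hline)).trans ?_
    rw [integral_const_mul, integral_const_mul, hYi, mul_assoc _ (4:ℝ)]
    gcongr
    exact tail_int' (by linarith)
  have hrect := Complex.integral_boundary_rect_eq_zero_of_differentiableOn (hh x)
    ((1 - η : ℝ) + (-Y : ℝ) * I) ((1 + b : ℝ) + (Y : ℝ) * I) (by
      intro s hs
      rw [hre, hre, him, him, mem_reProdIm, Set.uIcc_of_le (by linarith),
        Set.uIcc_of_le (by linarith)] at hs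
      obtain ⟨⟨s1, s2⟩, s3, s4⟩ := hs
      exact (hh_diff hxp (by linarith) (hB s (abs_le.mpr ⟨s3, s4⟩) s1 (by linarith)).1).differentiableWithinAt)
  simp only [hre, him] at hrect
  have hhor : ∀ y : ℝ, |y| = Y → ‖∫ u in (1 - η)..(1 + b), hh x (u + y * I)‖ ≤
      B * (exp 1 * x) * 8 * exp (-T) := by
    intro y hy
    have := intervalIntegral.norm_integral_le_of_norm_le_const (a := 1 - η) (b := 1 + b)
      (f := fun u : ℝ => hh x (u + y * I)) (C := B * (exp 1 * x) * (4 * exp (-T))) (by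
        intro u hu
        rw [Set.uIoc_of_le (by linarith)] at hu
        obtain ⟨u1, u2⟩ := hu
        refine (hh_norm hxp (by linarith) (hB _ (by rw [him]; exact hy.le) (by rw [hre]; exact u1.le)
          (by rw [hre]; linarith)).2).trans ?_
        rw [← hxσ, hYi]
        gcongr
        · linarith [add_one_le_exp 1]
        · rw [one_div]
          apply inv_anti₀ (by linarith)
          rw [← sq_abs, hy]; nlinarith)
    refine this.trans ?_
    rw [abs_of_pos (by linarith)]
    have hp : 0 ≤ B * (exp 1 * x) * (4 * exp (-T)) := by positivity
    nlinarith
  have hleft : ‖∫ v in (-Y)..Y, hh x ((1 - η : ℝ) + v * I)‖ ≤ B * x ^ (1 - η) * (4 * π) := by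
    have := intervalIntegral.norm_integral_le_of_norm_le (a := -Y) (b := Y) (μ := volume)
      (f := fun v : ℝ => hh x ((1 - η : ℝ) + v * I))
      (g := fun v : ℝ => B * x ^ (1 - η) * (4 * (1 + v ^ 2)⁻¹)) (by linarith) (by
        refine Eventually.of_forall fun v hv => ?_
        exact hh_norm hxp (by linarith) (hB _ (by rw [him]; exact abs_le.mpr ⟨hv.1.le, hv.2⟩)
          (by rw [hre]) (by rw [hre]; linarith)).2)
        ((integrable_inv_one_add_sq.const_mul 4).const_mul _).intervalIntegrable
    refine this.trans ?_
    rw [intervalIntegral.integral_const_mul, intervalIntegral.integral_const_mul, integral_inv_one_add_sq]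
    gcongr
    have h1 := arctan_lt_pi_div_two Y
    have h2 := neg_pi_div_two_lt_arctan (-Y)
    linarith
  have hb1' := hhor (-Y) (by rw [abs_neg, abs_of_pos (by linarith)])
  have hb2' := hhor Y (abs_of_pos (by linarith))
  set Ib := ∫ u in (1 - η)..(1 + b), hh x (u + (-Y : ℝ) * I) with hIb
  set It := ∫ u in (1 - η)..(1 + b), hh x (u + (Y : ℝ) * I) with hIt
  set Ir := ∫ v in (-Y)..Y, hh x ((1 + b : ℝ) + v * I) with hIr
  set Il := ∫ v in (-Y)..Y, hh x ((1 - η : ℝ) + v * I) with hIl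
  have hr : ‖Ir‖ ≤ ‖Il‖ + ‖It‖ + ‖Ib‖ := by
    have e : I * Ir = I * Il + It - Ib := by
      simp only [smul_eq_mul] at hrect
      linear_combination hrect
    have e2 : ‖I * Ir‖ = ‖Ir‖ := by simp
    rw [← e2, e]
    refine (norm_sub_le _ _).trans ?_
    gcongr
    refine (norm_add_le _ _).trans ?_
    simp
  rw [hsplit]
  refine (norm_add_le _ _).trans ?_
  have := norm_add_le (∫ v in Set.Iic (-Y), hh x ((1 + b : ℝ) + v * I)) Ir
  linarith

theorem S_bound {α : ℝ} (h1 : 1/2 < α) (h2 : α < 3/5) : ∃ C > 0, ∀ᶠ x : ℝ in atTop, ∀ N : ℕ, x ≤ N →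
    |∑ n ∈ Finset.Icc 1 N, aa n * max (1 - n / x) 0| ≤ C * x * log x * exp (-(log x) ^ α) := by
  set θ := 1 / α - 1 with hθ
  have hα0 : 0 < α := by linarith
  have hθα : α * θ = 1 - α := by rw [hθ]; field_simp
  have hθ1 : 2/3 < θ := by
    have : 5/3 < 1/α := by rw [lt_div_iff₀ hα0]; linarith
    linarith
  have hθ2 : θ < 1 := by
    have : 1/α < 2 := by rw [div_lt_iff₀ hα0]; linarith
    linarith
  obtain ⟨C, hC, hG⟩ := GG_bound hθ1 hθ2
  obtain ⟨D, hD, hR⟩ := GG_right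
  have hlim : Tendsto (fun x : ℝ => (log x) ^ α) atTop atTop :=
    (tendsto_rpow_atTop hα0).comp tendsto_log_atTop
  refine ⟨8 * D * exp 1 + 16 * C * exp 1 + 4 * π * C, by positivity, ?_⟩
  filter_upwards [hlim.eventually hG, hlim.eventually (ev_rpow (by linarith : -θ < 0) 2),
    eventually_ge_atTop (exp 1)] with x hB hη hx N hN
  have hxp : 0 < x := (exp_pos _).trans_le hx
  have hlog : 1 ≤ log x := by rw [le_log_iff_exp_le hxp]; exact hx
  set T := (log x) ^ α with hT
  have hTp : 0 < T := by positivity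
  have hTl : T ≤ log x := by
    calc T ≤ (log x) ^ (1:ℝ) := rpow_le_rpow_of_exponent_le hlog (by linarith)
      _ = _ := rpow_one _
  rw [rpow_zero] at hη
  have key := contour hx (by positivity : 0 < T ^ (-θ)) (by linarith) hTp.le
    (by positivity : 0 ≤ C * T) hB hR hN
  have ex : x ^ (1 - T ^ (-θ)) = x * exp (-T) := by
    rw [sub_eq_add_neg, rpow_add hxp, rpow_one]
    congr 1
    rw [rpow_def_of_pos hxp]
    congr 1
    rw [mul_neg]
    congr 1
    have : T ^ (-θ) = (log x) ^ (α - 1) := by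
      rw [hT, ← rpow_mul (by linarith), show α * -θ = α - 1 by linarith]
    rw [this, hT, rpow_sub_one (by linarith)]
    field_simp
  rw [ex] at key
  have hπ : 1 ≤ 2 * π := by linarith [pi_gt_three]
  have hE : 0 < exp (-T) := exp_pos _
  set A := |∑ n ∈ Finset.Icc 1 N, aa n * max (1 - n / x) 0|
  have hA : 0 ≤ A := abs_nonneg _
  have : A ≤ 2 * π * A := by nlinarith
  refine this.trans (key.trans ?_)
  have e1 : C * T * (exp 1 * x) * 8 * exp (-T) ≤ C * log x * (exp 1 * x) * 8 * exp (-T) := by gcongr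
  have e2 : C * T * (x * exp (-T)) * (4 * π) ≤ C * log x * (x * exp (-T)) * (4 * π) := by gcongr
  nlinarith only [e1, e2]


noncomputable def S1 (N : ℕ) (y : ℝ) : ℝ := ∑ n ∈ Finset.Icc 1 N, aa n * max (y - n) 0

lemma psi_if {u : ℝ} {N : ℕ} (hu : u ≤ N) (f : ℕ → ℝ) :
    ∑ n ∈ Finset.Icc 1 ⌊u⌋₊, f n = ∑ n ∈ Finset.Icc 1 N, if (n:ℝ) ≤ u then f n else 0 := by
  rw [← sum_filter]
  apply sum_congr _ (fun _ _ => rfl)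
  ext n
  simp only [mem_Icc, mem_filter]
  constructor
  · rintro ⟨h1, h2⟩
    have := (Nat.le_floor_iff' (by omega)).1 h2
    exact ⟨⟨h1, by exact_mod_cast this.trans hu⟩, this⟩
  · rintro ⟨⟨h1, h2⟩, h3⟩
    exact ⟨h1, Nat.le_floor h3⟩

lemma psi_Icc (u : ℝ) : psi u = ∑ n ∈ Finset.Icc 1 ⌊u⌋₊, vonMangoldt n := by
  rw [psi]; rfl

lemma desmooth {u v : ℝ} (hu : 0 ≤ u) (huv : u ≤ v) {N : ℕ} (hN : v ≤ N) :
    (v - u) * psi u ≤ S1 N v - S1 N u + (v - u) * v ∧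
    S1 N v - S1 N u + (v - u) * (u - 1) ≤ (v - u) * psi v := by
  set d : ℕ → ℝ := fun n => max (v - n) 0 - max (u - n) 0 with hd
  have hS : S1 N v - S1 N u = ∑ n ∈ Finset.Icc 1 N, vonMangoldt n * d n -
      ∑ n ∈ Finset.Icc 1 N, d n := by
    rw [S1, S1, ← sum_sub_distrib, ← sum_sub_distrib]
    apply sum_congr rfl
    intro n _
    simp only [aa, hd]; ring
  have hΛ : ∀ n : ℕ, 0 ≤ vonMangoldt n := fun n => vonMangoldt_nonneg
  have d0 : ∀ n, 0 ≤ d n := fun n => by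
    simp only [hd, sub_nonneg]; exact max_le_max (by linarith) le_rfl
  have d1 : ∀ n, d n ≤ v - u := fun n => by
    simp only [hd]
    have : max (v - n) 0 ≤ max (u - n) 0 + (v - u) := by
      apply max_le
      · have := le_max_left (u - n) 0; linarith
      · have := le_max_right (u - n) 0; linarith
    linarith
  have d2 : ∀ n : ℕ, (n:ℝ) ≤ u → d n = v - u := fun n h => by
    simp only [hd]; rw [max_eq_left (by linarith), max_eq_left (by linarith)]; ring
  have d3 : ∀ n : ℕ, ¬ (n:ℝ) ≤ v → d n = 0 := fun n h => by
    push Not at h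
    simp only [hd]; rw [max_eq_right (by linarith), max_eq_right (by linarith)]; ring
  have c : ∀ w : ℝ, ∑ n ∈ Finset.Icc 1 ⌊w⌋₊, (v - u) = (v - u) * ⌊w⌋₊ := fun w => by
    rw [sum_const, Nat.card_Icc]; simp [mul_comm]; try ring
  have huN : u ≤ N := huv.trans hN
  constructor
  · have e1 : (v - u) * psi u ≤ ∑ n ∈ Finset.Icc 1 N, vonMangoldt n * d n := by
      rw [psi_Icc, mul_sum, psi_if huN]
      apply sum_le_sum
      intro n _
      split_ifs with h
      · rw [d2 n h, mul_comm]
      · exact mul_nonneg (hΛ n) (d0 n)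
    have e2 : ∑ n ∈ Finset.Icc 1 N, d n ≤ (v - u) * ⌊v⌋₊ := by
      rw [← c, psi_if hN]
      apply sum_le_sum
      intro n _
      split_ifs with h
      · exact d1 n
      · exact (d3 n h).le
    have e3 : (v - u) * ⌊v⌋₊ ≤ (v - u) * v :=
      mul_le_mul_of_nonneg_left (Nat.floor_le (hu.trans huv)) (by linarith)
    linarith
  · have e1 : ∑ n ∈ Finset.Icc 1 N, vonMangoldt n * d n ≤ (v - u) * psi v := by
      rw [psi_Icc, mul_sum, psi_if hN]
      apply sum_le_sum
      intro n _
      split_ifs with h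
      · rw [mul_comm]; exact mul_le_mul_of_nonneg_right (d1 n) (hΛ n)
      · rw [d3 n h, mul_zero]
    have e2 : (v - u) * ⌊u⌋₊ ≤ ∑ n ∈ Finset.Icc 1 N, d n := by
      rw [← c, psi_if huN]
      apply sum_le_sum
      intro n _
      split_ifs with h
      · exact (d2 n h).ge
      · exact d0 n
    have e3 : (v - u) * (u - 1) ≤ (v - u) * ⌊u⌋₊ :=
      mul_le_mul_of_nonneg_left (by have := Nat.lt_floor_add_one u; linarith) (by linarith)
    linarith

lemma S1_bound {β : ℝ} (h1 : 1/2 < β) (h2 : β < 3/5) : ∀ᶠ y : ℝ in atTop, ∀ N : ℕ, y ≤ N →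
    |S1 N y| ≤ y ^ 2 * exp (-(8 * (log y) ^ β)) := by
  obtain ⟨α, ha, hb⟩ := exists_between h2
  obtain ⟨C, hC, hS⟩ := S_bound (by linarith : 1/2 < α) hb
  filter_upwards [hS, tendsto_log_atTop.eventually (ev_rpow ha 9),
    tendsto_log_atTop.eventually (ev_exp (by linarith : 0 < β) 1 C), eventually_gt_atTop 1]
    with y hS e1 e2 hy N hN
  have hy0 : 0 < y := by linarith
  have e : S1 N y = y * ∑ n ∈ Finset.Icc 1 N, aa n * max (1 - n / y) 0 := by
    rw [S1, mul_sum]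
    apply sum_congr rfl
    intro n _
    have : max (y - n) 0 = y * max (1 - n / y) 0 := by
      rw [mul_max_of_nonneg _ _ hy0.le]; congr 1
      · field_simp
      · simp
    rw [this]; ring
  rw [e, abs_mul, abs_of_pos hy0]
  rw [rpow_one] at e2
  calc y * |∑ n ∈ Finset.Icc 1 N, aa n * max (1 - n / y) 0|
      ≤ y * (C * y * log y * exp (-(log y) ^ α)) := by gcongr; exact hS N hN
    _ = y ^ 2 * ((C * log y) * exp (-(log y) ^ α)) := by ring
    _ ≤ y ^ 2 * (exp (log y ^ β) * exp (-(log y) ^ α)) := by gcongr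
    _ ≤ _ := by
      rw [← Real.exp_add]; gcongr; linarith

set_option maxHeartbeats 1000000 in
theorem theta_bound {β : ℝ} (h1 : 1/2 < β) (h2 : β < 3/5) : ∀ᶠ x : ℝ in atTop,
    |theta x - x| ≤ x * exp (-(log x) ^ β) := by
  obtain ⟨y₀, hy₀⟩ := eventually_atTop.1 (S1_bound h1 h2)
  have hβ : 0 < β := by linarith
  filter_upwards [eventually_ge_atTop (2 * y₀), eventually_ge_atTop 4,
    tendsto_log_atTop.eventually (ev_rpow (by linarith : β < 1) 8),
    tendsto_log_atTop.eventually (ev_exp hβ 1 4),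
    tendsto_log_atTop.eventually (ev_exp hβ 0 40)] with x hx hx4 e1 e2 e3
  rw [rpow_one] at e1 e2
  rw [rpow_zero, mul_one] at e3
  set T := log x with hT
  set L := T ^ β with hL
  have hx0 : 0 < x := by linarith
  have hxe : x = exp T := by rw [hT, exp_log hx0]
  have hT0 : 0 < T := log_pos (by linarith)
  have hL0 : 0 < L := by positivity
  set q := exp (-L) with hq
  have hq0 : 0 < q := exp_pos _
  have hqi : q * exp L = 1 := by rw [hq, ← Real.exp_add]; simp
  have hq40 : 40 * q ≤ 1 := by nlinarith only [hqi, e3, hq0]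
  have hlog : T / 2 ≤ log (x / 2) := by
    rw [log_div hx0.ne' two_ne_zero, ← hT]
    have : 2 * log 2 ≤ T := by
      have e : (2:ℝ) * log 2 = log 4 := by
        rw [show (4:ℝ) = 2 ^ 2 by norm_num, log_pow]; norm_num
      rw [e]; exact log_le_log (by norm_num) hx4
    linarith
  have hS : ∀ y, x / 2 ≤ y → y ≤ 2 * x → ∀ N : ℕ, y ≤ N → |S1 N y| ≤ 4 * x ^ 2 * q ^ 4 := by
    intro y ha hb N hN
    refine (hy₀ y (by linarith) N hN).trans ?_
    have hl : T / 2 ≤ log y := hlog.trans (log_le_log (by linarith) ha)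
    have : L / 2 ≤ log y ^ β := by
      calc L / 2 ≤ (1/2:ℝ) ^ β * L := by
            have : (1/2:ℝ) ^ (1:ℝ) ≤ (1/2:ℝ) ^ β :=
              rpow_le_rpow_of_exponent_ge (by norm_num) (by norm_num) (by linarith)
            rw [rpow_one] at this
            nlinarith only [this, hL0]
        _ = (T / 2) ^ β := by
            rw [hL, ← mul_rpow (by norm_num) hT0.le]; congr 1; ring
        _ ≤ _ := by gcongr
    have hq4 : q ^ 4 = exp (-(4 * L)) := by rw [hq, ← exp_nat_mul]; congr 1; push_cast; ring
    rw [hq4]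
    have : y ^ 2 ≤ 4 * x ^ 2 := by nlinarith only [ha, hb, hx0]
    refine mul_le_mul this (exp_le_exp.2 (by linarith)) (exp_pos _).le (by positivity)
  have hh0 : 0 < x * q ^ 2 := by positivity
  have hhx : x * q ^ 2 ≤ x / 2 := by
    have : q ^ 2 ≤ 1 / 2 := by nlinarith only [hq40, hq0]
    nlinarith only [this, hx0]
  have hpsi : |psi x - x| ≤ 9 * x * q ^ 2 + 1 := by
    set N := ⌈x + x * q ^ 2⌉₊
    have hN : x + x * q ^ 2 ≤ N := Nat.le_ceil _
    have A := (desmooth hx0.le (by linarith : x ≤ x + x * q ^ 2) hN).1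
    have B := (desmooth (by linarith : 0 ≤ x - x * q ^ 2) (by linarith : x - x * q ^ 2 ≤ x)
      (by linarith : x ≤ (N:ℝ))).2
    have s1 := abs_le.1 (hS (x + x * q ^ 2) (by linarith) (by linarith) N hN)
    have s2 := abs_le.1 (hS x (by linarith) (by linarith) N (by linarith))
    have s3 := abs_le.1 (hS (x - x * q ^ 2) (by linarith) (by linarith) N (by linarith))
    have hq4 : 4 * x ^ 2 * q ^ 4 = (x * q ^ 2) * (4 * x * q ^ 2) := by ring
    rw [hq4] at s1 s2 s3
    rw [show x + x * q ^ 2 - x = x * q ^ 2 by ring] at A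
    rw [show x - (x - x * q ^ 2) = x * q ^ 2 by ring] at B
    have A' : (x * q ^ 2) * psi x ≤ (x * q ^ 2) * (x + 9 * x * q ^ 2) := by nlinarith only [A, s1, s2]
    have B' : (x * q ^ 2) * (x - 9 * x * q ^ 2 - 1) ≤ (x * q ^ 2) * psi x := by
      nlinarith only [B, s2, s3]
    have A2 := le_of_mul_le_mul_left A' hh0
    have B2 := le_of_mul_le_mul_left B' hh0
    rw [abs_le]; constructor <;> linarith
  have hpt := Chebyshev.abs_psi_sub_theta_le_sqrt_mul_log (x := x) (by linarith)
  have hsq : √x = exp (T / 2) := by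
    rw [sqrt_eq_rpow, hxe, ← exp_mul]; congr 1; ring
  have hr : 2 * √x * T ≤ x * q / 2 := by
    have : 4 * T * exp (T / 2) ≤ x * q := by
      calc 4 * T * exp (T / 2) ≤ exp L * exp (T / 2) := by gcongr
        _ = exp (L + T / 2) := by rw [Real.exp_add]
        _ ≤ exp (T - L) := by gcongr; linarith
        _ = x * q := by rw [hxe, hq, ← Real.exp_add]; ring_nf
    rw [hsq]; linarith
  have hxq : 4 ≤ x * q := by
    have : 8 * x * q ≥ 8 * exp L := by
      have : exp L ≤ x * q := by
        rw [hxe, hq, ← Real.exp_add]; gcongr; linarith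
      linarith
    linarith
  have hf : 9 * x * q ^ 2 ≤ 9 / 40 * (x * q) := by nlinarith only [hq40, hq0, mul_pos hx0 hq0]
  rw [abs_le] at *
  constructor <;> linarith [hpt.1, hpt.2, hpsi.1, hpsi.2]


lemma fr_int (x : ℝ) {a b : ℝ} (ha : 2 ≤ a) (hab : a ≤ b) :
    IntervalIntegrable (fun t => Int.fract (x / t) / log t) volume a b := by
  rw [intervalIntegrable_iff_integrableOn_Ioc_of_le hab]
  refine Measure.integrableOn_of_bounded (M := 1 / log 2) (by simp) ?_ ?_
  · apply Measurable.aestronglyMeasurable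
    exact (measurable_fract.comp (measurable_const.div measurable_id)).div measurable_log
  · filter_upwards [ae_restrict_mem measurableSet_Ioc] with t ht
    have h2 : 0 < log 2 := log_pos (by norm_num)
    have ht2 : log 2 ≤ log t := log_le_log (by norm_num) (by linarith [ht.1])
    rw [norm_div, norm_eq_abs, norm_eq_abs, abs_of_nonneg (Int.fract_nonneg _),
      abs_of_pos (by linarith)]
    exact div_le_div₀ zero_le_one (Int.fract_lt_one _).le h2 ht2

lemma abel_piece {a b K M : ℝ} {g g1 : ℝ → ℝ} (ha : 0 < a) (hab : a ≤ b)
    (hd : ∀ t ∈ Set.Icc a b, HasDerivAt g (g1 t) t) (hc : ContinuousOn g1 (Set.Icc a b))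
    (hM : ∀ t ∈ Set.Icc a b, |theta t - t| ≤ M)
    (h1 : ∀ t ∈ Set.Icc a b, |g t| ≤ 1) (h2 : ∀ t ∈ Set.Icc a b, |g1 t| ≤ K) :
    |∑ p ∈ (Finset.Ioc ⌊a⌋₊ ⌊b⌋₊).filter Nat.Prime, g p * log p - ∫ t in a..b, g t| ≤
      2 * M + K * M * (b - a) := by
  set c : ℕ → ℝ := fun p => if p.Prime then log p else 0 with hcd
  have hθ : ∀ t : ℝ, ∑ k ∈ Finset.Icc 0 ⌊t⌋₊, c k = theta t := fun t => by
    rw [Chebyshev.theta_eq_sum_Icc, sum_filter]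
  have hde : ∀ t ∈ Set.Icc a b, deriv g t = g1 t := fun t ht => (hd t ht).deriv
  have hA := sum_mul_eq_sub_sub_integral_mul c ha.le hab (fun t ht => (hd t ht).differentiableAt)
    ((hc.congr hde).integrableOn_Icc)
  have hs : ∑ p ∈ (Finset.Ioc ⌊a⌋₊ ⌊b⌋₊).filter Nat.Prime, g p * log p =
      ∑ k ∈ Finset.Ioc ⌊a⌋₊ ⌊b⌋₊, g k * c k := by
    rw [sum_filter]
    apply sum_congr rfl
    intro p _
    simp only [hcd]; split_ifs <;> simp
  have hI : ∫ t in Set.Ioc a b, deriv g t * ∑ k ∈ Finset.Icc 0 ⌊t⌋₊, c k =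
      ∫ t in a..b, g1 t * theta t := by
    rw [integral_of_le hab]
    apply setIntegral_congr_fun measurableSet_Ioc
    intro t ht
    simp only [hθ]
    rw [hde t ⟨ht.1.le, ht.2⟩]
  have hc' : ContinuousOn g1 (Set.uIcc a b) := by rwa [Set.uIcc_of_le hab]
  have hB := intervalIntegral.integral_mul_deriv_eq_deriv_mul (a := a) (b := b) (u := g) (u' := g1)
    (v := fun t => t) (v' := fun _ => 1) (by rwa [Set.uIcc_of_le hab]) (fun t _ => hasDerivAt_id t)
    hc'.intervalIntegrable (by simp)
  simp only [mul_one] at hB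
  have i1 : IntervalIntegrable (fun t => g1 t * theta t) volume a b :=
    (Chebyshev.theta_mono.intervalIntegrable).continuousOn_mul hc'
  have i2 : IntervalIntegrable (fun t => g1 t * t) volume a b :=
    (hc'.mul continuousOn_id).intervalIntegrable
  have hR : ∫ t in a..b, g1 t * (theta t - t) =
      (∫ t in a..b, g1 t * theta t) - ∫ t in a..b, g1 t * t := by
    rw [← intervalIntegral.integral_sub i1 i2]
    congr 1; ext t; ring
  have hn : ‖∫ t in a..b, g1 t * (theta t - t)‖ ≤ K * M * |b - a| := by
    apply intervalIntegral.norm_integral_le_of_norm_le_const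
    intro t ht
    rw [Set.uIoc_of_le hab] at ht
    have ht' : t ∈ Set.Icc a b := ⟨ht.1.le, ht.2⟩
    rw [norm_mul]
    exact mul_le_mul (h2 t ht') (hM t ht') (norm_nonneg _) ((abs_nonneg _).trans (h2 t ht'))
  rw [abs_of_nonneg (by linarith : 0 ≤ b - a), norm_eq_abs] at hn
  rw [hs, hA, hI, hθ, hθ, hB]
  have key : g b * theta b - g a * theta a - (∫ t in a..b, g1 t * theta t) -
      (g b * b - g a * a - ∫ t in a..b, g1 t * t) =
      g b * (theta b - b) - g a * (theta a - a) -
        ∫ t in a..b, g1 t * (theta t - t) := by rw [hR]; ring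
  rw [key]
  have q : ∀ t ∈ Set.Icc a b, |g t * (theta t - t)| ≤ M := fun t ht => by
    rw [abs_mul]
    have := h1 t ht
    have := hM t ht
    nlinarith [abs_nonneg (g t), abs_nonneg (theta t - t)]
  have qa := abs_le.1 (q a ⟨le_rfl, hab⟩)
  have qb := abs_le.1 (q b ⟨hab, le_rfl⟩)
  have hn := abs_le.1 hn
  rw [abs_le]
  constructor <;> linarith [qa.1, qa.2, qb.1, qb.2, hn.1, hn.2]

lemma piece {x E : ℝ} {n : ℕ} (hn : 1 ≤ n) (hx : 3 ≤ x / (n + 1)) (hE : 0 ≤ E)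
    (hθ : ∀ t, x / (n + 1) ≤ t → |theta t - t| ≤ E * t) :
    |∑ p ∈ (Finset.Ioc ⌊x / (n + 1)⌋₊ ⌊x / n⌋₊).filter Nat.Prime, Int.fract (x / p) -
      ∫ t in (x / (n + 1))..(x / n), Int.fract (x / t) / log t| ≤ 6 * E * x * (1 / n) := by
  have hn1 : (1:ℝ) ≤ n := by exact_mod_cast hn
  have hn0 : (0:ℝ) < n := by linarith
  have hx0 : 0 < x := by
    by_contra h
    have : x / (n + 1) ≤ 0 := div_nonpos_of_nonpos_of_nonneg (by linarith) (by linarith)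
    linarith
  set a := x / (n + 1) with ha
  set b := x / n with hb
  have hab : a ≤ b := by rw [ha, hb]; gcongr; linarith
  have ha0 : 0 < a := by linarith
  have hfr : ∀ t, a < t → t ≤ b → Int.fract (x / t) = x / t - n := by
    intro t h1 h2
    have ht0 : 0 < t := by linarith
    rw [Int.fract_eq_iff]
    refine ⟨?_, ?_, n, by push_cast; ring⟩
    · rw [hb, le_div_iff₀ hn0] at h2
      rw [sub_nonneg, le_div_iff₀ ht0]; linarith
    · rw [ha, div_lt_iff₀ (by linarith)] at h1
      rw [sub_lt_iff_lt_add, div_lt_iff₀ ht0]; linarith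
  have hb01 : ∀ t ∈ Set.Icc a b, 0 ≤ x / t - n ∧ x / t - n ≤ 1 := by
    rintro t ⟨h1, h2⟩
    have ht0 : 0 < t := by linarith
    constructor
    · rw [hb, le_div_iff₀ hn0] at h2
      rw [sub_nonneg, le_div_iff₀ ht0]; linarith
    · rw [ha, div_le_iff₀ (by linarith)] at h1
      rw [sub_le_iff_le_add, div_le_iff₀ ht0]; linarith
  have hlog : ∀ t ∈ Set.Icc a b, 1 ≤ log t := by
    rintro t ⟨h1, h2⟩
    rw [le_log_iff_exp_le (by linarith)]
    linarith [exp_one_lt_d9]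
  set g : ℝ → ℝ := fun t => (x / t - n) / log t with hg
  set g1 : ℝ → ℝ := fun t => (-(x / t ^ 2) * log t - (x / t - n) * t⁻¹) / (log t) ^ 2 with hg1
  have hd : ∀ t ∈ Set.Icc a b, HasDerivAt g (g1 t) t := by
    intro t ht
    have ht0 : t ≠ 0 := by linarith [ht.1]
    have hl := hlog t ht
    have e1 : HasDerivAt (fun t => x / t - n) (-(x / t ^ 2)) t := by
      have := ((hasDerivAt_inv ht0).const_mul x).sub_const (n:ℝ)
      have e : -(x / t ^ 2) = x * -(t ^ 2)⁻¹ := by rw [div_eq_mul_inv]; ring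
      rw [e]
      simpa only [div_eq_mul_inv] using this
    exact e1.div (hasDerivAt_log ht0) (by linarith)
  have hc : ContinuousOn g1 (Set.Icc a b) := by
    intro t ht
    have ht0 : t ≠ 0 := by linarith [ht.1]
    have hl : log t ^ 2 ≠ 0 := by have := hlog t ht; positivity
    apply ContinuousAt.continuousWithinAt
    have e2 : t ^ 2 ≠ 0 := pow_ne_zero 2 ht0
    simp only [hg1]
    fun_prop (disch := assumption)
  have h1 : ∀ t ∈ Set.Icc a b, |g t| ≤ 1 := by
    intro t ht
    have hl := hlog t ht
    obtain ⟨u, v⟩ := hb01 t ht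
    simp only [hg]
    rw [abs_of_nonneg (by positivity), div_le_one (by linarith)]; linarith
  have h2 : ∀ t ∈ Set.Icc a b, |g1 t| ≤ 2 * x / a ^ 2 := by
    intro t ht
    have hl := hlog t ht
    obtain ⟨u, v⟩ := hb01 t ht
    have ht0 : 0 < t := by linarith [ht.1]
    have htx : t ≤ x := ht.2.trans (by rw [hb]; exact div_le_self hx0.le hn1)
    simp only [hg1]
    rw [abs_div, abs_of_pos (by positivity : 0 < log t ^ 2), div_le_iff₀ (by positivity)]
    have w1 : (x / t - n) * t⁻¹ ≤ x / t ^ 2 := by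
      calc (x / t - n) * t⁻¹ ≤ 1 * t⁻¹ := by gcongr
        _ = t / t ^ 2 := by field_simp
        _ ≤ _ := by gcongr
    have w0 : 0 ≤ (x / t - n) * t⁻¹ := by positivity
    have w2 : x / t ^ 2 ≤ x / a ^ 2 := by gcongr; exact ht.1
    have w3 : 0 < x / t ^ 2 := by positivity
    have w4 : log t ≤ log t ^ 2 := by nlinarith
    have w5 : 1 ≤ log t ^ 2 := by nlinarith
    calc |-(x / t ^ 2) * log t - (x / t - n) * t⁻¹|
        = x / t ^ 2 * log t + (x / t - n) * t⁻¹ := by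
          rw [abs_of_nonpos (by nlinarith)]; ring
      _ ≤ x / t ^ 2 * log t ^ 2 + x / t ^ 2 * log t ^ 2 := by nlinarith
      _ = 2 * (x / t ^ 2) * log t ^ 2 := by ring
      _ ≤ 2 * (x / a ^ 2) * log t ^ 2 := by gcongr
      _ = _ := by ring
  have hM : ∀ t ∈ Set.Icc a b, |theta t - t| ≤ E * b := by
    intro t ht
    exact (hθ t ht.1).trans (by gcongr; exact ht.2)
  have key := abel_piece ha0 hab hd hc hM h1 h2
  have es : ∑ p ∈ (Finset.Ioc ⌊a⌋₊ ⌊b⌋₊).filter Nat.Prime, Int.fract (x / p) =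
      ∑ p ∈ (Finset.Ioc ⌊a⌋₊ ⌊b⌋₊).filter Nat.Prime, g p * log p := by
    apply sum_congr rfl
    intro p hp
    simp only [mem_filter, mem_Ioc] at hp
    have p1 : a < p := (Nat.floor_lt ha0.le).1 hp.1.1
    have p2 : (p:ℝ) ≤ b := (Nat.le_floor_iff (by linarith)).1 hp.1.2
    have := hlog p ⟨p1.le, p2⟩
    rw [hfr p p1 p2]
    simp only [hg]; field_simp
  have ei : ∫ t in a..b, Int.fract (x / t) / log t = ∫ t in a..b, g t := by
    rw [integral_of_le hab, integral_of_le hab]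
    apply setIntegral_congr_fun measurableSet_Ioc
    intro t ht
    simp only [hg]; rw [hfr t ht.1 ht.2]
  rw [es, ei]
  refine key.trans ?_
  have : 2 * x / a ^ 2 * (b - a) ≤ 4 := by
    have : 2 * x / a ^ 2 * (b - a) = 2 * ((n + 1) / n) := by
      rw [ha, hb]; field_simp; ring
    rw [this]
    have : ((n:ℝ) + 1) / n ≤ 2 := by rw [div_le_iff₀ hn0]; linarith
    linarith
  have hEb : 0 ≤ E * b := by have : 0 ≤ b := by linarith
                             positivity
  have eb : E * x * (1 / n) = E * b := by rw [hb]; ring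
  nlinarith

lemma pieces {x E : ℝ} {N : ℕ} (hx : 3 ≤ x / (N + 1)) (hE : 0 ≤ E)
    (hθ : ∀ t, x / (N + 1) ≤ t → |theta t - t| ≤ E * t) (m : ℕ) (hm : m ≤ N) :
    |∑ p ∈ (Finset.Ioc ⌊x / (m + 1)⌋₊ ⌊x⌋₊).filter Nat.Prime, Int.fract (x / p) -
      ∫ t in (x / (m + 1))..x, Int.fract (x / t) / log t| ≤
      6 * E * x * ∑ n ∈ Finset.Icc 1 m, 1 / (n:ℝ) := by
  have hx0 : 0 < x := by
    by_contra h
    have : x / (N + 1) ≤ 0 := div_nonpos_of_nonpos_of_nonneg (by linarith) (by positivity)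
    linarith
  induction m with
  | zero => simp
  | succ m ih =>
    have ih := ih (by omega)
    have hmN : ((m + 1 : ℕ) : ℝ) ≤ N := by exact_mod_cast hm
    have hl : x / (N + 1) ≤ x / ((m + 1 : ℕ) + 1) := by gcongr
    have hp := piece (x := x) (E := E) (n := m + 1) (by omega) (hx.trans hl) hE
      (fun t ht => hθ t (hl.trans ht))
    have e1 : x / ((m + 1 : ℕ) + 1) ≤ x / ((m + 1 : ℕ):ℝ) := by gcongr; linarith
    have e2 : x / ((m + 1 : ℕ):ℝ) ≤ x := div_le_self hx0.le (by push_cast; linarith [Nat.cast_nonneg (α := ℝ) m])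
    rw [show (m:ℝ) + 1 = ((m + 1 : ℕ):ℝ) by push_cast; ring] at ih
    rw [Finset.sum_Icc_succ_top (by omega), mul_add]
    have s : ∑ p ∈ (Finset.Ioc ⌊x / ((m + 1 : ℕ) + 1)⌋₊ ⌊x⌋₊).filter Nat.Prime, Int.fract (x / p) =
      ∑ p ∈ (Finset.Ioc ⌊x / ((m + 1 : ℕ) + 1)⌋₊ ⌊x / ((m + 1 : ℕ):ℝ)⌋₊).filter Nat.Prime, Int.fract (x / p) +
      ∑ p ∈ (Finset.Ioc ⌊x / ((m + 1 : ℕ):ℝ)⌋₊ ⌊x⌋₊).filter Nat.Prime, Int.fract (x / p) := by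
      simp only [sum_filter]
      rw [Finset.sum_Ioc_consecutive _ (Nat.floor_le_floor e1) (Nat.floor_le_floor e2)]
    rw [s, ← intervalIntegral.integral_add_adjacent_intervals (b := x / ((m + 1 : ℕ):ℝ))
      (fr_int x (by linarith) e1) (fr_int x (by linarith) e2)]
    rw [abs_le] at *
    constructor <;> linarith [ih.1, ih.2, hp.1, hp.2]

lemma total {x E : ℝ} (hx : 36 ≤ x) (hE : 0 ≤ E)
    (hθ : ∀ t, √x / 2 ≤ t → |theta t - t| ≤ E * t) :
    |(∑ p ∈ (range (⌊x⌋₊ + 1)).filter Nat.Prime, Int.fract (x / p)) - lif x| ≤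
      3 * √x + 6 * E * x * (1 + log x) := by
  set N := ⌊√x⌋₊ with hN
  have hx0 : 0 < x := by linarith
  have hs6 : 6 ≤ √x := by
    rw [show (6:ℝ) = √36 by rw [show (36:ℝ) = 6 ^ 2 by norm_num]; simp]; exact sqrt_le_sqrt hx
  have hss : √x * √x = x := mul_self_sqrt hx0.le
  have hN1 : (N:ℝ) ≤ √x := Nat.floor_le (by linarith)
  have hN2 : √x < N + 1 := Nat.lt_floor_add_one _
  set y := x / (N + 1) with hy
  have hy1 : √x / 2 ≤ y := by
    rw [hy, le_div_iff₀ (by linarith)]; nlinarith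
  have hy2 : y ≤ √x := by
    rw [hy, div_le_iff₀ (by linarith)]; nlinarith
  have hyx : y ≤ x := by nlinarith
  have key := pieces (x := x) (E := E) (N := N) (by linarith) hE (fun t ht => hθ t (hy1.trans ht)) N le_rfl
  rw [← hy] at key
  have hh : ∑ n ∈ Finset.Icc 1 N, 1 / (n:ℝ) ≤ 1 + log x := by
    have h := harmonic_le_one_add_log N
    rw [harmonic_eq_sum_Icc] at h
    push_cast at h
    simp only [one_div]
    have : log N ≤ log x := by
      apply log_le_log
      · have : (0:ℝ) < N := by linarith
        exact this
      · nlinarith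
    linarith
  have key2 : 6 * E * x * ∑ n ∈ Finset.Icc 1 N, 1 / (n:ℝ) ≤ 6 * E * x * (1 + log x) := by gcongr
  have s : ∑ p ∈ (range (⌊x⌋₊ + 1)).filter Nat.Prime, Int.fract (x / p) =
      ∑ p ∈ (Finset.Ioc 0 ⌊y⌋₊).filter Nat.Prime, Int.fract (x / p) +
      ∑ p ∈ (Finset.Ioc ⌊y⌋₊ ⌊x⌋₊).filter Nat.Prime, Int.fract (x / p) := by
    simp only [sum_filter]
    rw [Finset.sum_Ioc_consecutive _ (Nat.zero_le _) (Nat.floor_le_floor hyx)]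
    symm
    apply Finset.sum_subset
    · intro p; simp only [mem_Ioc, mem_range]; omega
    · intro p h1 h2
      simp only [mem_Ioc, mem_range] at h1 h2
      have : p = 0 := by omega
      subst this; simp
  have s0 : 0 ≤ ∑ p ∈ (Finset.Ioc 0 ⌊y⌋₊).filter Nat.Prime, Int.fract (x / p) :=
    sum_nonneg fun _ _ => Int.fract_nonneg _
  have s1 : ∑ p ∈ (Finset.Ioc 0 ⌊y⌋₊).filter Nat.Prime, Int.fract (x / p) ≤ √x := by
    calc _ ≤ ∑ p ∈ (Finset.Ioc 0 ⌊y⌋₊).filter Nat.Prime, (1:ℝ) :=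
          sum_le_sum fun _ _ => (Int.fract_lt_one _).le
      _ = ((Finset.Ioc 0 ⌊y⌋₊).filter Nat.Prime).card := by simp
      _ ≤ (Finset.Ioc 0 ⌊y⌋₊).card := by exact_mod_cast Finset.card_filter_le _ _
      _ = ⌊y⌋₊ := by simp
      _ ≤ y := Nat.floor_le (by linarith)
      _ ≤ _ := hy2
  have i : lif x = (∫ t in (2:ℝ)..y, Int.fract (x / t) / log t) +
      ∫ t in y..x, Int.fract (x / t) / log t := by
    rw [lif, intervalIntegral.integral_add_adjacent_intervals (fr_int x le_rfl (by linarith))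
      (fr_int x (by linarith) hyx)]
  have i1 : |∫ t in (2:ℝ)..y, Int.fract (x / t) / log t| ≤ 2 * √x := by
    have : ‖∫ t in (2:ℝ)..y, Int.fract (x / t) / log t‖ ≤ 2 * |y - 2| := by
      apply intervalIntegral.norm_integral_le_of_norm_le_const
      intro t ht
      rw [Set.uIoc_of_le (by linarith)] at ht
      have ht2 : log 2 ≤ log t := log_le_log (by norm_num) (by linarith [ht.1])
      have := log_two_gt_d9
      rw [norm_div, norm_eq_abs, norm_eq_abs, abs_of_nonneg (Int.fract_nonneg _),
        abs_of_pos (by linarith), div_le_iff₀ (by linarith)]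
      linarith [Int.fract_lt_one (x / t)]
    rw [abs_of_nonneg (by linarith : 0 ≤ y - 2), norm_eq_abs] at this
    linarith
  rw [s, i]
  rw [abs_le] at *
  constructor <;> linarith [key.1, key.2, i1.1, i1.2]

end VK

theorem sum_fract_x_div_p :
    ∀ ε > (0:ℝ), ∃ c > (0:ℝ), ∃ C > (0:ℝ), ∀ᶠ x : ℝ in atTop,
      |(∑ p ∈ (Finset.range (⌊x⌋₊ + 1)).filter Nat.Prime, Int.fract (x / p)) - lif x| ≤
        C * x * Real.exp (-c * (Real.log x) ^ ((3:ℝ)/5 - ε)) := by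
  intro ε hε
  obtain ⟨γ, g1, g2⟩ := exists_between (max_lt (by norm_num : (1/2:ℝ) < 3/5) (by linarith : 3/5 - ε < 3/5))
  obtain ⟨β, b1, b2⟩ := exists_between g2
  have g3 := (le_max_left _ _).trans_lt g1
  have g4 := (le_max_right _ _).trans_lt g1
  refine ⟨1, one_pos, 2, two_pos, ?_⟩
  obtain ⟨y₀, hy₀⟩ := eventually_atTop.1 (VK.theta_bound (g3.trans b1) b2)
  have hlog := Real.tendsto_log_atTop
  filter_upwards [eventually_ge_atTop ((2 * y₀) ^ 2), eventually_ge_atTop 36,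
    hlog.eventually_ge_atTop 1,
    hlog.eventually (VK.ev_rpow b1 8), hlog.eventually (VK.ev_rpow (by linarith : γ < 1) 4),
    hlog.eventually (VK.ev_exp (by linarith : 0 < γ) 1 12),
    hlog.eventually (VK.ev_exp (by linarith : 0 < γ) 0 3)] with x hx hx36 hT1 e1 e2 e3 e4
  rw [Real.rpow_one] at e2 e3
  rw [Real.rpow_zero, mul_one] at e4
  set T := Real.log x with hT
  have hx0 : 0 < x := by linarith
  have hxe : x = exp T := by rw [hT, Real.exp_log hx0]
  have hsq : √x = exp (T / 2) := by
    rw [Real.sqrt_eq_rpow, hxe, ← Real.exp_mul]; congr 1; ring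
  have hy : y₀ ≤ √x / 2 := by
    have := Real.le_sqrt_of_sq_le hx
    linarith
  have hl4 : T / 4 ≤ Real.log (√x / 2) := by
    rw [Real.log_div (by positivity) two_ne_zero, Real.log_sqrt hx0.le, ← hT]
    have e : (4:ℝ) * Real.log 2 = Real.log 16 := by
      rw [show (16:ℝ) = 2 ^ 4 by norm_num, Real.log_pow]; norm_num
    have : Real.log 16 ≤ T := Real.log_le_log (by norm_num) (by linarith)
    linarith
  have hsp : 0 < √x := Real.sqrt_pos.2 hx0
  have hθ : ∀ t, √x / 2 ≤ t → |Chebyshev.theta t - t| ≤ exp (-(T ^ β / 4)) * t := by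
    intro t ht
    have ht0 : 0 < t := by linarith
    refine (hy₀ t (hy.trans ht)).trans ?_
    rw [mul_comm]
    have hl : T / 4 ≤ Real.log t := hl4.trans (Real.log_le_log (by linarith) ht)
    have : T ^ β / 4 ≤ Real.log t ^ β := by
      calc T ^ β / 4 ≤ (1/4:ℝ) ^ β * T ^ β := by
            have : (1/4:ℝ) ^ (1:ℝ) ≤ (1/4:ℝ) ^ β :=
              Real.rpow_le_rpow_of_exponent_ge (by norm_num) (by norm_num) (by linarith)
            rw [Real.rpow_one] at this
            have : 0 ≤ T ^ β := by positivity
            nlinarith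
        _ = (T / 4) ^ β := by
            rw [← Real.mul_rpow (by norm_num) (by linarith)]; congr 1; ring
        _ ≤ _ := by gcongr; linarith
    gcongr
  have key := VK.total hx36 (exp_pos _).le hθ
  refine key.trans ?_
  have hfin : exp (-T ^ γ) ≤ exp (-1 * T ^ (3/5 - ε)) := by
    have := Real.rpow_le_rpow_of_exponent_le hT1 g4.le
    gcongr; linarith
  have A : 3 * √x ≤ x * exp (-T ^ γ) := by
    calc 3 * √x ≤ exp (T ^ γ) * exp (T / 2) := by rw [hsq]; gcongr
      _ ≤ exp (T + -T ^ γ) := by rw [← Real.exp_add]; exact Real.exp_le_exp.2 (by linarith)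
      _ = _ := by rw [Real.exp_add, ← hxe]
  have B : 6 * exp (-(T ^ β / 4)) * x * (1 + T) ≤ x * exp (-T ^ γ) := by
    calc 6 * exp (-(T ^ β / 4)) * x * (1 + T) = x * ((6 * (1 + T)) * exp (-(T ^ β / 4))) := by ring
      _ ≤ x * (exp (T ^ γ) * exp (-(T ^ β / 4))) := by gcongr; linarith
      _ ≤ _ := by rw [← Real.exp_add]; gcongr; linarith
  have D : x * exp (-T ^ γ) ≤ x * exp (-1 * T ^ (3/5 - ε)) := by gcongr
  linarith
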